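/- Let f ∈ M_p, 1<p<∞, α₁,α₂>0, n₁,n₂ ∈ ℕ. Then ω_{α₁,α₂}(f, 1/n₁, 1/n₂)_p ≍ n₁^{−α₁}n₂^{−α₂}{Σ_{ν₁=1}^{n₁}Σ_{ν₂=1}^{n₂} a_{ν₁,ν₂}^p ν₁^{(α₁+1)p−2} ν₂^{(α₂+1)p−2}}^{1/p} + n₁^{−α₁}{Σ_{ν₁=1}^{n₁}Σ_{ν₂=n₂+1}^∞ a_{ν₁,ν₂}^p ν₁^{(α₁+1)p−2} ν₂^{p−2}}^{1/p} + n₂^{−α₂}{Σ_{ν₁=n₁+1}^∞Σ_{ν₂=1}^{n₂} a_{ν₁,ν₂}^p ν₁^{p−2} ν₂^{(α₂+1)p−2}}^{1/p} + {Σ_{ν₁=n₁+1}^∞Σ_{ν₂=n₂+1}^∞ a_{ν₁,ν₂}^p (ν₁ν₂)^{p−2}}^{1/p}, with constants independent of f, n₁, n₂. -/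

import Mathlib

open MeasureTheory Real
open scoped ENNReal

noncomputable section

/-- The `L_p` norm of a function of two variables over the period square `(0,2π]²`. -/
def Lp2Norm (p : ℝ) (f : ℝ → ℝ → ℝ) : ℝ≥0∞ :=
  (∫⁻ x in Set.Ioc (0:ℝ) (2*π), ∫⁻ y in Set.Ioc (0:ℝ) (2*π),
      ENNReal.ofReal (|f x y| ^ p)) ^ (1/p)

/-- `f ∈ L_p^0(T²)`: measurable, `2π`-periodic in each variable, finite `L_p` norm,
and zero mean in each variable separately. -/
structure MemLp0 (p : ℝ) (f : ℝ → ℝ → ℝ) : Prop where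
  meas : Measurable (Function.uncurry f)
  periodic_x : ∀ y, Function.Periodic (fun x => f x y) (2*π)
  periodic_y : ∀ x, Function.Periodic (f x) (2*π)
  norm_ne_top : Lp2Norm p f ≠ ⊤
  mean_x : ∀ᵐ (y : ℝ) ∂volume, (∫ x in (0:ℝ)..(2*π), f x y) = 0
  mean_y : ∀ᵐ (x : ℝ) ∂volume, (∫ y in (0:ℝ)..(2*π), f x y) = 0

/-- Generalized (fractional) binomial coefficient `C(α,ν) = α(α-1)⋯(α-ν+1)/ν!`. -/
def fracBinom (α : ℝ) : ℕ → ℝ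
  | 0 => 1
  | n+1 => fracBinom α n * (α - (n : ℝ)) / ((n : ℝ) + 1)

/-- Fractional difference of order `α` with step `h` in the first variable. -/
def diffX (α h : ℝ) (f : ℝ → ℝ → ℝ) : ℝ → ℝ → ℝ :=
  fun x y => ∑' ν : ℕ, (-1 : ℝ) ^ ν * fracBinom α ν * f (x + (α - (ν : ℝ)) * h) y

/-- Fractional difference of order `α` with step `h` in the second variable. -/
def diffY (α h : ℝ) (f : ℝ → ℝ → ℝ) : ℝ → ℝ → ℝ :=
  fun x y => ∑' ν : ℕ, (-1 : ℝ) ^ ν * fracBinom α ν * f x (y + (α - (ν : ℝ)) * h)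

/-- The mixed (fractional) modulus of smoothness `ω_{α₁,α₂}(f, δ₁, δ₂)_p`. -/
def mixedMod (p α₁ α₂ δ₁ δ₂ : ℝ) (f : ℝ → ℝ → ℝ) : ℝ≥0∞ :=
  ⨆ (h₁ : ℝ) (_ : |h₁| ≤ δ₁) (h₂ : ℝ) (_ : |h₂| ≤ δ₂),
    Lp2Norm p (diffX α₁ h₁ (diffY α₂ h₂ f))

/-- Cosine-cosine Fourier coefficient `a_{n₁,n₂}` of `f`. -/
def fourierCC (f : ℝ → ℝ → ℝ) (n₁ n₂ : ℕ) : ℝ :=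
  (1/π^2) * ∫ x in (0:ℝ)..(2*π), ∫ y in (0:ℝ)..(2*π),
    f x y * Real.cos ((n₁ : ℝ) * x) * Real.cos ((n₂ : ℝ) * y)

/-- Sine-cosine Fourier coefficient `b_{n₁,n₂}` of `f`. -/
def fourierSC (f : ℝ → ℝ → ℝ) (n₁ n₂ : ℕ) : ℝ :=
  (1/π^2) * ∫ x in (0:ℝ)..(2*π), ∫ y in (0:ℝ)..(2*π),
    f x y * Real.sin ((n₁ : ℝ) * x) * Real.cos ((n₂ : ℝ) * y)

/-- Cosine-sine Fourier coefficient `c_{n₁,n₂}` of `f`. -/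
def fourierCS (f : ℝ → ℝ → ℝ) (n₁ n₂ : ℕ) : ℝ :=
  (1/π^2) * ∫ x in (0:ℝ)..(2*π), ∫ y in (0:ℝ)..(2*π),
    f x y * Real.cos ((n₁ : ℝ) * x) * Real.sin ((n₂ : ℝ) * y)

/-- Sine-sine Fourier coefficient `d_{n₁,n₂}` of `f`. -/
def fourierSS (f : ℝ → ℝ → ℝ) (n₁ n₂ : ℕ) : ℝ :=
  (1/π^2) * ∫ x in (0:ℝ)..(2*π), ∫ y in (0:ℝ)..(2*π),
    f x y * Real.sin ((n₁ : ℝ) * x) * Real.sin ((n₂ : ℝ) * y)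

/-- The class `M_p`: `f ∈ L_p^0(T²)` with a pure cosine-cosine Fourier series
`Σ a_{ν₁,ν₂} cos ν₁x cos ν₂y` whose coefficients have nonnegative mixed differences. -/
def InMclass (p : ℝ) (f : ℝ → ℝ → ℝ) (a : ℕ → ℕ → ℝ) : Prop :=
  MemLp0 p f ∧
  (∀ ν₁ ν₂ : ℕ, 1 ≤ ν₁ → 1 ≤ ν₂ → fourierCC f ν₁ ν₂ = a ν₁ ν₂) ∧
  (∀ n₁ n₂ : ℕ, fourierSC f n₁ n₂ = 0 ∧ fourierCS f n₁ n₂ = 0 ∧ fourierSS f n₁ n₂ = 0) ∧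
  (∀ ν₁ ν₂ : ℕ, 1 ≤ ν₁ → 1 ≤ ν₂ →
    0 ≤ a ν₁ ν₂ - a (ν₁+1) ν₂ - a ν₁ (ν₂+1) + a (ν₁+1) (ν₂+1))

/-- The four-term quantity of Theorem 7.2 for coefficients `a`. -/
def Mfun (a : ℕ → ℕ → ℝ) (p α₁ α₂ : ℝ) (n₁ n₂ : ℕ) : ℝ≥0∞ :=
  ENNReal.ofReal ((n₁:ℝ) ^ (-α₁) * (n₂:ℝ) ^ (-α₂)) *
    (∑ ν₁ ∈ Finset.Icc 1 n₁, ∑ ν₂ ∈ Finset.Icc 1 n₂,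
      ENNReal.ofReal (a ν₁ ν₂ ^ p * (ν₁:ℝ) ^ ((α₁+1)*p-2) * (ν₂:ℝ) ^ ((α₂+1)*p-2))) ^ (1/p)
  + ENNReal.ofReal ((n₁:ℝ) ^ (-α₁)) *
    (∑ ν₁ ∈ Finset.Icc 1 n₁, ∑' k : ℕ,
      ENNReal.ofReal (a ν₁ (n₂+1+k) ^ p * (ν₁:ℝ) ^ ((α₁+1)*p-2) *
        ((n₂+1+k : ℕ) : ℝ) ^ (p-2))) ^ (1/p)
  + ENNReal.ofReal ((n₂:ℝ) ^ (-α₂)) *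
    (∑ ν₂ ∈ Finset.Icc 1 n₂, ∑' k : ℕ,
      ENNReal.ofReal (a (n₁+1+k) ν₂ ^ p * ((n₁+1+k : ℕ) : ℝ) ^ (p-2) *
        (ν₂:ℝ) ^ ((α₂+1)*p-2))) ^ (1/p)
  + (∑' (j : ℕ) (k : ℕ),
      ENNReal.ofReal (a (n₁+1+j) (n₂+1+k) ^ p *
        (((n₁+1+j) * (n₂+1+k) : ℕ) : ℝ) ^ (p-2))) ^ (1/p)

/-- Schur's test for a nonnegative kernel, in the form of an `L_p` bound. -/
theorem lintegral_rpow_le_of_schur {X Y : Type*} [MeasurableSpace X] [MeasurableSpace Y]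
    (μ : Measure X) (ν : Measure Y) [SFinite μ] [SFinite ν] {p : ℝ} (hp : 1 < p)
    {k : X → Y → ℝ≥0∞} (hk : Measurable (Function.uncurry k))
    {u : X → ℝ≥0∞} (hu : Measurable u) {v : Y → ℝ≥0∞} (hv : Measurable v) (C₁ C₂ : ℝ≥0∞)
    (hu0 : ∀ᵐ x ∂μ, u x ≠ 0 ∧ u x ≠ ⊤)
    (h₁ : ∀ y, ∫⁻ x, k x y * u x ∂μ ≤ C₁ * v y)
    (h₂ : ∀ x, ∫⁻ y, k x y * v y ^ (p - 1) ∂ν ≤ C₂ * u x ^ (p - 1))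
    {g : X → ℝ≥0∞} (hg : Measurable g) :
    ∫⁻ y, (∫⁻ x, g x * k x y ∂μ) ^ p ∂ν ≤ C₁ ^ (p - 1) * C₂ * ∫⁻ x, g x ^ p ∂μ := by
  have hp0 : 0 < p := by linarith
  have hp1 : 0 < p - 1 := by linarith
  set q := p / (p - 1) with hq
  have hpq : q.HolderConjugate p := (Real.HolderConjugate.conjExponent hp).symm
  have hq0 : 0 < q := by positivity
  have hqp : 1 / q * p = p - 1 := by rw [hq]; field_simp
  have hqp1 : 1 / q + 1 / p = 1 := by simpa using hpq.inv_add_inv_eq_one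
  have hky : ∀ y, Measurable fun x => k x y := fun y => hk.of_uncurry_right
  have key : ∀ y, (∫⁻ x, g x * k x y ∂μ) ^ p ≤
      C₁ ^ (p - 1) * (v y ^ (p - 1) * ∫⁻ x, g x ^ p * k x y * u x ^ (-(p - 1)) ∂μ) := by
    intro y
    have e1 : ∫⁻ x, g x * k x y ∂μ = ∫⁻ x, ((fun x => (k x y * u x) ^ (1 / q)) *
        fun x => g x * k x y ^ (1 / p) * u x ^ (-(1 / q))) x ∂μ := by
      apply lintegral_congr_ae
      filter_upwards [hu0] with x hx
      have h3 : u x ^ (1 / q) * u x ^ (-(1 / q)) = 1 := by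
        rw [← ENNReal.rpow_add _ _ hx.1 hx.2]; simp
      have h4 : k x y ^ (1 / q) * k x y ^ (1 / p) = k x y := by
        rw [← ENNReal.rpow_add_of_nonneg _ _ (by positivity) (by positivity), hqp1,
          ENNReal.rpow_one]
      simp only [Pi.mul_apply]
      rw [ENNReal.mul_rpow_of_nonneg _ _ (by positivity)]
      calc g x * k x y = g x * (k x y ^ (1 / q) * k x y ^ (1 / p)) *
            (u x ^ (1 / q) * u x ^ (-(1 / q))) := by rw [h3, h4, mul_one]
        _ = _ := by ring
    have e2 := ENNReal.lintegral_mul_le_Lp_mul_Lq μ hpq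
      (f := fun x => (k x y * u x) ^ (1 / q))
      (g := fun x => g x * k x y ^ (1 / p) * u x ^ (-(1 / q)))
      (((hky y).mul hu).pow_const _).aemeasurable
      ((hg.mul ((hky y).pow_const _)).mul (hu.pow_const _)).aemeasurable
    have e3 : ∀ x, ((k x y * u x) ^ (1 / q)) ^ q = k x y * u x := by
      intro x
      rw [← ENNReal.rpow_mul, one_div, inv_mul_cancel₀ hq0.ne', ENNReal.rpow_one]
    have e4 : ∀ x, (g x * k x y ^ (1 / p) * u x ^ (-(1 / q))) ^ p =
        g x ^ p * k x y * u x ^ (-(p - 1)) := by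
      intro x
      rw [ENNReal.mul_rpow_of_nonneg _ _ hp0.le, ENNReal.mul_rpow_of_nonneg _ _ hp0.le,
        ← ENNReal.rpow_mul, ← ENNReal.rpow_mul, one_div, inv_mul_cancel₀ hp0.ne',
        ENNReal.rpow_one, neg_mul, ← hqp]
    simp only [e3, e4] at e2
    rw [e1]
    calc _ ≤ ((∫⁻ x, k x y * u x ∂μ) ^ (1 / q) *
          (∫⁻ x, g x ^ p * k x y * u x ^ (-(p - 1)) ∂μ) ^ (1 / p)) ^ p := by gcongr
      _ = (∫⁻ x, k x y * u x ∂μ) ^ (p - 1) *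
          (∫⁻ x, g x ^ p * k x y * u x ^ (-(p - 1)) ∂μ) := by
        rw [ENNReal.mul_rpow_of_nonneg _ _ hp0.le, ← ENNReal.rpow_mul, ← ENNReal.rpow_mul, hqp,
          one_div_mul_cancel hp0.ne', ENNReal.rpow_one]
      _ ≤ (C₁ * v y) ^ (p - 1) * (∫⁻ x, g x ^ p * k x y * u x ^ (-(p - 1)) ∂μ) := by
        gcongr; exact h₁ y
      _ = _ := by rw [ENNReal.mul_rpow_of_nonneg _ _ hp1.le, mul_assoc]
  have hm : Measurable (Function.uncurry fun (y : Y) (x : X) =>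
      v y ^ (p - 1) * (g x ^ p * k x y * u x ^ (-(p - 1)))) := by
    have : Measurable fun z : Y × X => k z.2 z.1 := hk.comp measurable_swap
    unfold Function.uncurry
    fun_prop
  calc _ ≤ ∫⁻ y, C₁ ^ (p - 1) *
        (v y ^ (p - 1) * ∫⁻ x, g x ^ p * k x y * u x ^ (-(p - 1)) ∂μ) ∂ν := lintegral_mono key
    _ = C₁ ^ (p - 1) *
        ∫⁻ y, ∫⁻ x, v y ^ (p - 1) * (g x ^ p * k x y * u x ^ (-(p - 1))) ∂μ ∂ν := by
      have hm2 : ∀ y, Measurable fun x => g x ^ p * k x y * u x ^ (-(p - 1)) := by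
        intro y
        have := hky y
        fun_prop
      rw [← lintegral_const_mul _ hm.lintegral_prod_right]
      simp_rw [lintegral_const_mul _ (hm2 _)]
    _ = C₁ ^ (p - 1) *
        ∫⁻ x, ∫⁻ y, v y ^ (p - 1) * (g x ^ p * k x y * u x ^ (-(p - 1))) ∂ν ∂μ := by
      rw [lintegral_lintegral_swap hm.aemeasurable]
    _ ≤ C₁ ^ (p - 1) * ∫⁻ x, C₂ * g x ^ p ∂μ := by
      gcongr 1
      apply lintegral_mono_ae
      filter_upwards [hu0] with x hx
      have hkx : Measurable fun y => k x y := hk.of_uncurry_left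
      have h3 : u x ^ (p - 1) * u x ^ (-(p - 1)) = 1 := by
        rw [← ENNReal.rpow_add _ _ hx.1 hx.2]; simp
      calc ∫⁻ y, v y ^ (p - 1) * (g x ^ p * k x y * u x ^ (-(p - 1))) ∂ν
          = ∫⁻ y, (g x ^ p * u x ^ (-(p - 1))) * (k x y * v y ^ (p - 1)) ∂ν := by
            congr 1; ext y; ring
        _ = (g x ^ p * u x ^ (-(p - 1))) * ∫⁻ y, (k x y * v y ^ (p - 1)) ∂ν := by
            rw [lintegral_const_mul]; fun_prop
        _ ≤ (g x ^ p * u x ^ (-(p - 1))) * (C₂ * u x ^ (p - 1)) := by gcongr; exact h₂ x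
        _ = C₂ * g x ^ p * (u x ^ (p - 1) * u x ^ (-(p - 1))) := by ring
        _ = _ := by rw [h3, mul_one]
    _ = _ := by rw [lintegral_const_mul _ (hg.pow_const _), mul_assoc]

/-- The scaling integral behind the Hardy-type kernel `min (t, R)`. -/
theorem lintegral_Ioi_rpow_mul_min_le {γ : ℝ} (h0 : 0 < γ) (h1 : γ < 1) {R : ℝ} (hR : 0 < R) :
    ∫⁻ t in Set.Ioi (0:ℝ), ENNReal.ofReal (t ^ (γ - 2) * min t R) ≤
      ENNReal.ofReal ((1 / γ + 1 / (1 - γ)) * R ^ γ) := by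
  have hsplit : Set.Ioi (0:ℝ) = Set.Ioc 0 R ∪ Set.Ioi R := (Set.Ioc_union_Ioi_eq_Ioi hR.le).symm
  rw [hsplit, lintegral_union measurableSet_Ioi (Set.Ioc_disjoint_Ioi le_rfl)]
  have hI : IntervalIntegrable (fun t : ℝ => t ^ (γ - 1)) volume 0 R :=
    intervalIntegral.intervalIntegrable_rpow' (by linarith)
  have hA : ∫⁻ t in Set.Ioc (0:ℝ) R, ENNReal.ofReal (t ^ (γ - 2) * min t R) ≤
      ENNReal.ofReal (1 / γ * R ^ γ) := by
    calc _ ≤ ∫⁻ t in Set.Ioc (0:ℝ) R, ENNReal.ofReal (t ^ (γ - 1)) := by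
          apply setLIntegral_mono' measurableSet_Ioc
          intro t ht
          apply ENNReal.ofReal_le_ofReal
          rw [min_eq_left ht.2]
          apply le_of_eq
          rw [← Real.rpow_add_one ht.1.ne']; ring_nf
      _ = ENNReal.ofReal (∫ t in Set.Ioc (0:ℝ) R, t ^ (γ - 1)) := by
          rw [ofReal_integral_eq_lintegral_ofReal]
          · exact (intervalIntegrable_iff_integrableOn_Ioc_of_le hR.le).1 hI
          · exact (ae_restrict_mem measurableSet_Ioc).mono fun t ht =>
              Real.rpow_nonneg ht.1.le _
      _ ≤ _ := by
          rw [← intervalIntegral.integral_of_le hR.le, integral_rpow (Or.inl (by linarith))]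
          apply ENNReal.ofReal_le_ofReal
          simp [h0.ne']
          apply le_of_eq; field_simp
  have hB : ∫⁻ t in Set.Ioi R, ENNReal.ofReal (t ^ (γ - 2) * min t R) ≤
      ENNReal.ofReal (1 / (1 - γ) * R ^ γ) := by
    calc _ ≤ ∫⁻ t in Set.Ioi R, ENNReal.ofReal (R * t ^ (γ - 2)) := by
          apply setLIntegral_mono' measurableSet_Ioi
          intro t ht
          apply ENNReal.ofReal_le_ofReal
          rw [mul_comm]
          have : 0 ≤ t ^ (γ - 2) := Real.rpow_nonneg (hR.le.trans (le_of_lt ht)) _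
          gcongr; exact min_le_right _ _
      _ = ENNReal.ofReal (∫ t in Set.Ioi R, R * t ^ (γ - 2)) := by
          rw [ofReal_integral_eq_lintegral_ofReal]
          · exact (integrableOn_Ioi_rpow_of_lt (by linarith) hR).const_mul _
          · exact (ae_restrict_mem measurableSet_Ioi).mono fun t ht =>
              mul_nonneg hR.le (Real.rpow_nonneg (hR.le.trans (le_of_lt ht)) _)
      _ ≤ _ := by
          rw [integral_const_mul, integral_Ioi_rpow_of_lt (by linarith) hR]
          apply ENNReal.ofReal_le_ofReal
          apply le_of_eq
          have h3 : R ^ γ = R * R ^ (γ - 2 + 1) := by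
            rw [mul_comm, ← Real.rpow_add_one hR.ne']; ring_nf
          have : γ - 2 + 1 ≠ 0 := by linarith
          have : 1 - γ ≠ 0 := by linarith
          rw [h3]; field_simp; ring
  have : 0 < 1 - γ := by linarith
  calc _ ≤ _ := add_le_add hA hB
    _ = _ := by rw [← ENNReal.ofReal_add (by positivity) (by positivity)]; ring_nf

/-- Lebesgue measure on one period. -/
abbrev periodMeasure : Measure ℝ := volume.restrict (Set.Ioc 0 (2 * π))

/-- The frequency `i + 1` as an extended nonnegative real. -/
abbrev freq (i : ℕ) : ℝ≥0∞ := ((i + 1 : ℕ) : ℝ≥0∞)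

/-- The majorant `min (i + 1, 1 / |sin (x / 2)|)` of the Dirichlet sums of `i + 1` terms. -/
def dirichletMajorant (i : ℕ) (x : ℝ) : ℝ≥0∞ :=
  min (freq i) (ENNReal.ofReal |sin (x / 2)|)⁻¹

theorem freq_ne_zero (i : ℕ) : freq i ≠ 0 := by simp [freq]

theorem freq_ne_top (i : ℕ) : freq i ≠ ⊤ := by simp [freq]

theorem freq_eq_ofReal (i : ℕ) : freq i = ENNReal.ofReal ((i : ℝ) + 1) := by
  rw [freq, ← ENNReal.ofReal_natCast]; push_cast; rfl

theorem freq_rpow (i : ℕ) (r : ℝ) : freq i ^ r = ENNReal.ofReal (((i : ℝ) + 1) ^ r) := by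
  rw [freq_eq_ofReal, ENNReal.ofReal_rpow_of_pos (by positivity)]

theorem freq_rpow_mul (i : ℕ) (r s : ℝ) : freq i ^ r * freq i ^ s = freq i ^ (r + s) :=
  (ENNReal.rpow_add _ _ (freq_ne_zero i) (freq_ne_top i)).symm

theorem measurable_dirichletMajorant (i : ℕ) : Measurable (dirichletMajorant i) := by
  unfold dirichletMajorant
  fun_prop

theorem dirichletMajorant_eq_ofReal (i : ℕ) {x : ℝ} (hx : 0 < |sin (x / 2)|) :
    dirichletMajorant i x = ENNReal.ofReal (min ((i : ℝ) + 1) (1 / |sin (x / 2)|)) := by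
  rw [dirichletMajorant, ENNReal.ofReal_min, freq_eq_ofReal, one_div,
    ENNReal.ofReal_inv_of_pos hx]

theorem tsum_freq_rpow_mul_dirichletMajorant_le {γ : ℝ} (h0 : 0 < γ) (h1 : γ < 1) (x : ℝ) :
    ∑' i : ℕ, freq i ^ (γ - 2) * dirichletMajorant i x ≤
      ENNReal.ofReal (1 / γ + 1 / (1 - γ)) * ENNReal.ofReal |sin (x / 2)| ^ (-γ) := by
  have h1' : 0 < 1 - γ := by linarith
  have hc : 0 < 1 / γ + 1 / (1 - γ) := by positivity
  rcases (abs_nonneg (sin (x / 2))).eq_or_lt with hs | hs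
  · rw [← hs, ENNReal.ofReal_zero, ENNReal.zero_rpow_of_neg (by linarith), ENNReal.mul_top]
    · exact le_top
    · simpa using hc
  set R := 1 / |sin (x / 2)| with hR
  have hR0 : 0 < R := by positivity
  have hterm : ∀ i : ℕ, freq i ^ (γ - 2) * dirichletMajorant i x ≤
      ∫⁻ t in Set.Ioc (i : ℝ) (i + 1), ENNReal.ofReal (t ^ (γ - 2) * min t R) := by
    intro i
    rw [dirichletMajorant_eq_ofReal i hs, freq_rpow, ← ENNReal.ofReal_mul (by positivity), ← hR]
    calc _ = ∫⁻ t in Set.Ioc (i : ℝ) (i + 1),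
          ENNReal.ofReal (((i : ℝ) + 1) ^ (γ - 2) * min ((i : ℝ) + 1) R) := by
          simp
      _ ≤ _ := by
          apply setLIntegral_mono' measurableSet_Ioc
          intro t ht
          have ht0 : 0 < t := lt_of_le_of_lt (Nat.cast_nonneg i) ht.1
          apply ENNReal.ofReal_le_ofReal
          have hi : (0:ℝ) < i + 1 := by positivity
          have e : ∀ s : ℝ, 0 < s →
              s ^ (γ - 2) * min s R = min (s ^ (γ - 1)) (s ^ (γ - 2) * R) := by
            intro s hs
            rw [mul_min_of_nonneg _ _ (Real.rpow_nonneg hs.le _), ← Real.rpow_add_one hs.ne']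
            ring_nf
          rw [e _ hi, e _ ht0]
          apply min_le_min
          · exact Real.rpow_le_rpow_of_nonpos ht0 ht.2 (by linarith)
          · exact mul_le_mul_of_nonneg_right
              (Real.rpow_le_rpow_of_nonpos ht0 ht.2 (by linarith)) hR0.le
  calc _ ≤ ∑' i : ℕ, ∫⁻ t in Set.Ioc (i : ℝ) (i + 1), ENNReal.ofReal (t ^ (γ - 2) * min t R) :=
        ENNReal.tsum_le_tsum hterm
    _ = ∫⁻ t in ⋃ i : ℕ, Set.Ioc (i : ℝ) (i + 1), ENNReal.ofReal (t ^ (γ - 2) * min t R) := by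
        rw [lintegral_iUnion (fun _ => measurableSet_Ioc)]
        intro i j hij
        refine Set.disjoint_left.2 fun t hi hj => ?_
        rcases lt_or_gt_of_ne hij with h | h
        · have : (i : ℝ) + 1 ≤ j := by exact_mod_cast h
          linarith [hi.2, hj.1]
        · have : (j : ℝ) + 1 ≤ i := by exact_mod_cast h
          linarith [hj.2, hi.1]
    _ ≤ ∫⁻ t in Set.Ioi (0:ℝ), ENNReal.ofReal (t ^ (γ - 2) * min t R) := by
        apply lintegral_mono_set
        intro t ht
        obtain ⟨i, hi⟩ := Set.mem_iUnion.1 ht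
        exact lt_of_le_of_lt (Nat.cast_nonneg i) hi.1
    _ ≤ ENNReal.ofReal ((1 / γ + 1 / (1 - γ)) * R ^ γ) := lintegral_Ioi_rpow_mul_min_le h0 h1 hR0
    _ = _ := by
        rw [ENNReal.ofReal_mul hc.le, ENNReal.ofReal_rpow_of_pos hs, hR, one_div |sin (x / 2)|,
          Real.inv_rpow hs.le, Real.rpow_neg hs.le]

theorem lintegral_dirichletMajorant_mul_rpow_le {γ : ℝ} (h0 : 0 < γ) (h1 : γ < 1) (i : ℕ) :
    ∫⁻ x, dirichletMajorant i x * ENNReal.ofReal |sin (x / 2)| ^ (-γ) ∂periodMeasure ≤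
      ENNReal.ofReal (2 * π ^ 2 * (1 / γ + 1 / (1 - γ))) * freq i ^ γ := by
  have h1' : 0 < 1 - γ := by linarith
  have hc : 0 < 1 / γ + 1 / (1 - γ) := by positivity
  set K : ℝ := (i : ℝ) + 1 with hK
  have hK0 : 0 < K := by positivity
  set ψ : ℝ → ℝ≥0∞ := (Set.Ioi (0:ℝ)).indicator fun t =>
    ENNReal.ofReal (π ^ 2 * K) * ENNReal.ofReal (t ^ ((1 - γ) - 2) * min t (1 / K)) with hψ
  have hψm : Measurable ψ := by
    apply Measurable.indicator _ measurableSet_Ioi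
    fun_prop
  have hbound : ∀ x t : ℝ, 0 < t → t / π ≤ |sin (x / 2)| →
      dirichletMajorant i x * ENNReal.ofReal |sin (x / 2)| ^ (-γ) ≤ ψ t := by
    intro x t ht hs
    have hs0 : 0 < |sin (x / 2)| := lt_of_lt_of_le (by positivity) hs
    rw [dirichletMajorant_eq_ofReal i hs0, ENNReal.ofReal_rpow_of_pos hs0,
      ← ENNReal.ofReal_mul (by positivity), hψ,
      Set.indicator_of_mem (show t ∈ Set.Ioi 0 from ht), ← ENNReal.ofReal_mul (by positivity)]
    apply ENNReal.ofReal_le_ofReal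
    have e1 : min K (1 / |sin (x / 2)|) ≤ π * (K / t * min t (1 / K)) := by
      have : K / t * min t (1 / K) = min K (1 / t) := by
        rw [mul_min_of_nonneg _ _ (by positivity)]; congr 1 <;> field_simp
      rw [this, mul_min_of_nonneg _ _ pi_pos.le]
      apply min_le_min
      · nlinarith [pi_gt_three]
      · calc 1 / |sin (x / 2)| ≤ 1 / (t / π) := by gcongr
          _ = _ := by field_simp
    have e2 : |sin (x / 2)| ^ (-γ) ≤ π * t ^ (-γ) := by
      calc |sin (x / 2)| ^ (-γ) ≤ (t / π) ^ (-γ) :=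
            Real.rpow_le_rpow_of_nonpos (by positivity) hs (by linarith)
        _ = π ^ γ * t ^ (-γ) := by
            rw [Real.div_rpow ht.le pi_pos.le, Real.rpow_neg pi_pos.le γ]; field_simp
        _ ≤ π ^ (1:ℝ) * t ^ (-γ) := by
            have := Real.rpow_le_rpow_of_exponent_le (by linarith [pi_gt_three] : 1 ≤ π) h1.le
            gcongr
        _ = _ := by rw [Real.rpow_one]
    have e3 : t ^ ((1 - γ) - 2) = t ^ (-γ) / t := by
      rw [← Real.rpow_sub_one ht.ne']; ring_nf
    calc _ ≤ (π * (K / t * min t (1 / K))) * (π * t ^ (-γ)) := by gcongr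
      _ = _ := by rw [e3]; ring
  have hle : ∀ x ∈ Set.Ioo (0:ℝ) (2 * π),
      dirichletMajorant i x * ENNReal.ofReal |sin (x / 2)| ^ (-γ) ≤ ψ x + ψ (2 * π - x) := by
    intro x hx
    rcases le_total x π with h | h
    · refine (hbound x x hx.1 ?_).trans le_self_add
      have := Real.mul_le_sin (x := x / 2) (by linarith [hx.1]) (by linarith)
      refine le_trans (le_of_eq ?_) (this.trans (le_abs_self _))
      field_simp
    · refine (hbound x (2 * π - x) (by linarith [hx.2]) ?_).trans le_add_self
      have := Real.mul_le_sin (x := π - x / 2) (by linarith [hx.2]) (by linarith)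
      rw [Real.sin_pi_sub] at this
      refine le_trans (le_of_eq ?_) (this.trans (le_abs_self _))
      field_simp
  have hψI : ∫⁻ x, ψ x ≤ ENNReal.ofReal (π ^ 2 * (1 / γ + 1 / (1 - γ)) * K ^ γ) := by
    rw [hψ, lintegral_indicator measurableSet_Ioi, lintegral_const_mul _ (by fun_prop)]
    calc _ ≤ ENNReal.ofReal (π ^ 2 * K) * ENNReal.ofReal
          ((1 / (1 - γ) + 1 / (1 - (1 - γ))) * (1 / K) ^ (1 - γ)) := by
          gcongr
          exact lintegral_Ioi_rpow_mul_min_le h1' (by linarith) (by positivity)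
      _ = _ := by
          rw [← ENNReal.ofReal_mul (by positivity), one_div K, Real.inv_rpow hK0.le,
            ← Real.rpow_neg hK0.le]
          congr 1
          have : K ^ γ = K * K ^ (-(1 - γ)) := by
            rw [mul_comm, ← Real.rpow_add_one hK0.ne']; ring_nf
          rw [this]; ring_nf
  calc _ = ∫⁻ x in Set.Ioo 0 (2 * π),
        dirichletMajorant i x * ENNReal.ofReal |sin (x / 2)| ^ (-γ) := by
        rw [periodMeasure, restrict_Ioo_eq_restrict_Ioc]
    _ ≤ ∫⁻ x in Set.Ioo 0 (2 * π), (ψ x + ψ (2 * π - x)) :=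
        setLIntegral_mono' measurableSet_Ioo hle
    _ ≤ ∫⁻ x, (ψ x + ψ (2 * π - x)) := setLIntegral_le_lintegral _ _
    _ = 2 * ∫⁻ x, ψ x := by
        rw [lintegral_add_left hψm, lintegral_sub_left_eq_self, two_mul]
    _ ≤ 2 * ENNReal.ofReal (π ^ 2 * (1 / γ + 1 / (1 - γ)) * K ^ γ) := by gcongr
    _ = _ := by
        rw [freq_rpow, ← ENNReal.ofReal_mul (by positivity), ← ENNReal.ofReal_ofNat 2,
          ← ENNReal.ofReal_mul (by positivity)]
        congr 1; ring

theorem ae_sin_half_ne_zero : ∀ᵐ x ∂periodMeasure, sin (x / 2) ≠ 0 := by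
  rw [periodMeasure, ← restrict_Ioo_eq_restrict_Ioc]
  filter_upwards [ae_restrict_mem measurableSet_Ioo] with x hx
  exact (Real.sin_pos_of_pos_of_lt_pi (by linarith [hx.1]) (by linarith [hx.2])).ne'

/-- Hardy-type inequality: the moments of `g` against the Dirichlet majorants. -/
theorem exists_tsum_lintegral_mul_dirichletMajorant_le {p : ℝ} (hp : 1 < p) :
    ∃ C : ℝ≥0∞, C ≠ ⊤ ∧ ∀ g : ℝ → ℝ≥0∞, Measurable g →
      ∑' i, freq i ^ (-2 : ℝ) * (∫⁻ x, g x * dirichletMajorant i x ∂periodMeasure) ^ p ≤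
        C * ∫⁻ x, g x ^ p ∂periodMeasure := by
  have hp0 : 0 < p := by linarith
  have hp1 : 1 / p < 1 := by rw [div_lt_one hp0]; exact hp
  have hp1' : 0 < 1 / p := by positivity
  refine ⟨ENNReal.ofReal (2 * π ^ 2 * (1 / (1 / p) + 1 / (1 - 1 / p))) ^ (p - 1) *
    ENNReal.ofReal (1 / (1 - 1 / p) + 1 / (1 - (1 - 1 / p))), ?_, ?_⟩
  · exact ENNReal.mul_ne_top
      (ENNReal.rpow_ne_top_of_nonneg (by linarith) ENNReal.ofReal_ne_top) ENNReal.ofReal_ne_top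
  intro g hg
  have := lintegral_rpow_le_of_schur periodMeasure (Measure.count : Measure ℕ) hp
    (k := fun x i => freq i ^ (-2 / p) * dirichletMajorant i x)
    (by
      apply measurable_from_prod_countable_left
      intro i
      have := measurable_dirichletMajorant i
      simp only [Function.uncurry_apply_pair]
      fun_prop)
    (u := fun x => ENNReal.ofReal |sin (x / 2)| ^ (-(1 / p))) (by fun_prop)
    (v := fun i => freq i ^ (-(1 / p))) (measurable_from_top)
    (ENNReal.ofReal (2 * π ^ 2 * (1 / (1 / p) + 1 / (1 - 1 / p))))
    (ENNReal.ofReal (1 / (1 - 1 / p) + 1 / (1 - (1 - 1 / p))))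
    (by
      filter_upwards [ae_sin_half_ne_zero] with x hx
      have : 0 < |sin (x / 2)| := by positivity
      rw [ENNReal.ofReal_rpow_of_pos this]
      refine ⟨?_, ENNReal.ofReal_ne_top⟩
      simp only [ne_eq, ENNReal.ofReal_eq_zero, not_le]
      positivity)
    (by
      intro i
      simp_rw [mul_assoc]
      rw [lintegral_const_mul _ (by have := measurable_dirichletMajorant i; fun_prop)]
      calc _ ≤ freq i ^ (-2 / p) *
            (ENNReal.ofReal (2 * π ^ 2 * (1 / (1 / p) + 1 / (1 - 1 / p))) * freq i ^ (1 / p)) := by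
            gcongr
            exact lintegral_dirichletMajorant_mul_rpow_le hp1' hp1 i
        _ = ENNReal.ofReal (2 * π ^ 2 * (1 / (1 / p) + 1 / (1 - 1 / p))) *
            (freq i ^ (-2 / p) * freq i ^ (1 / p)) := by ring
        _ = _ := by rw [freq_rpow_mul]; congr 2; field_simp; ring)
    (by
      intro x
      rw [lintegral_count]
      have e : ∀ i, freq i ^ (-2 / p) * dirichletMajorant i x * (freq i ^ (-(1 / p))) ^ (p - 1) =
          freq i ^ ((1 - 1 / p) - 2) * dirichletMajorant i x := by
        intro i
        rw [← ENNReal.rpow_mul, mul_right_comm, freq_rpow_mul]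
        congr 2; field_simp; ring
      simp_rw [e]
      refine (tsum_freq_rpow_mul_dirichletMajorant_le (by linarith) (by linarith) x).trans
        (le_of_eq ?_)
      rw [← ENNReal.rpow_mul]
      congr 2; field_simp)
    hg
  rw [lintegral_count] at this
  refine le_trans (le_of_eq ?_) this
  congr 1; ext i
  have e : ∀ x, g x * (freq i ^ (-2 / p) * dirichletMajorant i x) =
      freq i ^ (-2 / p) * (g x * dirichletMajorant i x) := fun x => by ring
  simp_rw [e]
  rw [lintegral_const_mul _ (by have := measurable_dirichletMajorant i; fun_prop),
    ENNReal.mul_rpow_of_nonneg _ _ hp0.le, ← ENNReal.rpow_mul, div_mul_cancel₀ _ hp0.ne']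

/-- Hardy-type inequality: sums of Dirichlet majorants in `L_p`. -/
theorem exists_lintegral_tsum_mul_dirichletMajorant_le {p : ℝ} (hp : 1 < p) :
    ∃ C : ℝ≥0∞, C ≠ ⊤ ∧ ∀ b : ℕ → ℝ≥0∞,
      ∫⁻ x, (∑' i, b i * (freq i ^ (-1 : ℝ) * dirichletMajorant i x)) ^ p ∂periodMeasure ≤
        C * ∑' i, b i ^ p * freq i ^ (p - 2) := by
  have hp0 : 0 < p := by linarith
  have hp1 : 1 / p < 1 := by rw [div_lt_one hp0]; exact hp
  have hp1' : 0 < 1 / p := by positivity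
  refine ⟨ENNReal.ofReal (1 / (1 / p) + 1 / (1 - 1 / p)) ^ (p - 1) *
    ENNReal.ofReal (2 * π ^ 2 * (1 / (1 - 1 / p) + 1 / (1 - (1 - 1 / p)))), ?_, ?_⟩
  · exact ENNReal.mul_ne_top
      (ENNReal.rpow_ne_top_of_nonneg (by linarith) ENNReal.ofReal_ne_top) ENNReal.ofReal_ne_top
  intro b
  have := lintegral_rpow_le_of_schur (Measure.count : Measure ℕ) periodMeasure hp
    (k := fun i x => freq i ^ (-2 + 2 / p) * dirichletMajorant i x)
    (by
      apply measurable_from_prod_countable_right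
      intro i
      have := measurable_dirichletMajorant i
      simp only [Function.uncurry_apply_pair]
      fun_prop)
    (u := fun i => freq i ^ (-(1 / p))) (measurable_from_top)
    (v := fun x => ENNReal.ofReal |sin (x / 2)| ^ (-(1 / p))) (by fun_prop)
    (ENNReal.ofReal (1 / (1 / p) + 1 / (1 - 1 / p)))
    (ENNReal.ofReal (2 * π ^ 2 * (1 / (1 - 1 / p) + 1 / (1 - (1 - 1 / p)))))
    (by
      refine Filter.Eventually.of_forall fun i => ⟨?_, ?_⟩
      · exact (ENNReal.rpow_pos (pos_iff_ne_zero.2 (freq_ne_zero i)) (freq_ne_top i)).ne'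
      · rw [freq_rpow]; exact ENNReal.ofReal_ne_top)
    (by
      intro x
      rw [lintegral_count]
      have e : ∀ i, freq i ^ (-2 + 2 / p) * dirichletMajorant i x * freq i ^ (-(1 / p)) =
          freq i ^ (1 / p - 2) * dirichletMajorant i x := by
        intro i
        rw [mul_right_comm, freq_rpow_mul]
        congr 2; ring
      simp_rw [e]
      exact tsum_freq_rpow_mul_dirichletMajorant_le hp1' hp1 x)
    (by
      intro i
      have e : ∀ x : ℝ, (ENNReal.ofReal |sin (x / 2)| ^ (-(1 / p))) ^ (p - 1) =
          ENNReal.ofReal |sin (x / 2)| ^ (-(1 - 1 / p)) := by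
        intro x
        rw [← ENNReal.rpow_mul]; congr 1; field_simp
      simp_rw [e, mul_assoc]
      rw [lintegral_const_mul _ (by have := measurable_dirichletMajorant i; fun_prop)]
      calc _ ≤ freq i ^ (-2 + 2 / p) *
            (ENNReal.ofReal (2 * π ^ 2 * (1 / (1 - 1 / p) + 1 / (1 - (1 - 1 / p)))) *
              freq i ^ (1 - 1 / p)) := by
            gcongr
            exact lintegral_dirichletMajorant_mul_rpow_le (by linarith) (by linarith) i
        _ = ENNReal.ofReal (2 * π ^ 2 * (1 / (1 - 1 / p) + 1 / (1 - (1 - 1 / p)))) *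
            (freq i ^ (-2 + 2 / p) * freq i ^ (1 - 1 / p)) := by ring
        _ = _ := by
            have e2 : -2 + 2 / p + (1 - 1 / p) = -(1 / p) * (p - 1) := by field_simp; ring
            rw [freq_rpow_mul, ← ENNReal.rpow_mul, e2, mul_assoc 2 (π ^ 2)])
    (g := fun i => b i * freq i ^ (1 - 2 / p)) measurable_from_top
  simp only [lintegral_count] at this
  refine le_trans (le_of_eq ?_) (this.trans (le_of_eq ?_))
  · congr 1; ext x; congr 2; ext i
    rw [mul_assoc, ← mul_assoc (freq i ^ (1 - 2 / p)), freq_rpow_mul]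
    congr 3; ring
  · congr 2; ext i
    rw [ENNReal.mul_rpow_of_nonneg _ _ hp0.le, ← ENNReal.rpow_mul]
    congr 2; field_simp

theorem lintegral_periodMeasure_add {g : ℝ → ℝ≥0∞}
    (hper : Function.Periodic g (2 * π)) (s : ℝ) :
    ∫⁻ x, g (x + s) ∂periodMeasure = ∫⁻ x, g x ∂periodMeasure := by
  have : Fact (0 < 2 * π) := ⟨by positivity⟩
  have h1 := AddCircle.lintegral_preimage (2 * π) 0 hper.lift
  have h2 := AddCircle.lintegral_preimage (2 * π) 0 fun b => hper.lift (b + (s : AddCircle (2 * π)))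
  rw [lintegral_add_right_eq_self (fun b => hper.lift b)] at h2
  rw [← h1, zero_add] at h2
  exact h2

theorem lintegral_mul_comp_add {g φ : ℝ → ℝ≥0∞}
    (hgp : Function.Periodic g (2 * π)) (hφp : Function.Periodic φ (2 * π)) (s : ℝ) :
    ∫⁻ x, g x * φ (x + s) ∂periodMeasure = ∫⁻ x, g (x - s) * φ x ∂periodMeasure := by
  rw [← lintegral_periodMeasure_add (g := fun x => g (x - s) * φ x) _ s]
  · simp
  · intro x
    simp only
    rw [hφp x, show x + 2 * π - s = x - s + 2 * π by ring, hgp]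

/-- Jensen's inequality for a countable family of weights. -/
theorem ENNReal.tsum_mul_rpow_le {ι : Type*} {p : ℝ} (hp : 1 < p) (b z : ι → ℝ≥0∞) :
    (∑' ν, b ν * z ν) ^ p ≤ (∑' ν, b ν) ^ (p - 1) * ∑' ν, b ν * z ν ^ p := by
  have hp0 : 0 < p := by linarith
  rw [← ENNReal.le_rpow_inv_iff hp0]
  have hfin : ∀ s : Finset ι, ∑ ν ∈ s, b ν * z ν ≤
      ((∑' ν, b ν) ^ (p - 1) * ∑' ν, b ν * z ν ^ p) ^ p⁻¹ := by
    intro s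
    refine (ENNReal.inner_le_weight_mul_Lp_of_nonneg s hp.le b z).trans ?_
    rw [ENNReal.mul_rpow_of_nonneg _ _ (by positivity), ← ENNReal.rpow_mul]
    have e : (p - 1) * p⁻¹ = 1 - p⁻¹ := by field_simp
    rw [e]
    have : 0 ≤ 1 - p⁻¹ := by rw [← e]; exact mul_nonneg (by linarith) (by positivity)
    gcongr
    · exact ENNReal.sum_le_tsum s
    · exact ENNReal.sum_le_tsum s
  rw [ENNReal.tsum_eq_iSup_sum]
  exact iSup_le hfin

/-- A positive combination of translates. -/
def translateSum (b : ℕ → ℝ≥0∞) (s : ℕ → ℝ) (g : ℝ → ℝ≥0∞) (x : ℝ) : ℝ≥0∞ :=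
  ∑' ν, b ν * g (x + s ν)

theorem measurable_translateSum (b : ℕ → ℝ≥0∞) (s : ℕ → ℝ) {g : ℝ → ℝ≥0∞} (hg : Measurable g) :
    Measurable (translateSum b s g) := by
  unfold translateSum
  exact Measurable.tsum fun ν => by fun_prop

theorem lintegral_translateSum_rpow_le {p : ℝ} (hp : 1 < p) (b : ℕ → ℝ≥0∞) (s : ℕ → ℝ)
    {g : ℝ → ℝ≥0∞} (hg : Measurable g) (hgp : Function.Periodic g (2 * π)) :
    ∫⁻ x, translateSum b s g x ^ p ∂periodMeasure ≤
      (∑' ν, b ν) ^ p * ∫⁻ x, g x ^ p ∂periodMeasure := by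
  calc _ ≤ ∫⁻ x, (∑' ν, b ν) ^ (p - 1) * ∑' ν, b ν * g (x + s ν) ^ p ∂periodMeasure :=
        lintegral_mono fun x => ENNReal.tsum_mul_rpow_le hp b _
    _ = (∑' ν, b ν) ^ (p - 1) * ∑' ν, b ν * ∫⁻ x, g x ^ p ∂periodMeasure := by
        rw [lintegral_const_mul _ (Measurable.tsum fun ν => by fun_prop),
          lintegral_tsum fun ν => by fun_prop]
        congr 2; ext ν
        rw [lintegral_const_mul _ (by fun_prop),
          lintegral_periodMeasure_add (g := fun x => g x ^ p)]
        intro x; simp only [hgp x]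
    _ = _ := by
        rw [ENNReal.tsum_mul_right, ← mul_assoc]
        congr 1
        conv_lhs => rw [← ENNReal.rpow_one (∑' ν, b ν), ← ENNReal.rpow_mul, one_mul]
        rw [← ENNReal.rpow_add_of_nonneg _ _ (by linarith) zero_le_one]
        ring_nf

theorem periodic_dirichletMajorant (i : ℕ) :
    Function.Periodic (dirichletMajorant i) (2 * π) := by
  intro x
  unfold dirichletMajorant
  rw [show (x + 2 * π) / 2 = x / 2 + π by ring, Real.sin_add_pi, abs_neg]

theorem exists_tsum_lintegral_mul_translateSum_le {p : ℝ} (hp : 1 < p) :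
    ∃ C : ℝ≥0∞, C ≠ ⊤ ∧ ∀ (b : ℕ → ℝ≥0∞) (s : ℕ → ℝ) (g : ℝ → ℝ≥0∞), Measurable g →
      Function.Periodic g (2 * π) →
      ∑' i, freq i ^ (-2 : ℝ) *
          (∫⁻ x, g x * translateSum b s (dirichletMajorant i) x ∂periodMeasure) ^ p ≤
        C * (∑' ν, b ν) ^ p * ∫⁻ x, g x ^ p ∂periodMeasure := by
  obtain ⟨C, hC, h⟩ := exists_tsum_lintegral_mul_dirichletMajorant_le hp
  refine ⟨C, hC, fun b s g hg hgp => ?_⟩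
  have hgp' : Function.Periodic (fun x => g (-x)) (2 * π) := by
    intro x
    simp only
    rw [← hgp, show -(x + 2 * π) + 2 * π = -x by ring]
  have e : ∀ i, ∫⁻ x, g x * translateSum b s (dirichletMajorant i) x ∂periodMeasure =
      ∫⁻ x, translateSum b (fun ν => -s ν) g x * dirichletMajorant i x ∂periodMeasure := by
    intro i
    have hm := measurable_dirichletMajorant i
    unfold translateSum
    simp_rw [← ENNReal.tsum_mul_left, ← ENNReal.tsum_mul_right]
    rw [lintegral_tsum fun ν => by fun_prop, lintegral_tsum fun ν => by fun_prop]
    congr 1; ext ν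
    have := lintegral_mul_comp_add hgp (periodic_dirichletMajorant i) (s ν)
    simp_rw [mul_left_comm (g _) (b ν), mul_assoc, ← sub_eq_add_neg]
    rw [lintegral_const_mul _ (by fun_prop), lintegral_const_mul _ (by fun_prop), this]
  simp_rw [e]
  refine (h _ (measurable_translateSum _ _ hg)).trans ?_
  rw [mul_assoc]
  gcongr
  exact lintegral_translateSum_rpow_le hp b _ hg hgp

theorem freq_inv_mul_dirichletMajorant_anti {k i : ℕ} (h : k ≤ i) (x : ℝ) :
    (freq i)⁻¹ * dirichletMajorant i x ≤ (freq k)⁻¹ * dirichletMajorant k x := by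
  have e : ∀ i, (freq i)⁻¹ * dirichletMajorant i x =
      min 1 ((freq i)⁻¹ * (ENNReal.ofReal |sin (x / 2)|)⁻¹) := by
    intro i
    rw [dirichletMajorant, mul_min,
      ENNReal.inv_mul_cancel (freq_ne_zero i) (freq_ne_top i)]
  rw [e, e]
  have : freq k ≤ freq i := by
    unfold freq; gcongr
  gcongr

theorem ENNReal.tsum_mul_sum_range (c z : ℕ → ℝ≥0∞) :
    ∑' i, c i * ∑ k ∈ Finset.range (i + 1), z k = ∑' k, (∑' j, c (k + j)) * z k := by
  have e1 : ∀ i, c i * ∑ k ∈ Finset.range (i + 1), z k =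
      ∑' k, if k ≤ i then c i * z k else 0 := by
    intro i
    rw [tsum_eq_sum (s := Finset.range (i + 1)), Finset.mul_sum]
    · refine Finset.sum_congr rfl fun k hk => ?_
      rw [if_pos (Nat.lt_succ_iff.1 (Finset.mem_range.1 hk))]
    · intro k hk
      rw [if_neg]
      simpa [Nat.lt_succ_iff] using hk
  simp_rw [e1]
  rw [ENNReal.tsum_comm]
  congr 1; ext k
  rw [← ENNReal.summable.sum_add_tsum_nat_add' (k := k), Finset.sum_eq_zero, zero_add,
    ← ENNReal.tsum_mul_right]
  · congr 1; ext j
    rw [if_pos (by omega), add_comm]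
  · intro i hi
    rw [if_neg (by simpa using hi)]

theorem exists_lintegral_tsum_mul_translateSum_le {p : ℝ} (hp : 1 < p) :
    ∃ C : ℝ≥0∞, C ≠ ⊤ ∧ ∀ (b : ℕ → ℝ≥0∞) (s : ℕ → ℝ) (D : ℝ≥0∞) (w : ℕ → ℝ≥0∞),
      (∀ i, freq i * w i ≤ D * ∑ k ∈ Finset.range (i + 1), w k) → ∀ c : ℕ → ℝ≥0∞,
      ∫⁻ x, (∑' i, c i * (w i * translateSum b s (dirichletMajorant i) x)) ^ p ∂periodMeasure ≤
        C * (∑' ν, b ν) ^ p * D ^ p *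
          ∑' k, (∑' j, c (k + j)) ^ p * (w k ^ p * freq k ^ (p - 2)) := by
  obtain ⟨C, hC, h⟩ := exists_lintegral_tsum_mul_dirichletMajorant_le hp
  have hp0 : 0 < p := by linarith
  refine ⟨C, hC, fun b s D w hw c => ?_⟩
  set S : ℝ → ℝ≥0∞ := fun x => ∑' i, c i * (w i * dirichletMajorant i x) with hS
  have hSm : Measurable S :=
    Measurable.tsum fun i => ((measurable_dirichletMajorant i).const_mul _).const_mul _
  have hSp : Function.Periodic S (2 * π) := by
    intro x
    simp only [hS, (periodic_dirichletMajorant _) x]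
  have e : ∀ x, ∑' i, c i * (w i * translateSum b s (dirichletMajorant i) x) =
      translateSum b s S x := by
    intro x
    simp only [translateSum, hS]
    simp_rw [← ENNReal.tsum_mul_left]
    rw [ENNReal.tsum_comm]
    congr 1; ext ν; congr 1; ext i; ring
  simp_rw [e]
  refine (lintegral_translateSum_rpow_le hp b s hSm hSp).trans ?_
  have hb : ∀ x, S x ≤ D * ∑' k, ((∑' j, c (k + j)) * w k) *
      (freq k ^ (-1 : ℝ) * dirichletMajorant k x) := by
    intro x
    have h1 : ∀ i, w i * dirichletMajorant i x ≤
        D * ∑ k ∈ Finset.range (i + 1), w k * ((freq k)⁻¹ * dirichletMajorant k x) := by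
      intro i
      calc w i * dirichletMajorant i x =
          (freq i * w i) * ((freq i)⁻¹ * dirichletMajorant i x) := by
            have := ENNReal.inv_mul_cancel (freq_ne_zero i) (freq_ne_top i)
            calc _ = ((freq i)⁻¹ * freq i) * (w i * dirichletMajorant i x) := by rw [this, one_mul]
              _ = _ := by ring
        _ ≤ (D * ∑ k ∈ Finset.range (i + 1), w k) * ((freq i)⁻¹ * dirichletMajorant i x) := by
            exact mul_le_mul' (hw i) le_rfl
        _ = D * ∑ k ∈ Finset.range (i + 1), w k * ((freq i)⁻¹ * dirichletMajorant i x) := by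
            rw [mul_assoc, Finset.sum_mul]
        _ ≤ _ := by
            exact mul_le_mul' le_rfl (Finset.sum_le_sum fun k hk => mul_le_mul' le_rfl
              (freq_inv_mul_dirichletMajorant_anti
                (Nat.lt_succ_iff.1 (Finset.mem_range.1 hk)) x))
    calc S x ≤ ∑' i, c i * (D * ∑ k ∈ Finset.range (i + 1),
            w k * ((freq k)⁻¹ * dirichletMajorant k x)) :=
          ENNReal.tsum_le_tsum fun i => mul_le_mul' le_rfl (h1 i)
      _ = D * ∑' i, c i * ∑ k ∈ Finset.range (i + 1),
            w k * ((freq k)⁻¹ * dirichletMajorant k x) := by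
          rw [← ENNReal.tsum_mul_left]; congr 1; ext i; ring
      _ = _ := by
          rw [ENNReal.tsum_mul_sum_range]
          congr 2; ext k
          rw [ENNReal.rpow_neg_one, mul_assoc]
  have h2 : ∫⁻ x, S x ^ p ∂periodMeasure ≤ D ^ p * (C *
      ∑' k, (∑' j, c (k + j)) ^ p * (w k ^ p * freq k ^ (p - 2))) := by
    calc _ ≤ ∫⁻ x, D ^ p * (∑' k, ((∑' j, c (k + j)) * w k) *
          (freq k ^ (-1 : ℝ) * dirichletMajorant k x)) ^ p ∂periodMeasure := by
          apply lintegral_mono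
          intro x
          simp only
          rw [← ENNReal.mul_rpow_of_nonneg _ _ hp0.le]
          gcongr
          exact hb x
      _ = D ^ p * ∫⁻ x, (∑' k, ((∑' j, c (k + j)) * w k) *
          (freq k ^ (-1 : ℝ) * dirichletMajorant k x)) ^ p ∂periodMeasure := by
          rw [lintegral_const_mul]
          exact (Measurable.tsum fun k =>
            ((measurable_dirichletMajorant k).const_mul _).const_mul _).pow_const _
      _ ≤ D ^ p * (C * ∑' k, ((∑' j, c (k + j)) * w k) ^ p * freq k ^ (p - 2)) := by
          gcongr
          exact h _
      _ = _ := by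
          congr 3; ext k
          rw [ENNReal.mul_rpow_of_nonneg _ _ hp0.le, mul_assoc]
  calc _ ≤ (∑' ν, b ν) ^ p * (D ^ p * (C *
      ∑' k, (∑' j, c (k + j)) ^ p * (w k ^ p * freq k ^ (p - 2)))) := by gcongr
    _ = _ := by ring

/-- Two-dimensional Hardy-type inequality for moments against Dirichlet majorants. -/
theorem exists_tsum_tsum_lintegral_le {p : ℝ} (hp : 1 < p) :
    ∃ C : ℝ≥0∞, C ≠ ⊤ ∧ ∀ (b₁ b₂ : ℕ → ℝ≥0∞) (s₁ s₂ : ℕ → ℝ) (G : ℝ → ℝ → ℝ≥0∞),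
      Measurable (Function.uncurry G) → (∀ y, Function.Periodic (fun x => G x y) (2 * π)) →
      (∀ x, Function.Periodic (G x) (2 * π)) →
      ∑' i, ∑' j, freq i ^ (-2 : ℝ) * freq j ^ (-2 : ℝ) *
          (∫⁻ x, ∫⁻ y, G x y * translateSum b₁ s₁ (dirichletMajorant i) x *
            translateSum b₂ s₂ (dirichletMajorant j) y ∂periodMeasure ∂periodMeasure) ^ p ≤
        C * (∑' ν, b₁ ν) ^ p * (∑' ν, b₂ ν) ^ p *
          ∫⁻ x, ∫⁻ y, G x y ^ p ∂periodMeasure ∂periodMeasure := by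
  obtain ⟨C, hC, h⟩ := exists_tsum_lintegral_mul_translateSum_le hp
  refine ⟨C * C, ENNReal.mul_ne_top hC hC, fun b₁ b₂ s₁ s₂ G hG hGx hGy => ?_⟩
  set Ψ : ℕ → ℝ → ℝ≥0∞ := fun i => translateSum b₁ s₁ (dirichletMajorant i)
  set Θ : ℕ → ℝ → ℝ≥0∞ := fun j => translateSum b₂ s₂ (dirichletMajorant j)
  have hΨ : ∀ i, Measurable (Ψ i) := fun i =>
    measurable_translateSum _ _ (measurable_dirichletMajorant i)
  have hΘ : ∀ i, Measurable (Θ i) := fun i =>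
    measurable_translateSum _ _ (measurable_dirichletMajorant i)
  set g : ℕ → ℝ → ℝ≥0∞ := fun i y => ∫⁻ x, G x y * Ψ i x ∂periodMeasure with hg
  have hgm : ∀ i, Measurable (g i) := by
    intro i
    have : Measurable fun z : ℝ × ℝ => G z.1 z.2 * Ψ i z.1 :=
      hG.mul ((hΨ i).comp measurable_fst)
    exact this.lintegral_prod_left'
  have hgp : ∀ i, Function.Periodic (g i) (2 * π) := by
    intro i y
    simp only [hg, (hGy _) y]
  have e : ∀ i j, ∫⁻ x, ∫⁻ y, G x y * Ψ i x * Θ j y ∂periodMeasure ∂periodMeasure =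
      ∫⁻ y, g i y * Θ j y ∂periodMeasure := by
    intro i j
    have hm : Measurable fun z : ℝ × ℝ => G z.1 z.2 * Ψ i z.1 * Θ j z.2 :=
      (hG.mul ((hΨ i).comp measurable_fst)).mul ((hΘ j).comp measurable_snd)
    rw [lintegral_lintegral_swap hm.aemeasurable]
    congr 1; ext y
    rw [lintegral_mul_const]
    exact (hG.comp (measurable_id.prodMk measurable_const)).mul (hΨ i)
  have hGsw : Measurable fun z : ℝ × ℝ => G z.2 z.1 := hG.comp measurable_swap
  calc _ = ∑' i, freq i ^ (-2 : ℝ) *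
        ∑' j, freq j ^ (-2 : ℝ) * (∫⁻ y, g i y * Θ j y ∂periodMeasure) ^ p := by
        congr 1; ext i
        rw [← ENNReal.tsum_mul_left]
        congr 1; ext j
        rw [← e, mul_assoc]
    _ ≤ ∑' i, freq i ^ (-2 : ℝ) * (C * (∑' ν, b₂ ν) ^ p * ∫⁻ y, g i y ^ p ∂periodMeasure) := by
        apply ENNReal.tsum_le_tsum
        intro i
        gcongr
        exact h b₂ s₂ (g i) (hgm i) (hgp i)
    _ = C * (∑' ν, b₂ ν) ^ p * ∫⁻ y, ∑' i, freq i ^ (-2 : ℝ) * g i y ^ p ∂periodMeasure := by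
        rw [lintegral_tsum fun i => (((hgm i).pow_const _).const_mul _).aemeasurable,
          ← ENNReal.tsum_mul_left]
        congr 1; ext i
        rw [lintegral_const_mul _ ((hgm i).pow_const _)]
        ring
    _ ≤ C * (∑' ν, b₂ ν) ^ p * ∫⁻ y, C * (∑' ν, b₁ ν) ^ p *
          ∫⁻ x, G x y ^ p ∂periodMeasure ∂periodMeasure := by
        gcongr with y
        exact h b₁ s₁ (fun x => G x y) (hG.comp (measurable_id.prodMk measurable_const)) (hGx y)
    _ = _ := by
        rw [lintegral_const_mul _ (Measurable.lintegral_prod_right' (hGsw.pow_const _)),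
          lintegral_lintegral_swap (f := fun y x => G x y ^ p) (hGsw.pow_const _).aemeasurable]
        ring

/-- Two-dimensional Hardy-type inequality for sums of products of Dirichlet majorants. -/
theorem exists_lintegral_tsum_tsum_le {p : ℝ} (hp : 1 < p) :
    ∃ C : ℝ≥0∞, C ≠ ⊤ ∧ ∀ (b₁ b₂ : ℕ → ℝ≥0∞) (s₁ s₂ : ℕ → ℝ) (D₁ D₂ : ℝ≥0∞)
      (w v : ℕ → ℝ≥0∞),
      (∀ i, freq i * w i ≤ D₁ * ∑ k ∈ Finset.range (i + 1), w k) →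
      (∀ i, freq i * v i ≤ D₂ * ∑ k ∈ Finset.range (i + 1), v k) → ∀ c : ℕ → ℕ → ℝ≥0∞,
      ∫⁻ x, ∫⁻ y, (∑' i, ∑' j, c i j * (w i * translateSum b₁ s₁ (dirichletMajorant i) x) *
          (v j * translateSum b₂ s₂ (dirichletMajorant j) y)) ^ p
          ∂periodMeasure ∂periodMeasure ≤
        C * ((∑' ν, b₁ ν) ^ p * D₁ ^ p) * ((∑' ν, b₂ ν) ^ p * D₂ ^ p) *
          ∑' k, ∑' l, (∑' i, ∑' j, c (k + i) (l + j)) ^ p *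
            (w k ^ p * freq k ^ (p - 2)) * (v l ^ p * freq l ^ (p - 2)) := by
  obtain ⟨C, hC, h⟩ := exists_lintegral_tsum_mul_translateSum_le hp
  refine ⟨C * C, ENNReal.mul_ne_top hC hC, fun b₁ b₂ s₁ s₂ D₁ D₂ w v hw hv c => ?_⟩
  set Ψ : ℕ → ℝ → ℝ≥0∞ := fun i => translateSum b₁ s₁ (dirichletMajorant i)
  set Θ : ℕ → ℝ → ℝ≥0∞ := fun j => translateSum b₂ s₂ (dirichletMajorant j)
  have hΨ : ∀ i, Measurable (Ψ i) := fun i =>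
    measurable_translateSum _ _ (measurable_dirichletMajorant i)
  have hΘ : ∀ i, Measurable (Θ i) := fun i =>
    measurable_translateSum _ _ (measurable_dirichletMajorant i)
  have hm : Measurable fun z : ℝ × ℝ => (∑' i, ∑' j, c i j * (w i * Ψ i z.1) *
      (v j * Θ j z.2)) ^ p := by
    refine (Measurable.tsum fun i => Measurable.tsum fun j => ?_).pow_const _
    have h1 : Measurable fun z : ℝ × ℝ => Ψ i z.1 := (hΨ i).comp measurable_fst
    have h2 : Measurable fun z : ℝ × ℝ => Θ j z.2 := (hΘ j).comp measurable_snd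
    fun_prop
  rw [lintegral_lintegral_swap hm.aemeasurable]
  calc _ = ∫⁻ y, ∫⁻ x, (∑' i, (∑' j, c i j * (v j * Θ j y)) * (w i * Ψ i x)) ^ p
          ∂periodMeasure ∂periodMeasure := by
        congr 1; ext y; congr 1; ext x; congr 2; ext i
        rw [← ENNReal.tsum_mul_right]
        congr 1; ext j; ring
    _ ≤ ∫⁻ y, C * (∑' ν, b₁ ν) ^ p * D₁ ^ p *
          ∑' k, (∑' i, ∑' j, c (k + i) j * (v j * Θ j y)) ^ p *
            (w k ^ p * freq k ^ (p - 2)) ∂periodMeasure := by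
        gcongr with y
        exact h b₁ s₁ D₁ w hw _
    _ = C * (∑' ν, b₁ ν) ^ p * D₁ ^ p * ∑' k, (w k ^ p * freq k ^ (p - 2)) *
          ∫⁻ y, (∑' j, (∑' i, c (k + i) j) * (v j * Θ j y)) ^ p ∂periodMeasure := by
        have hm2 : ∀ k, Measurable fun y =>
            (∑' i, ∑' j, c (k + i) j * (v j * Θ j y)) ^ p := fun k =>
          (Measurable.tsum fun i => Measurable.tsum fun j =>
            ((hΘ j).const_mul _).const_mul _).pow_const _
        rw [lintegral_const_mul _ (Measurable.tsum fun k => (hm2 k).mul_const _),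
          lintegral_tsum fun k => ((hm2 k).mul_const _).aemeasurable]
        congr 2; ext k
        rw [lintegral_mul_const _ (hm2 k), mul_comm]
        congr 2; ext y; congr 1
        rw [ENNReal.tsum_comm]
        congr 1; ext j
        rw [ENNReal.tsum_mul_right]
    _ ≤ C * (∑' ν, b₁ ν) ^ p * D₁ ^ p * ∑' k, (w k ^ p * freq k ^ (p - 2)) *
          (C * (∑' ν, b₂ ν) ^ p * D₂ ^ p *
            ∑' l, (∑' j, ∑' i, c (k + i) (l + j)) ^ p * (v l ^ p * freq l ^ (p - 2))) := by
        gcongr with k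
        exact h b₂ s₂ D₂ v hv _
    _ = _ := by
        have e : ∀ k, (w k ^ p * freq k ^ (p - 2)) *
          (C * (∑' ν, b₂ ν) ^ p * D₂ ^ p *
            ∑' l, (∑' j, ∑' i, c (k + i) (l + j)) ^ p * (v l ^ p * freq l ^ (p - 2))) =
          (C * (∑' ν, b₂ ν) ^ p * D₂ ^ p) * ∑' l, (∑' i, ∑' j, c (k + i) (l + j)) ^ p *
            (w k ^ p * freq k ^ (p - 2)) * (v l ^ p * freq l ^ (p - 2)) := by
          intro k
          rw [mul_left_comm, ← ENNReal.tsum_mul_left]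
          congr 2; ext l
          rw [ENNReal.tsum_comm]; ring
        simp_rw [e]
        rw [ENNReal.tsum_mul_left]
        ring

/-- The coefficients of the fractional difference of order `α`. -/
def diffCoeff (α : ℝ) (ν : ℕ) : ℝ := (-1) ^ ν * fracBinom α ν

theorem fracBinom_eq_choose (α : ℝ) (ν : ℕ) : (fracBinom α ν : ℂ) = Ring.choose (α : ℂ) ν := by
  induction ν with
  | zero => simp [fracBinom]
  | succ n ih =>
    have e : ∀ n : ℕ, (descPochhammer ℤ n).smeval (α : ℂ) = n.factorial * Ring.choose (α : ℂ) n :=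
      fun n => by rw [Ring.descPochhammer_eq_factorial_smul_choose, nsmul_eq_mul]
    have h : ((n + 1).factorial : ℂ) * Ring.choose (α : ℂ) (n + 1) =
        n.factorial * Ring.choose (α : ℂ) n * (α - n) := by
      rw [← e, ← e]
      simp [descPochhammer_succ_right, Polynomial.smeval_mul, Polynomial.smeval_natCast]
    have hn : (n.factorial : ℂ) ≠ 0 := by exact_mod_cast n.factorial_ne_zero
    have hn1 : (n : ℂ) + 1 ≠ 0 := by exact_mod_cast n.succ_ne_zero
    rw [Nat.factorial_succ] at h
    push_cast at h
    simp only [fracBinom]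
    push_cast
    rw [ih, div_eq_iff hn1]
    apply mul_left_cancel₀ hn
    linear_combination -h

theorem summable_abs_diffCoeff {α : ℝ} (hα : 0 < α) : Summable fun ν => |diffCoeff α ν| := by
  obtain ⟨N, hN⟩ := exists_nat_ge α
  rw [← summable_nat_add_iff N]
  have hstep : ∀ ν : ℕ, α * |diffCoeff α (ν + N)| =
      ((ν + N : ℕ) : ℝ) * |diffCoeff α (ν + N)| -
        ((ν + 1 + N : ℕ) : ℝ) * |diffCoeff α (ν + 1 + N)| := by
    intro ν
    have h1 : |diffCoeff α (ν + 1 + N)| =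
        |diffCoeff α (ν + N)| * (((ν + N : ℕ) : ℝ) - α) / (((ν + N : ℕ) : ℝ) + 1) := by
      rw [show ν + 1 + N = (ν + N) + 1 by ring]
      simp only [diffCoeff, fracBinom, abs_mul, abs_div, abs_pow, abs_neg, abs_one, one_pow,
        one_mul]
      rw [abs_sub_comm, abs_of_nonneg (a := ((ν + N : ℕ) : ℝ) - α),
        abs_of_pos (a := ((ν + N : ℕ) : ℝ) + 1)]
      · positivity
      · push_cast; have : (0:ℝ) ≤ ν := Nat.cast_nonneg ν
        linarith
    rw [h1]
    push_cast
    field_simp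
    ring
  refine summable_of_sum_range_le (c := (N : ℝ) * |diffCoeff α N| / α) (fun _ => abs_nonneg _) ?_
  intro n
  rw [le_div_iff₀ hα, mul_comm, Finset.mul_sum, Finset.sum_congr rfl fun ν _ => hstep ν,
    Finset.sum_range_sub' fun ν : ℕ => ((ν + N : ℕ) : ℝ) * |diffCoeff α (ν + N)|]
  simp only [zero_add]
  have : 0 ≤ ((n + N : ℕ) : ℝ) * |diffCoeff α (n + N)| := by positivity
  linarith

theorem hasSum_diffCoeff_mul_pow_of_norm_lt_one (α : ℝ) {z : ℂ} (hz : ‖z‖ < 1) :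
    HasSum (fun ν => (diffCoeff α ν : ℂ) * z ^ ν) ((1 - z) ^ (α : ℂ)) := by
  have h := (Complex.one_add_cpow_hasFPowerSeriesOnBall_zero (a := α)).hasSum (y := -z)
    (by simpa [← ENNReal.ofReal_one, Metric.eball_ofReal] using hz)
  rw [zero_add, ← sub_eq_add_neg] at h
  have e : (fun ν => (diffCoeff α ν : ℂ) * z ^ ν) =
      fun ν => binomialSeries ℂ (α : ℂ) ν fun _ => -z := by
    ext ν
    rw [binomialSeries_apply, ← fracBinom_eq_choose, diffCoeff]
    simp only [List.ofFn_const, List.prod_replicate, smul_eq_mul]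
    rw [neg_pow z]
    push_cast
    ring
  rw [e]
  exact h

theorem hasSum_diffCoeff_mul_pow {α : ℝ} (hα : 0 < α) {z : ℂ} (hz : ‖z‖ ≤ 1) :
    HasSum (fun ν => (diffCoeff α ν : ℂ) * z ^ ν) ((1 - z) ^ (α : ℂ)) := by
  have hs := summable_abs_diffCoeff hα
  have hb : ∀ ν : ℕ, ∀ w : ℂ, ‖w‖ ≤ 1 → ‖(diffCoeff α ν : ℂ) * w ^ ν‖ ≤ |diffCoeff α ν| := by
    intro ν w hw
    rw [norm_mul, Complex.norm_real, Real.norm_eq_abs, norm_pow]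
    exact mul_le_of_le_one_right (abs_nonneg _) (pow_le_one₀ (norm_nonneg _) hw)
  have hsz : Summable fun ν => (diffCoeff α ν : ℂ) * z ^ ν :=
    Summable.of_norm_bounded hs fun ν => hb ν z hz
  suffices h : ∑' ν, (diffCoeff α ν : ℂ) * z ^ ν = (1 - z) ^ (α : ℂ) from h ▸ hsz.hasSum
  have hr : ∀ r ∈ Set.Icc (0:ℝ) 1, ‖(r : ℂ) * z‖ ≤ 1 := by
    intro r hr
    rw [norm_mul, Complex.norm_real, Real.norm_of_nonneg hr.1]
    exact mul_le_one₀ hr.2 (norm_nonneg _) hz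
  have hcont : ContinuousOn (fun r : ℝ => ∑' ν, (diffCoeff α ν : ℂ) * ((r : ℂ) * z) ^ ν)
      (Set.Icc 0 1) :=
    continuousOn_tsum (fun ν => by fun_prop) hs fun ν r h => hb ν _ (hr r h)
  have h1 : Filter.Tendsto (fun r : ℝ => ∑' ν, (diffCoeff α ν : ℂ) * ((r : ℂ) * z) ^ ν)
      (nhdsWithin 1 (Set.Ioo 0 1)) (nhds (∑' ν, (diffCoeff α ν : ℂ) * z ^ ν)) := by
    have := (hcont 1 (by simp)).mono_left (nhdsWithin_mono _ Set.Ioo_subset_Icc_self)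
    simpa using this
  have h2 : Filter.Tendsto (fun r : ℝ => (1 - (r : ℂ) * z) ^ (α : ℂ))
      (nhdsWithin 1 (Set.Ioo 0 1)) (nhds ((1 - z) ^ (α : ℂ))) := by
    have hc : ContinuousAt (fun w : ℂ => w ^ (α : ℂ)) (1 - z) := by
      by_cases h : z = 1
      · rw [h, sub_self]
        exact (Complex.continuousAt_cpow_zero_of_re_pos (z := α) (by simpa using hα)).comp
          (f := fun w : ℂ => (w, (α : ℂ))) (by fun_prop)
      · refine continuousAt_cpow_const ?_
        left
        have hre : z.re ≤ 1 := (Complex.re_le_norm z).trans hz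
        rcases hre.lt_or_eq with h' | h'
        · simpa using h'
        · exfalso
          apply h
          have h3 : z.re ^ 2 + z.im ^ 2 ≤ 1 := by
            have := pow_le_one₀ (norm_nonneg z) hz (n := 2)
            rwa [Complex.sq_norm, Complex.normSq_apply, ← sq, ← sq] at this
          have h4 : z.im = 0 := by
            rw [h'] at h3
            exact pow_eq_zero_iff two_ne_zero |>.1 (le_antisymm (by linarith) (sq_nonneg _))
          exact Complex.ext (by simpa using h') (by simpa using h4)
    have hl : Filter.Tendsto (fun r : ℝ => 1 - (r : ℂ) * z) (nhdsWithin 1 (Set.Ioo 0 1))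
        (nhds (1 - z)) := by
      have : Continuous fun r : ℝ => 1 - (r : ℂ) * z := by fun_prop
      simpa using (this.tendsto 1).mono_left nhdsWithin_le_nhds
    exact hc.tendsto.comp hl
  have hne : (nhdsWithin (1:ℝ) (Set.Ioo 0 1)).NeBot := by
    rw [← mem_closure_iff_nhdsWithin_neBot, closure_Ioo (by norm_num)]
    simp
  refine tendsto_nhds_unique h1 (h2.congr' ?_)
  filter_upwards [self_mem_nhdsWithin] with r hr'
  refine (hasSum_diffCoeff_mul_pow_of_norm_lt_one α ?_).tsum_eq.symm
  rw [norm_mul, Complex.norm_real, Real.norm_of_nonneg hr'.1.le]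
  exact mul_lt_one_of_nonneg_of_lt_one_left hr'.1.le hr'.2 hz

theorem one_sub_exp_cpow {α θ : ℝ} (hα : 0 < α) (hθ : θ ∈ Set.Icc 0 (2 * π)) :
    (1 - Complex.exp (-(θ * Complex.I))) ^ (α : ℂ) =
      ((2 * sin (θ / 2)) ^ α : ℝ) * Complex.exp ((α * (π - θ) / 2 : ℝ) * Complex.I) := by
  have h : 1 - Complex.exp (-(θ * Complex.I)) =
      ((2 * sin (θ / 2) : ℝ) : ℂ) * Complex.exp (((π - θ) / 2 : ℝ) * Complex.I) := by
    rw [← neg_mul, ← Complex.ofReal_neg, Complex.exp_mul_I, Complex.exp_mul_I]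
    simp only [← Complex.ofReal_cos, ← Complex.ofReal_sin]
    rw [show (π - θ) / 2 = π / 2 - θ / 2 by ring, Real.cos_pi_div_two_sub,
      Real.sin_pi_div_two_sub, Real.cos_neg, Real.sin_neg]
    have e1 : cos θ = 1 - 2 * sin (θ / 2) ^ 2 := by
      have h1 := Real.cos_two_mul (θ / 2)
      rw [show 2 * (θ / 2) = θ by ring, Real.cos_sq'] at h1
      rw [h1]; ring
    have e2 : sin θ = 2 * sin (θ / 2) * cos (θ / 2) := by
      rw [← Real.sin_two_mul, show 2 * (θ / 2) = θ by ring]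
    rw [e1, e2]
    push_cast
    ring
  have h0 : 0 ≤ sin (θ / 2) := Real.sin_nonneg_of_nonneg_of_le_pi (by linarith [hθ.1])
    (by linarith [hθ.2])
  rw [h]
  rcases h0.eq_or_lt with h1 | h1
  · rw [← h1]
    simp [Real.zero_rpow hα.ne', hα.ne']
  · have hθ1 : 0 < θ := by
      refine hθ.1.lt_of_ne fun e => ?_
      rw [← e] at h1; simp at h1
    have hθ2 : θ < 2 * π := by
      refine hθ.2.lt_of_ne fun e => ?_
      rw [e] at h1; simp at h1
    have hpos : 0 < 2 * sin (θ / 2) := by positivity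
    rw [Complex.cpow_def_of_ne_zero (mul_ne_zero (by exact_mod_cast hpos.ne')
      (Complex.exp_ne_zero _)), Complex.log_ofReal_mul hpos (Complex.exp_ne_zero _),
      Complex.log_exp, Complex.ofReal_cpow hpos.le, Complex.cpow_def_of_ne_zero
      (by exact_mod_cast hpos.ne'), ← Complex.exp_add, ← Complex.ofReal_log hpos.le]
    · congr 1
      push_cast
      ring
    · simp; linarith
    · simp; linarith

theorem hasSum_diffCoeff_mul_cos {α θ : ℝ} (hα : 0 < α) (hθ : θ ∈ Set.Icc 0 (2 * π)) (φ : ℝ) :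
    HasSum (fun ν : ℕ => diffCoeff α ν * cos (φ - ν * θ))
      ((2 * sin (θ / 2)) ^ α * cos (φ + α * (π - θ) / 2)) := by
  have h := hasSum_diffCoeff_mul_pow hα (z := Complex.exp (-(θ * Complex.I)))
    (by rw [← neg_mul, ← Complex.ofReal_neg, Complex.norm_exp_ofReal_mul_I])
  rw [one_sub_exp_cpow hα hθ] at h
  have h2 := Complex.hasSum_re (h.mul_left (Complex.exp (φ * Complex.I)))
  convert h2 using 2 with ν
  · rw [mul_left_comm, ← Complex.exp_nat_mul, ← Complex.exp_add, Complex.re_ofReal_mul,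
      ← Complex.exp_ofReal_mul_I_re]
    congr 3
    push_cast; ring
  · rw [mul_left_comm, ← Complex.exp_add, Complex.re_ofReal_mul, ← Complex.exp_ofReal_mul_I_re]
    congr 3
    push_cast; ring

/-- The multiplier size `min ((i + 1) / n, 1) ^ α` of a difference of order `α` and step `1 / n`. -/
def modWeight (n : ℕ) (α : ℝ) (i : ℕ) : ℝ := min (((i : ℝ) + 1) / n) 1 ^ α

theorem modWeight_nonneg (n : ℕ) (α : ℝ) (i : ℕ) : 0 ≤ modWeight n α i :=
  Real.rpow_nonneg (le_min (by positivity) zero_le_one) _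

theorem mul_modWeight_le_sum (n : ℕ) {α : ℝ} (hα : 0 < α) (i : ℕ) :
    ((i : ℝ) + 1) * modWeight n α i ≤
      2 ^ (α + 1) * ∑ k ∈ Finset.range (i + 1), modWeight n α k := by
  have hhalf : ∀ k : ℕ, ((i : ℝ) + 1) / 2 ≤ k + 1 → (1 / 2) ^ α * modWeight n α i ≤
      modWeight n α k := by
    intro k hk
    have h0 : 0 ≤ min (((i : ℝ) + 1) / n) 1 := le_min (by positivity) zero_le_one
    rw [modWeight, modWeight, ← Real.mul_rpow (by norm_num) h0]
    refine Real.rpow_le_rpow (by positivity) (le_min ?_ ?_) hα.le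
    · calc 1 / 2 * min (((i : ℝ) + 1) / n) 1 ≤ 1 / 2 * (((i : ℝ) + 1) / n) := by
            gcongr; exact min_le_left _ _
        _ = (((i : ℝ) + 1) / 2) / n := by ring
        _ ≤ _ := by gcongr
    · have := min_le_right (((i : ℝ) + 1) / n) 1
      linarith
  have hpair : ∀ k ∈ Finset.range (i + 1), (1 / 2) ^ α * modWeight n α i ≤
      modWeight n α k + modWeight n α (i - k) := by
    intro k hk
    have hki : k ≤ i := Nat.lt_succ_iff.1 (Finset.mem_range.1 hk)
    rcases le_total (((i : ℝ) + 1) / 2) (k + 1) with h | h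
    · exact (hhalf k h).trans (le_add_of_nonneg_right (modWeight_nonneg _ _ _))
    · refine (hhalf (i - k) ?_).trans (le_add_of_nonneg_left (modWeight_nonneg _ _ _))
      rw [Nat.cast_sub hki]
      linarith
  have h := Finset.sum_le_sum hpair
  rw [Finset.sum_const, Finset.card_range, nsmul_eq_mul, Finset.sum_add_distrib] at h
  have hr := Finset.sum_range_reflect (modWeight n α) (i + 1)
  simp only [Nat.add_sub_cancel] at hr
  rw [hr] at h
  have e : (2:ℝ) ^ (α + 1) * ∑ k ∈ Finset.range (i + 1), modWeight n α k =
      2 ^ α * (∑ k ∈ Finset.range (i + 1), modWeight n α k +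
        ∑ k ∈ Finset.range (i + 1), modWeight n α k) := by
    rw [Real.rpow_add_one two_ne_zero]; ring
  rw [e]
  calc ((i : ℝ) + 1) * modWeight n α i =
      2 ^ α * (((i + 1 : ℕ) : ℝ) * ((1 / 2) ^ α * modWeight n α i)) := by
        have : (2:ℝ) ^ α * (1 / 2) ^ α = 1 := by
          rw [← Real.mul_rpow (by norm_num) (by norm_num)]; norm_num
        push_cast
        linear_combination (-((i : ℝ) + 1) * modWeight n α i) * this
    _ ≤ _ := by gcongr

theorem abs_sin_half_mul_sum_cos_le (m : ℕ) (x θ : ℝ) :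
    |sin (x / 2)| * |∑ k ∈ Finset.range m, cos ((k + 1) * x + θ)| ≤ 1 := by
  have h : 2 * sin (x / 2) * ∑ k ∈ Finset.range m, cos ((k + 1) * x + θ) =
      sin (((m : ℝ) + 1 / 2) * x + θ) - sin (x / 2 + θ) := by
    induction m with
    | zero => simp; ring_nf
    | succ m ih =>
      rw [Finset.sum_range_succ, mul_add, ih]
      have := Real.sin_sub_sin (((m + 1 : ℕ) + 1 / 2) * x + θ) (((m : ℝ) + 1 / 2) * x + θ)
      rw [show (((m + 1 : ℕ) + 1 / 2) * x + θ - (((m : ℝ) + 1 / 2) * x + θ)) / 2 = x / 2 by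
          push_cast; ring,
        show (((m + 1 : ℕ) + 1 / 2) * x + θ + (((m : ℝ) + 1 / 2) * x + θ)) / 2 =
          (m + 1) * x + θ by push_cast; ring] at this
      linarith
  have h2 := congrArg abs h
  rw [abs_mul, abs_mul, abs_two] at h2
  have := abs_sub (sin (((m : ℝ) + 1 / 2) * x + θ)) (sin (x / 2 + θ))
  linarith [Real.abs_sin_le_one (((m : ℝ) + 1 / 2) * x + θ), Real.abs_sin_le_one (x / 2 + θ)]

theorem abs_sum_mul_le_of_monotone {i : ℕ} {ρ z : ℕ → ℝ} {B : ℝ} (h0 : 0 ≤ ρ 0)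
    (hρ : ∀ k < i, ρ k ≤ ρ (k + 1)) (hz : ∀ m, |∑ k ∈ Finset.range m, z k| ≤ B) :
    |∑ k ∈ Finset.range (i + 1), ρ k * z k| ≤ 2 * ρ i * B := by
  have hB : 0 ≤ B := by simpa using hz 0
  have h := Finset.sum_range_by_parts ρ z (i + 1)
  simp only [smul_eq_mul, Nat.add_sub_cancel] at h
  rw [h]
  have hi : ρ 0 ≤ ρ i := by
    have := Finset.sum_nonneg fun k (hk : k ∈ Finset.range i) =>
      sub_nonneg.2 (hρ k (Finset.mem_range.1 hk))
    rw [Finset.sum_range_sub] at this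
    linarith
  have h1 : |ρ i * ∑ k ∈ Finset.range (i + 1), z k| ≤ ρ i * B := by
    rw [abs_mul, abs_of_nonneg (h0.trans hi)]
    exact mul_le_mul_of_nonneg_left (hz _) (h0.trans hi)
  have h2 : |∑ k ∈ Finset.range i, (ρ (k + 1) - ρ k) * ∑ l ∈ Finset.range (k + 1), z l| ≤
      (ρ i - ρ 0) * B := by
    rw [← Finset.sum_range_sub, Finset.sum_mul]
    refine (Finset.abs_sum_le_sum_abs _ _).trans (Finset.sum_le_sum fun k hk => ?_)
    have h3 := sub_nonneg.2 (hρ k (Finset.mem_range.1 hk))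
    rw [abs_mul, abs_of_nonneg h3]
    exact mul_le_mul_of_nonneg_left (hz _) h3
  refine (abs_sub _ _).trans ?_
  nlinarith

theorem ofReal_abs_sum_mul_cos_le {i : ℕ} {ρ : ℕ → ℝ} (h0 : 0 ≤ ρ 0)
    (hρ : ∀ k < i, ρ k ≤ ρ (k + 1)) (x θ : ℝ) :
    ENNReal.ofReal |∑ k ∈ Finset.range (i + 1), ρ k * cos ((k + 1) * x + θ)| ≤
      2 * ENNReal.ofReal (ρ i) * dirichletMajorant i x := by
  have hmono : ∀ k ≤ i, 0 ≤ ρ k ∧ ρ k ≤ ρ i := by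
    have h1 : ∀ d k, k + d ≤ i → ρ k ≤ ρ (k + d) := by
      intro d
      induction d with
      | zero => intro k _; rfl
      | succ d ih => intro k hk; exact (ih k (by omega)).trans (hρ _ (by omega))
    intro k hk
    have h2 := h1 k 0 (by omega)
    have h3 := h1 (i - k) k (by omega)
    rw [zero_add] at h2
    rw [Nat.add_sub_cancel' hk] at h3
    exact ⟨h0.trans h2, h3⟩
  have hi := (hmono i le_rfl).1
  rw [dirichletMajorant, mul_min]
  refine le_min ?_ ?_
  · rw [freq_eq_ofReal, ← ENNReal.ofReal_ofNat, ← ENNReal.ofReal_mul (by norm_num),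
      ← ENNReal.ofReal_mul (by positivity)]
    refine ENNReal.ofReal_le_ofReal ((Finset.abs_sum_le_sum_abs _ _).trans ?_)
    calc _ ≤ ∑ k ∈ Finset.range (i + 1), ρ i := by
          refine Finset.sum_le_sum fun k hk => ?_
          have hk' := hmono k (Nat.lt_succ_iff.1 (Finset.mem_range.1 hk))
          rw [abs_mul, abs_of_nonneg hk'.1]
          exact (mul_le_of_le_one_right hk'.1 (Real.abs_cos_le_one _)).trans hk'.2
      _ = ((i : ℝ) + 1) * ρ i := by simp
      _ ≤ _ := by nlinarith [mul_nonneg (by positivity : 0 ≤ (i : ℝ) + 1) hi]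
  · rcases (abs_nonneg (sin (x / 2))).eq_or_lt with hs | hs
    · rw [← hs, ENNReal.ofReal_zero, ENNReal.inv_zero]
      rcases hi.eq_or_lt with h | h
      · have : ∑ k ∈ Finset.range (i + 1), ρ k * cos ((k + 1) * x + θ) = 0 := by
          refine Finset.sum_eq_zero fun k hk => ?_
          have hk' := hmono k (Nat.lt_succ_iff.1 (Finset.mem_range.1 hk))
          rw [le_antisymm (hk'.2.trans h.ge) hk'.1, zero_mul]
        simp [this]
      · rw [ENNReal.mul_top]
        · exact le_top
        · simpa using h
    · rw [← ENNReal.ofReal_inv_of_pos hs, ← ENNReal.ofReal_ofNat,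
        ← ENNReal.ofReal_mul (by norm_num), ← ENNReal.ofReal_mul (by positivity)]
      refine ENNReal.ofReal_le_ofReal (abs_sum_mul_le_of_monotone h0 hρ fun m => ?_)
      rw [← one_div, le_div_iff₀ hs, mul_comm]
      exact abs_sin_half_mul_sum_cos_le m x θ

/-- The cosine sum `cos x + ⋯ + cos (i + 1) x`. -/
def cosSum (i : ℕ) (x : ℝ) : ℝ := ∑ k ∈ Finset.range (i + 1), cos ((k + 1) * x)

theorem ofReal_abs_cosSum_le (i : ℕ) (x : ℝ) :
    ENNReal.ofReal |cosSum i x| ≤ 2 * dirichletMajorant i x := by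
  have := ofReal_abs_sum_mul_cos_le (i := i) (ρ := fun _ => 1) zero_le_one (fun _ _ => le_rfl) x 0
  simpa [cosSum] using this

/-- The weights of the translates in `diffMajorant`. -/
def diffMajorantWeight (α : ℝ) (ν : ℕ) : ℝ≥0∞ :=
  Nat.casesOn ν 1 fun ν => ENNReal.ofReal |diffCoeff α ν|

/-- The shifts of the translates in `diffMajorant`. -/
def diffMajorantShift (α h : ℝ) (ν : ℕ) : ℝ :=
  Nat.casesOn ν (α * h / 2) fun ν => (α - ν) * h

/-- A combination of translates of Dirichlet majorants that bounds the differences of `cosSum`. -/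
abbrev diffMajorant (α h : ℝ) (i : ℕ) : ℝ → ℝ≥0∞ :=
  translateSum (diffMajorantWeight α) (diffMajorantShift α h) (dirichletMajorant i)

theorem tsum_diffMajorantWeight_ne_top {α : ℝ} (hα : 0 < α) :
    ∑' ν, diffMajorantWeight α ν ≠ ⊤ := by
  rw [tsum_eq_zero_add' ENNReal.summable]
  exact ENNReal.add_ne_top.2 ⟨ENNReal.one_ne_top, (summable_abs_diffCoeff hα).tsum_ofReal_ne_top⟩

theorem diffMajorant_eq (α h : ℝ) (i : ℕ) (x : ℝ) :
    diffMajorant α h i x = dirichletMajorant i (x + α * h / 2) +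
      ∑' ν : ℕ, ENNReal.ofReal |diffCoeff α ν| * dirichletMajorant i (x + (α - ν) * h) := by
  rw [diffMajorant, translateSum, tsum_eq_zero_add' ENNReal.summable]
  simp [diffMajorantWeight, diffMajorantShift]

theorem ofReal_abs_tsum_cosSum_le (α h : ℝ) (i : ℕ) (x : ℝ) :
    ENNReal.ofReal |∑' ν : ℕ, diffCoeff α ν * cosSum i (x + (α - ν) * h)| ≤
      2 * diffMajorant α h i x := by
  rw [← Real.enorm_eq_ofReal_abs]
  calc _ ≤ ∑' ν : ℕ, ‖diffCoeff α ν * cosSum i (x + (α - ν) * h)‖ₑ := enorm_tsum_le_tsum_enorm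
    _ ≤ ∑' ν : ℕ, 2 * (ENNReal.ofReal |diffCoeff α ν| *
          dirichletMajorant i (x + (α - ν) * h)) := by
        refine ENNReal.tsum_le_tsum fun ν => ?_
        rw [enorm_mul, Real.enorm_eq_ofReal_abs, Real.enorm_eq_ofReal_abs, mul_left_comm]
        exact mul_le_mul' le_rfl (ofReal_abs_cosSum_le i _)
    _ ≤ _ := by
        rw [ENNReal.tsum_mul_left, diffMajorant_eq]
        exact mul_le_mul' le_rfl le_add_self

theorem hasSum_diffCoeff_mul_cos_add {α t : ℝ} (hα : 0 < α) (ht : t ∈ Set.Icc 0 (2 * π)) (y : ℝ) :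
    HasSum (fun ν : ℕ => diffCoeff α ν * cos (y + (α - ν) * t))
      ((2 * sin (t / 2)) ^ α * cos (y + α * t / 2 + α * π / 2)) := by
  convert hasSum_diffCoeff_mul_cos hα ht (y + α * t) using 2 with ν
  · congr 1; ring_nf
  · congr 1; ring

theorem hasSum_diffCoeff_mul_cos_sub {α t : ℝ} (hα : 0 < α) (ht : t ∈ Set.Icc 0 (2 * π)) (y : ℝ) :
    HasSum (fun ν : ℕ => diffCoeff α ν * cos (y - (α - ν) * t))
      ((2 * sin (t / 2)) ^ α * cos (y - α * t / 2 - α * π / 2)) := by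
  convert hasSum_diffCoeff_mul_cos_add hα ht (-y) using 2 with ν
  · rw [← Real.cos_neg]; congr 2; ring
  · rw [← Real.cos_neg]; congr 2; ring

theorem two_mul_sin_half_le {t : ℝ} (ht : 0 ≤ t) : 2 * sin (t / 2) ≤ t := by
  have := Real.sin_le (x := t / 2) (by linarith)
  linarith

theorem half_le_two_mul_sin_half {t : ℝ} (ht : 0 ≤ t) (ht1 : t ≤ 1) : t / 2 ≤ 2 * sin (t / 2) := by
  have h := Real.mul_le_sin (x := t / 2) (by linarith) (by linarith [Real.pi_gt_three])
  have h2 : 1 / 2 ≤ 2 / π := by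
    rw [div_le_div_iff₀ two_pos Real.pi_pos]; linarith [Real.pi_lt_four]
  nlinarith

theorem sin_half_mono {s t : ℝ} (hs : 0 ≤ s) (hst : s ≤ t) (ht : t ≤ 1) :
    0 ≤ 2 * sin (s / 2) ∧ 2 * sin (s / 2) ≤ 2 * sin (t / 2) := by
  have hpi := Real.pi_gt_three
  constructor
  · have := Real.sin_nonneg_of_nonneg_of_le_pi (x := s / 2) (by linarith) (by linarith)
    linarith
  · have := Real.sin_le_sin_of_le_of_le_pi_div_two (x := s / 2) (y := t / 2) (by linarith)
      (by linarith) (by linarith)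
    linarith

theorem ofReal_abs_sum_sin_rpow_mul_cos_le {α h : ℝ} (hα : 0 < α) (hh : 0 ≤ h) {n i : ℕ}
    (hi : i + 1 ≤ n) (hn : h ≤ 1 / n) (x θ : ℝ) :
    ENNReal.ofReal |∑ k ∈ Finset.range (i + 1),
        (2 * sin (((k : ℝ) + 1) * h / 2)) ^ α * cos ((k + 1) * x + θ)| ≤
      2 * ENNReal.ofReal (modWeight n α i) * dirichletMajorant i x := by
  have hn0 : (0:ℝ) < n := by exact_mod_cast (by omega : 0 < n)
  have hin : ((i : ℝ) + 1) ≤ n := by exact_mod_cast hi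
  have hih : ((i : ℝ) + 1) * h ≤ ((i : ℝ) + 1) / n := by
    rw [div_eq_mul_one_div]; gcongr
  have hih1 : ((i : ℝ) + 1) / n ≤ 1 := by rwa [div_le_one hn0]
  refine (ofReal_abs_sum_mul_cos_le (ρ := fun k => (2 * sin (((k : ℝ) + 1) * h / 2)) ^ α)
    ?_ ?_ x θ).trans ?_
  · refine Real.rpow_nonneg (sin_half_mono (t := ((i : ℝ) + 1) * h) (by positivity) ?_
      (hih.trans hih1)).1 _
    simp only [Nat.cast_zero, zero_add]
    nlinarith [mul_nonneg (Nat.cast_nonneg (α := ℝ) i) hh]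
  · intro k hk
    have hk1 : ((k + 1 : ℕ) : ℝ) + 1 ≤ i + 1 := by
      have : ((k + 1 : ℕ) : ℝ) ≤ i := by exact_mod_cast hk
      linarith
    have := sin_half_mono (s := ((k : ℝ) + 1) * h) (t := (((k + 1 : ℕ) : ℝ) + 1) * h)
      (by positivity) (by push_cast; nlinarith)
      ((mul_le_mul_of_nonneg_right hk1 hh).trans (hih.trans hih1))
    exact Real.rpow_le_rpow this.1 this.2 hα.le
  · refine mul_le_mul' (mul_le_mul' le_rfl (ENNReal.ofReal_le_ofReal ?_)) le_rfl
    rw [modWeight, min_eq_left hih1]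
    refine Real.rpow_le_rpow (sin_half_mono (by positivity) le_rfl (hih.trans hih1)).1
      ((two_mul_sin_half_le (by positivity)).trans hih) hα.le

theorem ofReal_abs_diff_cosSum_le {α h : ℝ} (hα : 0 < α) {n : ℕ} (hn0 : 1 ≤ n)
    (hn : |h| ≤ 1 / n) (i : ℕ) (x : ℝ) :
    ENNReal.ofReal |∑' ν : ℕ, diffCoeff α ν * cosSum i (x + (α - ν) * h)| ≤
      2 * ENNReal.ofReal (modWeight n α i) * diffMajorant α h i x := by
  have hn1 : (0:ℝ) < n := by exact_mod_cast hn0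
  rcases le_or_gt (i + 1) n with hi | hi
  · have hle : dirichletMajorant i (x + α * h / 2) ≤ diffMajorant α h i x := by
      rw [diffMajorant_eq]; exact le_self_add
    have hin : ((i : ℝ) + 1) ≤ n := by exact_mod_cast hi
    have hk : ∀ k ∈ Finset.range (i + 1), ((k : ℝ) + 1) * |h| ∈ Set.Icc 0 (2 * π) := by
      intro k hk
      have hki : (k : ℝ) + 1 ≤ n := by
        have : k + 1 ≤ n := by have := Finset.mem_range.1 hk; omega
        exact_mod_cast this
      refine ⟨by positivity, ?_⟩
      calc ((k : ℝ) + 1) * |h| ≤ n * (1 / n) := by gcongr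
        _ = 1 := by field_simp
        _ ≤ 2 * π := by linarith [Real.pi_gt_three]
    have hsum : ∃ θ : ℝ, HasSum (fun ν : ℕ => diffCoeff α ν * cosSum i (x + (α - ν) * h))
        (∑ k ∈ Finset.range (i + 1), (2 * sin (((k : ℝ) + 1) * |h| / 2)) ^ α *
          cos ((k + 1) * (x + α * h / 2) + θ)) := by
      rcases le_total 0 h with h0 | h0
      · refine ⟨α * π / 2, ?_⟩
        simp_rw [cosSum, Finset.mul_sum]
        refine hasSum_sum fun k hk' => ?_
        convert hasSum_diffCoeff_mul_cos_add hα (hk k hk') ((k + 1) * x) using 3 with ν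
        · rw [abs_of_nonneg h0]; ring_nf
        · rw [abs_of_nonneg h0]; ring_nf
      · refine ⟨-(α * π / 2), ?_⟩
        simp_rw [cosSum, Finset.mul_sum]
        refine hasSum_sum fun k hk' => ?_
        convert hasSum_diffCoeff_mul_cos_sub hα (hk k hk') ((k + 1) * x) using 3 with ν
        · rw [abs_of_nonpos h0]; ring_nf
        · rw [abs_of_nonpos h0]; ring_nf
    obtain ⟨θ, hθ⟩ := hsum
    rw [hθ.tsum_eq]
    exact (ofReal_abs_sum_sin_rpow_mul_cos_le hα (abs_nonneg h) hi hn _ θ).trans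
      (mul_le_mul' le_rfl hle)
  · have h1 : modWeight n α i = 1 := by
      have : (1:ℝ) ≤ ((i : ℝ) + 1) / n := by
        rw [le_div_iff₀ hn1, one_mul]; exact_mod_cast hi.le
      rw [modWeight, min_eq_right this, Real.one_rpow]
    rw [h1, ENNReal.ofReal_one, mul_one]
    exact ofReal_abs_tsum_cosSum_le α h i x

theorem dirichletMajorant_mono {i j : ℕ} (hij : i ≤ j) (x : ℝ) :
    dirichletMajorant i x ≤ dirichletMajorant j x := by
  unfold dirichletMajorant
  refine min_le_min ?_ le_rfl
  unfold freq
  gcongr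

theorem exists_tester_low {α : ℝ} (hα : 0 < α) {n i : ℕ} (hi : i + 1 ≤ n) :
    ∃ (q : ℝ → ℝ) (l : ℕ → ℝ), Continuous q ∧ Function.Periodic q (2 * π) ∧
      (∀ x, ENNReal.ofReal |q x| ≤ 2 * diffMajorant α (1 / n) i x) ∧
      (∀ k, 0 ≤ l k) ∧
      (∀ x, HasSum (fun ν : ℕ => diffCoeff α ν * q (x - (α - ν) * (1 / n)))
        (∑ k ∈ Finset.range (i + 1), l k * cos ((k + 1) * x))) ∧
      2⁻¹ ^ (2 * α + 1) * (((i : ℝ) + 1) * modWeight n α i) ≤ ∑ k ∈ Finset.range (i + 1), l k := by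
  have hn0 : (0:ℝ) < n := by exact_mod_cast (by omega : 0 < n)
  have hk : ∀ k ∈ Finset.range (i + 1), ((k : ℝ) + 1) / n ≤ 1 := by
    intro k hk
    rw [div_le_one hn0]
    have : k + 1 ≤ n := by have := Finset.mem_range.1 hk; omega
    exact_mod_cast this
  refine ⟨fun x => ∑ k ∈ Finset.range (i + 1), cos ((k + 1) * (x + α * (1 / n) / 2) + α * π / 2),
    fun k => |2 * sin (((k : ℝ) + 1) / n / 2)| ^ α, by fun_prop, ?_, ?_,
    fun k => by positivity, ?_, ?_⟩
  · intro x
    refine Finset.sum_congr rfl fun k _ => ?_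
    have := Real.cos_add_nat_mul_two_pi ((k + 1) * (x + α * (1 / n) / 2) + α * π / 2) (k + 1)
    rw [← this]
    congr 1; push_cast; ring
  · intro x
    have h1 := ofReal_abs_sum_mul_cos_le (i := i) (ρ := fun _ => 1) zero_le_one
      (fun _ _ => le_rfl) (x + α * (1 / n) / 2) (α * π / 2)
    simp only [one_mul, ENNReal.ofReal_one, mul_one] at h1
    refine h1.trans (mul_le_mul' le_rfl ?_)
    rw [diffMajorant_eq]; exact le_self_add
  · intro x
    simp_rw [Finset.mul_sum]
    refine hasSum_sum fun k hk' => ?_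
    have ht : ((k : ℝ) + 1) / n ∈ Set.Icc 0 (2 * π) :=
      ⟨by positivity, (hk k hk').trans (by linarith [Real.pi_gt_three])⟩
    have h0 : 0 ≤ 2 * sin (((k : ℝ) + 1) / n / 2) :=
      (sin_half_mono ht.1 le_rfl (hk k hk')).1
    rw [abs_of_nonneg h0]
    convert hasSum_diffCoeff_mul_cos_sub hα ht
      ((k + 1) * (x + α * (1 / n) / 2) + α * π / 2) using 3 with ν
    · ring_nf
    · ring_nf
  · have h1 := mul_modWeight_le_sum n hα i
    have h2 : ∑ k ∈ Finset.range (i + 1), 2⁻¹ ^ α * modWeight n α k ≤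
        ∑ k ∈ Finset.range (i + 1), |2 * sin (((k : ℝ) + 1) / n / 2)| ^ α := by
      refine Finset.sum_le_sum fun k hk' => ?_
      rw [modWeight, min_eq_left (hk k hk'), ← Real.mul_rpow (by norm_num) (by positivity)]
      refine Real.rpow_le_rpow (by positivity) (le_trans ?_ (le_abs_self _)) hα.le
      have := half_le_two_mul_sin_half (t := ((k : ℝ) + 1) / n) (by positivity) (hk k hk')
      linarith
    refine le_trans ?_ h2
    rw [← Finset.mul_sum, show 2 * α + 1 = α + (α + 1) by ring,
      Real.rpow_add (by norm_num : (0:ℝ) < 2⁻¹), mul_assoc]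
    gcongr
    rw [Real.inv_rpow (by norm_num)]
    rw [inv_mul_le_iff₀ (by positivity)]
    exact h1

theorem exists_hasSum_diffCoeff_twice {α : ℝ} (hα : 0 < α) (t : ℝ) :
    ∃ A ψ : ℝ, (∀ y, HasSum (fun ν : ℕ => diffCoeff α ν * cos (y + (α - ν) * t))
        (A * cos (y + ψ))) ∧
      ∀ y, HasSum (fun ν : ℕ => diffCoeff α ν * (A * cos (y - (α - ν) * t + ψ)))
        (|2 * sin (t / 2)| ^ (2 * α) * cos y) := by
  obtain ⟨T, m, hT, ht⟩ : ∃ (T : ℝ) (m : ℤ), T ∈ Set.Icc 0 (2 * π) ∧ t = T + m * (2 * π) := by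
    refine ⟨2 * π * Int.fract (t / (2 * π)), ⌊t / (2 * π)⌋, ⟨?_, ?_⟩, ?_⟩
    · have := Int.fract_nonneg (t / (2 * π)); positivity
    · exact mul_le_of_le_one_right (by positivity) (Int.fract_lt_one _).le
    · rw [Int.fract]; field_simp; ring
  have hs : |2 * sin (t / 2)| = 2 * sin (T / 2) := by
    have h0 : 0 ≤ sin (T / 2) := Real.sin_nonneg_of_nonneg_of_le_pi (by linarith [hT.1])
      (by linarith [hT.2])
    rw [ht, show (T + m * (2 * π)) / 2 = T / 2 + m * π by ring, abs_mul, abs_two]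
    congr 1
    rw [Real.sin_add_int_mul_pi, abs_mul, abs_zpow, abs_neg, abs_one, one_zpow, one_mul,
      abs_of_nonneg h0]
  have h0 : 0 ≤ 2 * sin (T / 2) := hs ▸ abs_nonneg _
  refine ⟨(2 * sin (T / 2)) ^ α, α * t + α * (π - T) / 2, fun y => ?_, fun y => ?_⟩
  · convert hasSum_diffCoeff_mul_cos hα hT (y + α * t) using 2 with ν
    · rw [← Real.cos_add_int_mul_two_pi (y + (α - ν) * t) (ν * m)]
      congr 2
      push_cast
      rw [ht]; ring
    · ring_nf
  · have h := (hasSum_diffCoeff_mul_cos hα hT (-y - α * (π - T) / 2)).mul_left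
      ((2 * sin (T / 2)) ^ α)
    have e1 : ∀ ν : ℕ, (2 * sin (T / 2)) ^ α *
          (diffCoeff α ν * cos (-y - α * (π - T) / 2 - ν * T)) = diffCoeff α ν *
            ((2 * sin (T / 2)) ^ α * cos (y - (α - ν) * t + (α * t + α * (π - T) / 2))) := by
      intro ν
      rw [mul_left_comm, ← Real.cos_neg (y - (α - ν) * t + (α * t + α * (π - T) / 2)),
        ← Real.cos_add_int_mul_two_pi (-(y - (α - ν) * t + (α * t + α * (π - T) / 2))) (ν * m)]
      congr 3
      push_cast
      rw [ht]; ring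
    have e2 : |2 * sin (t / 2)| ^ (2 * α) * cos y = (2 * sin (T / 2)) ^ α *
        ((2 * sin (T / 2)) ^ α * cos (-y - α * (π - T) / 2 + α * (π - T) / 2)) := by
      rw [hs, two_mul α, Real.rpow_add' h0 (by positivity), mul_assoc, ← Real.cos_neg y]
      congr 3; ring
    simp_rw [e1] at h
    rw [e2]
    exact h

theorem sin_half_rpow_le_add {β : ℝ} (hβ : 0 < β) (x : ℝ) :
    sin (1 / 2) ^ β ≤ |2 * sin x| ^ β + |2 * sin (x + 1 / 2)| ^ β := by
  have h0 : 0 ≤ sin (1 / 2) :=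
    Real.sin_nonneg_of_nonneg_of_le_pi (by norm_num) (by linarith [Real.pi_gt_three])
  have h1 : sin (1 / 2) ≤ |sin x| + |sin (x + 1 / 2)| := by
    have e : sin (1 / 2) = sin (x + 1 / 2) * cos x - cos (x + 1 / 2) * sin x := by
      rw [← Real.sin_sub]; congr 1; ring
    rw [e]
    refine (le_abs_self _).trans ((abs_sub _ _).trans ?_)
    rw [abs_mul, abs_mul, add_comm]
    exact add_le_add (mul_le_of_le_one_left (abs_nonneg _) (Real.abs_cos_le_one _))
      (mul_le_of_le_one_right (abs_nonneg _) (Real.abs_cos_le_one _))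
  have h2 : ∀ y, |2 * sin y| = 2 * |sin y| := fun y => by rw [abs_mul, abs_two]
  rcases le_total (sin (1 / 2)) (2 * |sin x|) with h | h
  · have := Real.rpow_le_rpow h0 h hβ.le
    rw [h2]
    exact this.trans (le_add_of_nonneg_right (by positivity))
  · have := Real.rpow_le_rpow h0 (show sin (1 / 2) ≤ 2 * |sin (x + 1 / 2)| by linarith) hβ.le
    rw [h2 (x + 1 / 2)]
    exact this.trans (le_add_of_nonneg_left (by positivity))

theorem le_sum_sin_rpow {β : ℝ} (hβ : 0 < β) {n K : ℕ} (hn : 1 ≤ n) (hK : 2 * n ≤ K) :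
    sin (1 / 2) ^ β / 4 * K ≤
      ∑ k ∈ Finset.range K, |2 * sin (((k : ℝ) + 1) / n / 2)| ^ β := by
  set l : ℕ → ℝ := fun k => |2 * sin (((k : ℝ) + 1) / n / 2)| ^ β with hl
  have hl0 : ∀ k, 0 ≤ l k := fun k => by positivity
  have hn0 : (0:ℝ) < n := by exact_mod_cast hn
  have hc : 0 ≤ sin (1 / 2) ^ β := Real.rpow_nonneg
    (Real.sin_nonneg_of_nonneg_of_le_pi (by norm_num) (by linarith [Real.pi_gt_three])) _
  have h1 : ∑ k ∈ Finset.range (K - n), l k ≤ ∑ k ∈ Finset.range K, l k :=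
    Finset.sum_le_sum_of_subset_of_nonneg (Finset.range_mono (by omega)) fun k _ _ => hl0 k
  have h2 : ∑ k ∈ Finset.range (K - n), l (n + k) ≤ ∑ k ∈ Finset.range K, l k := by
    have := Finset.sum_range_add l n (K - n)
    rw [show n + (K - n) = K by omega] at this
    rw [this]
    exact le_add_of_nonneg_left (Finset.sum_nonneg fun k _ => hl0 k)
  have h3 : ∑ k ∈ Finset.range (K - n), sin (1 / 2) ^ β ≤
      ∑ k ∈ Finset.range (K - n), (l k + l (n + k)) := by
    refine Finset.sum_le_sum fun k _ => ?_
    have h := sin_half_rpow_le_add hβ (((k : ℝ) + 1) / n / 2)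
    have e : ((k : ℝ) + 1) / n / 2 + 1 / 2 = (((n + k : ℕ) : ℝ) + 1) / n / 2 := by
      push_cast
      field_simp
      ring
    rwa [e] at h
  rw [Finset.sum_add_distrib, Finset.sum_const, Finset.card_range, nsmul_eq_mul] at h3
  have h4 : (K : ℝ) / 2 ≤ ((K - n : ℕ) : ℝ) := by
    rw [Nat.cast_sub (by omega)]
    have : (2:ℝ) * n ≤ K := by exact_mod_cast hK
    linarith
  nlinarith

theorem exists_tester_high {α : ℝ} (hα : 0 < α) {n i : ℕ} (hn : 1 ≤ n) (hi : 2 * n ≤ i + 1) :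
    ∃ (q : ℝ → ℝ) (l : ℕ → ℝ), Continuous q ∧ Function.Periodic q (2 * π) ∧
      (∀ x, ENNReal.ofReal |q x| ≤ 2 * diffMajorant α (1 / n) i x) ∧
      (∀ k, 0 ≤ l k) ∧
      (∀ x, HasSum (fun ν : ℕ => diffCoeff α ν * q (x - (α - ν) * (1 / n)))
        (∑ k ∈ Finset.range (i + 1), l k * cos ((k + 1) * x))) ∧
      sin (1 / 2) ^ (2 * α) / 4 * ((i : ℝ) + 1) ≤ ∑ k ∈ Finset.range (i + 1), l k := by
  choose A ψ hA hA2 using fun k : ℕ => exists_hasSum_diffCoeff_twice hα (((k : ℝ) + 1) / n)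
  refine ⟨fun x => ∑ k ∈ Finset.range (i + 1), A k * cos ((k + 1) * x + ψ k),
    fun k => |2 * sin (((k : ℝ) + 1) / n / 2)| ^ (2 * α), by fun_prop, ?_, ?_,
    fun k => by positivity, ?_, ?_⟩
  · intro x
    refine Finset.sum_congr rfl fun k _ => ?_
    have := Real.cos_add_nat_mul_two_pi ((k + 1) * x + ψ k) (k + 1)
    rw [← this]
    congr 2; push_cast; ring
  · intro x
    refine le_trans (le_of_eq ?_) (ofReal_abs_tsum_cosSum_le α (1 / n) i x)
    have : HasSum (fun ν : ℕ => diffCoeff α ν * cosSum i (x + (α - ν) * (1 / n)))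
        (∑ k ∈ Finset.range (i + 1), A k * cos ((k + 1) * x + ψ k)) := by
      simp_rw [cosSum, Finset.mul_sum]
      refine hasSum_sum fun k _ => ?_
      convert hA k ((k + 1) * x) using 4 with ν
      ring
    rw [this.tsum_eq]
  · intro x
    simp_rw [Finset.mul_sum]
    refine hasSum_sum fun k _ => ?_
    convert hA2 k ((k + 1) * x) using 5 with ν
    ring
  · have := le_sum_sin_rpow (β := 2 * α) (by positivity) hn hi
    push_cast at this
    exact this

theorem exists_tester {α : ℝ} (hα : 0 < α) :
    ∃ c : ℝ, 0 < c ∧ ∀ n i : ℕ, 1 ≤ n →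
      ∃ (q : ℝ → ℝ) (l : ℕ → ℝ), Continuous q ∧ Function.Periodic q (2 * π) ∧
        (∀ x, ENNReal.ofReal |q x| ≤ 2 * diffMajorant α (1 / n) i x) ∧
        (∀ k, 0 ≤ l k) ∧
        (∀ x, HasSum (fun ν : ℕ => diffCoeff α ν * q (x - (α - ν) * (1 / n)))
          (∑ k ∈ Finset.range (i + 1), l k * cos ((k + 1) * x))) ∧
        c * (((i : ℝ) + 1) * modWeight n α i) ≤ ∑ k ∈ Finset.range (i + 1), l k := by
  have hsin : 0 < sin (1 / 2) :=
    Real.sin_pos_of_pos_of_lt_pi (by norm_num) (by linarith [Real.pi_gt_three])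
  have hc1 : 0 < sin (1 / 2) ^ (2 * α) / 4 := by positivity
  have hc2 : (0:ℝ) < 2⁻¹ ^ (2 * α + 1) := by positivity
  refine ⟨min (sin (1 / 2) ^ (2 * α) / 4) (2⁻¹ ^ (2 * α + 1) / 2), by positivity,
    fun n i hn => ?_⟩
  have hn0 : (0:ℝ) < n := by exact_mod_cast hn
  have hw := modWeight_nonneg n α i
  have hw1 : modWeight n α i ≤ 1 :=
    Real.rpow_le_one (le_min (by positivity) zero_le_one) (min_le_right _ _) hα.le
  rcases le_or_gt (i + 1) n with hi | hi
  · obtain ⟨q, l, h1, h2, h3, h4, h5, h6⟩ := exists_tester_low hα hi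
    refine ⟨q, l, h1, h2, h3, h4, h5, le_trans ?_ h6⟩
    gcongr
    exact (min_le_right _ _).trans (by linarith)
  rcases le_or_gt (2 * n) (i + 1) with hi2 | hi2
  · obtain ⟨q, l, h1, h2, h3, h4, h5, h6⟩ := exists_tester_high hα hn hi2
    refine ⟨q, l, h1, h2, h3, h4, h5, le_trans ?_ h6⟩
    gcongr
    · exact min_le_left _ _
    · exact mul_le_of_le_one_right (by positivity) hw1
  · obtain ⟨j, rfl⟩ : ∃ j, n = j + 1 := ⟨n - 1, by omega⟩
    obtain ⟨q, l, h1, h2, h3, h4, h5, h6⟩ := exists_tester_low hα (le_refl (j + 1))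
    have hsub : Finset.range (j + 1) ⊆ Finset.range (i + 1) := Finset.range_mono (by omega)
    have hsum : ∀ z : ℕ → ℝ, ∑ k ∈ Finset.range (i + 1), (if k ≤ j then l k else 0) * z k =
        ∑ k ∈ Finset.range (j + 1), l k * z k := by
      intro z
      rw [← Finset.sum_subset hsub]
      · refine Finset.sum_congr rfl fun k hk => ?_
        rw [if_pos (Nat.lt_succ_iff.1 (Finset.mem_range.1 hk))]
      · intro k _ hk
        rw [if_neg (by simpa [Nat.lt_succ_iff] using hk), zero_mul]
    refine ⟨q, fun k => if k ≤ j then l k else 0, h1, h2, fun x => (h3 x).trans ?_, ?_, ?_, ?_⟩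
    · refine mul_le_mul' le_rfl (ENNReal.tsum_le_tsum fun ν => mul_le_mul' le_rfl ?_)
      exact dirichletMajorant_mono (by omega) _
    · intro k
      dsimp only
      split_ifs
      exacts [h4 k, le_rfl]
    · intro x
      rw [hsum fun k => cos ((k + 1) * x)]
      exact h5 x
    · have h7 := hsum fun _ => 1
      simp only [mul_one] at h7
      rw [h7]
      refine le_trans ?_ h6
      have h8 : modWeight (j + 1) α j = 1 := by
        have : ((j : ℝ) + 1) / ((j + 1 : ℕ) : ℝ) = 1 := by
          push_cast; exact div_self (by positivity)
        rw [modWeight, this, min_self, Real.one_rpow]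
      have h9 : (i : ℝ) + 1 ≤ 2 * (j + 1) := by exact_mod_cast hi2.le
      rw [h8, mul_one]
      calc _ ≤ (2⁻¹ ^ (2 * α + 1) / 2) * ((2 * ((j : ℝ) + 1)) * 1) := by
            gcongr
            exact min_le_right _ _
        _ = _ := by ring

/-- Lebesgue measure on the period square. -/
abbrev squareMeasure : Measure (ℝ × ℝ) := periodMeasure.prod periodMeasure

/-- Measurable functions, periodic in each variable, and integrable over the period square. -/
structure IsPerInt (g : ℝ → ℝ → ℝ) : Prop where
  meas : Measurable (Function.uncurry g)
  per_x : ∀ y, Function.Periodic (fun x => g x y) (2 * π)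
  per_y : ∀ x, Function.Periodic (g x) (2 * π)
  int : Integrable (Function.uncurry g) squareMeasure

/-- Continuous `2π`-periodic functions. -/
structure IsTest (φ : ℝ → ℝ) : Prop where
  cont : Continuous φ
  per : Function.Periodic φ (2 * π)

theorem IsTest.exists_bound {φ : ℝ → ℝ} (h : IsTest φ) : ∃ B, 0 ≤ B ∧ ∀ x, |φ x| ≤ B := by
  obtain ⟨B, hB⟩ := (h.per.isBounded_of_continuous (by positivity) h.cont).exists_norm_le
  exact ⟨B, (norm_nonneg _).trans (hB _ ⟨0, rfl⟩), fun x => hB _ ⟨x, rfl⟩⟩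

theorem IsTest.comp_sub {φ : ℝ → ℝ} (h : IsTest φ) (s : ℝ) : IsTest fun x => φ (x - s) :=
  ⟨h.cont.comp (by fun_prop), fun x => by
    rw [show x + 2 * π - s = x - s + 2 * π by ring, h.per]⟩

theorem isTest_cos (k : ℕ) (θ : ℝ) : IsTest fun x => cos (k * x + θ) :=
  ⟨by fun_prop, fun x => by
    rw [show (k : ℝ) * (x + 2 * π) + θ = k * x + θ + k * (2 * π) by ring,
      Real.cos_add_nat_mul_two_pi]⟩

theorem IsPerInt.flip {g : ℝ → ℝ → ℝ} (h : IsPerInt g) : IsPerInt fun y x => g x y :=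
  ⟨h.meas.comp measurable_swap, h.per_y, h.per_x, h.int.swap⟩

theorem lintegral_square_add_fst {G : ℝ × ℝ → ℝ≥0∞} (hm : Measurable G)
    (hp : ∀ y, Function.Periodic (fun x => G (x, y)) (2 * π)) (s : ℝ) :
    ∫⁻ z, G (z.1 + s, z.2) ∂squareMeasure = ∫⁻ z, G z ∂squareMeasure := by
  rw [lintegral_prod_symm' _ (by fun_prop), lintegral_prod_symm' _ hm]
  congr 1; ext y
  exact lintegral_periodMeasure_add (hp y) s

theorem integrable_square_add_fst {G : ℝ × ℝ → ℝ} (hm : Measurable G)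
    (hp : ∀ y, Function.Periodic (fun x => G (x, y)) (2 * π)) (hi : Integrable G squareMeasure)
    (s : ℝ) : Integrable (fun z => G (z.1 + s, z.2)) squareMeasure := by
  refine ⟨Measurable.aestronglyMeasurable (by fun_prop), ?_⟩
  rw [HasFiniteIntegral, lintegral_square_add_fst (G := fun z => ‖G z‖ₑ) (by fun_prop)
    (fun y x => by simp only; rw [show G (x + 2 * π, y) = G (x, y) from hp y x])]
  exact hi.2

theorem integral_square_add_fst {G : ℝ × ℝ → ℝ} (hm : Measurable G)
    (hp : ∀ y, Function.Periodic (fun x => G (x, y)) (2 * π)) (hi : Integrable G squareMeasure)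
    (s : ℝ) : ∫ z, G (z.1 + s, z.2) ∂squareMeasure = ∫ z, G z ∂squareMeasure := by
  rw [integral_eq_lintegral_pos_part_sub_lintegral_neg_part (integrable_square_add_fst hm hp hi s),
    integral_eq_lintegral_pos_part_sub_lintegral_neg_part hi,
    lintegral_square_add_fst (G := fun z => ENNReal.ofReal (G z)) (by fun_prop)
      (fun y x => by simp only; rw [show G (x + 2 * π, y) = G (x, y) from hp y x]),
    lintegral_square_add_fst (G := fun z => ENNReal.ofReal (-G z)) (by fun_prop)
      (fun y x => by simp only; rw [show G (x + 2 * π, y) = G (x, y) from hp y x])]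

theorem tsum_enorm_diffCoeff_ne_top {α : ℝ} (hα : 0 < α) : ∑' ν, ‖diffCoeff α ν‖ₑ ≠ ⊤ := by
  have := (summable_abs_diffCoeff hα).tsum_ofReal_ne_top
  simpa [Real.enorm_eq_ofReal_abs] using this

theorem diffX_eq (α h : ℝ) (g : ℝ → ℝ → ℝ) (x y : ℝ) :
    diffX α h g x y = ∑' ν : ℕ, diffCoeff α ν * g (x + (α - ν) * h) y := rfl

theorem IsPerInt.lintegral_enorm_ne_top {g : ℝ → ℝ → ℝ} (hg : IsPerInt g) :
    ∫⁻ z, ‖g z.1 z.2‖ₑ ∂squareMeasure ≠ ⊤ := hg.int.2.ne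

theorem IsPerInt.lintegral_tsum_diff {g : ℝ → ℝ → ℝ} (hg : IsPerInt g) {α : ℝ} (hα : 0 < α)
    (h : ℝ) :
    ∑' ν : ℕ, ∫⁻ z, ‖diffCoeff α ν * g (z.1 + (α - ν) * h) z.2‖ₑ ∂squareMeasure ≠ ⊤ := by
  have hm := hg.meas
  have e : ∀ ν : ℕ, ∫⁻ z, ‖diffCoeff α ν * g (z.1 + (α - ν) * h) z.2‖ₑ ∂squareMeasure =
      ‖diffCoeff α ν‖ₑ * ∫⁻ z, ‖g z.1 z.2‖ₑ ∂squareMeasure := by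
    intro ν
    simp_rw [enorm_mul]
    have hm' : Measurable fun z : ℝ × ℝ => ‖g z.1 z.2‖ₑ := hm.enorm
    rw [lintegral_const_mul]
    · congr 1
      exact lintegral_square_add_fst (G := fun z => ‖g z.1 z.2‖ₑ) hm'
        (fun y x => by simp only; rw [show g (x + 2 * π) y = g x y from hg.per_x y x]) _
    · exact hm'.comp (by fun_prop : Measurable fun z : ℝ × ℝ => (z.1 + (α - ν) * h, z.2))
  simp_rw [e]
  rw [ENNReal.tsum_mul_right]
  exact ENNReal.mul_ne_top (tsum_enorm_diffCoeff_ne_top hα) hg.lintegral_enorm_ne_top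

theorem IsPerInt.diffX {g : ℝ → ℝ → ℝ} (hg : IsPerInt g) {α : ℝ} (hα : 0 < α) (h : ℝ) :
    IsPerInt (diffX α h g) := by
  have hm : ∀ ν : ℕ, Measurable fun z : ℝ × ℝ => diffCoeff α ν * g (z.1 + (α - ν) * h) z.2 :=
    fun ν => (hg.meas.comp
      (by fun_prop : Measurable fun z : ℝ × ℝ => (z.1 + (α - ν) * h, z.2))).const_mul _
  have hM : Measurable (Function.uncurry (_root_.diffX α h g)) := Measurable.tsum hm
  refine ⟨hM, fun y x => ?_, fun x y => ?_, hM.aestronglyMeasurable, ?_⟩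
  · simp only [diffX_eq]
    congr 1; ext ν
    rw [show x + 2 * π + (α - ν) * h = x + (α - ν) * h + 2 * π by ring,
      show g (x + (α - ν) * h + 2 * π) y = g (x + (α - ν) * h) y from hg.per_x y _]
  · simp only [diffX_eq]
    congr 1; ext ν
    rw [hg.per_y]
  · refine lt_of_le_of_lt (b := ∫⁻ z : ℝ × ℝ, ∑' ν : ℕ,
      ‖diffCoeff α ν * g (z.1 + (α - ν) * h) z.2‖ₑ ∂squareMeasure)
      (lintegral_mono fun z => enorm_tsum_le_tsum_enorm) ?_
    rw [lintegral_tsum fun ν => (hm ν).enorm.aemeasurable]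
    exact (hg.lintegral_tsum_diff hα h).lt_top

theorem IsPerInt.diffY {g : ℝ → ℝ → ℝ} (hg : IsPerInt g) {α : ℝ} (hα : 0 < α) (h : ℝ) :
    IsPerInt (diffY α h g) :=
  (hg.flip.diffX hα h).flip

/-- Integration against a product of two functions of one variable. -/
def pairing (g : ℝ → ℝ → ℝ) (φ ψ : ℝ → ℝ) : ℝ :=
  ∫ z, g z.1 z.2 * φ z.1 * ψ z.2 ∂squareMeasure

theorem pairing_flip (g : ℝ → ℝ → ℝ) (φ ψ : ℝ → ℝ) :
    pairing (fun y x => g x y) ψ φ = pairing g φ ψ := by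
  unfold pairing squareMeasure
  rw [← integral_prod_swap]
  congr 1; ext z
  simp only [Prod.fst_swap, Prod.snd_swap]
  ring

theorem IsPerInt.integrable_mul_mul {g : ℝ → ℝ → ℝ} (hg : IsPerInt g) {φ ψ : ℝ → ℝ}
    (hφ : IsTest φ) (hψ : IsTest ψ) :
    Integrable (fun z => g z.1 z.2 * φ z.1 * ψ z.2) squareMeasure := by
  obtain ⟨B, -, hB⟩ := hφ.exists_bound
  obtain ⟨B', -, hB'⟩ := hψ.exists_bound
  have h1 := hφ.cont
  have h2 := hψ.cont
  refine Integrable.mul_bdd (c := B') (Integrable.mul_bdd (c := B) hg.int ?_ ?_) ?_ ?_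
  · exact (h1.comp continuous_fst).aestronglyMeasurable
  · exact .of_forall fun z => hB _
  · exact (h2.comp continuous_snd).aestronglyMeasurable
  · exact .of_forall fun z => hB' _

theorem pairing_diffX {g : ℝ → ℝ → ℝ} (hg : IsPerInt g) {α : ℝ} (hα : 0 < α) (h : ℝ)
    {φ φ' ψ : ℝ → ℝ} (hφ : IsTest φ) (hψ : IsTest ψ)
    (hs : ∀ x, HasSum (fun ν : ℕ => diffCoeff α ν * φ (x - (α - ν) * h)) (φ' x)) :
    pairing (diffX α h g) φ ψ = pairing g φ' ψ := by
  obtain ⟨B, hB0, hB⟩ := hφ.exists_bound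
  obtain ⟨B', hB'0, hB'⟩ := hψ.exists_bound
  have hm : ∀ ν : ℕ, Measurable fun z : ℝ × ℝ => g (z.1 + (α - ν) * h) z.2 := fun ν =>
    hg.meas.comp (by fun_prop : Measurable fun z : ℝ × ℝ => (z.1 + (α - ν) * h, z.2))
  have hm0 : Measurable fun z : ℝ × ℝ => g z.1 z.2 := hg.meas
  have hφm := hφ.cont.measurable
  have hψm := hψ.cont.measurable
  have hb : ∀ u v w : ℝ, |v| ≤ B → |w| ≤ B' → ‖u * v * w‖ₑ ≤ ‖u‖ₑ * ENNReal.ofReal (B * B') := by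
    intro u v w hv hw
    rw [enorm_mul, enorm_mul, mul_assoc, ENNReal.ofReal_mul hB0, Real.enorm_eq_ofReal_abs v,
      Real.enorm_eq_ofReal_abs w]
    gcongr
  have e1 : ∀ z : ℝ × ℝ, diffX α h g z.1 z.2 * φ z.1 * ψ z.2 =
      ∑' ν : ℕ, diffCoeff α ν * g (z.1 + (α - ν) * h) z.2 * φ z.1 * ψ z.2 := by
    intro z; rw [diffX_eq, ← tsum_mul_right, ← tsum_mul_right]
  have e2 : ∀ z : ℝ × ℝ, g z.1 z.2 * φ' z.1 * ψ z.2 =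
      ∑' ν : ℕ, diffCoeff α ν * g z.1 z.2 * φ (z.1 - (α - ν) * h) * ψ z.2 := by
    intro z
    rw [← (hs z.1).tsum_eq, ← tsum_mul_left, ← tsum_mul_right]
    congr 1; ext ν; ring
  unfold pairing
  simp_rw [e1, e2]
  rw [integral_tsum, integral_tsum]
  · congr 1; ext ν
    have := integral_square_add_fst
      (G := fun z => diffCoeff α ν * g z.1 z.2 * φ (z.1 - (α - ν) * h) * ψ z.2)
      (by fun_prop)
      (fun y x => by
        simp only
        rw [show g (x + 2 * π) y = g x y from hg.per_x y x,
          show x + 2 * π - (α - ν) * h = x - (α - ν) * h + 2 * π by ring, hφ.per])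
      (by
        have := ((hg.integrable_mul_mul (hφ.comp_sub ((α - ν) * h)) hψ).const_mul (diffCoeff α ν))
        convert this using 2 with z
        ring) ((α - ν) * h)
    rw [← this]
    simp
  · intro ν; exact Measurable.aestronglyMeasurable (by fun_prop)
  · refine ne_top_of_le_ne_top (b := (∑' ν, ‖diffCoeff α ν‖ₑ) *
      ((∫⁻ z, ‖g z.1 z.2‖ₑ ∂squareMeasure) * ENNReal.ofReal (B * B')))
      (ENNReal.mul_ne_top (tsum_enorm_diffCoeff_ne_top hα)
        (ENNReal.mul_ne_top hg.lintegral_enorm_ne_top ENNReal.ofReal_ne_top)) ?_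
    rw [← ENNReal.tsum_mul_right]
    refine ENNReal.tsum_le_tsum fun ν => ?_
    rw [← lintegral_mul_const _ (by fun_prop), ← lintegral_const_mul _ (by fun_prop)]
    refine lintegral_mono fun z => (hb _ _ _ (hB _) (hB' _)).trans ?_
    rw [enorm_mul, mul_assoc]
  · intro ν; exact Measurable.aestronglyMeasurable (by fun_prop)
  · refine ne_top_of_le_ne_top (b := (∑' ν : ℕ,
      ∫⁻ z, ‖diffCoeff α ν * g (z.1 + (α - ν) * h) z.2‖ₑ ∂squareMeasure) *
        ENNReal.ofReal (B * B'))
      (ENNReal.mul_ne_top (hg.lintegral_tsum_diff hα h) ENNReal.ofReal_ne_top) ?_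
    rw [← ENNReal.tsum_mul_right]
    refine ENNReal.tsum_le_tsum fun ν => ?_
    rw [← lintegral_mul_const _ (by fun_prop)]
    exact lintegral_mono fun z => hb _ _ _ (hB _) (hB' _)

theorem pairing_diffY {g : ℝ → ℝ → ℝ} (hg : IsPerInt g) {α : ℝ} (hα : 0 < α) (h : ℝ)
    {φ ψ ψ' : ℝ → ℝ} (hφ : IsTest φ) (hψ : IsTest ψ)
    (hs : ∀ x, HasSum (fun ν : ℕ => diffCoeff α ν * ψ (x - (α - ν) * h)) (ψ' x)) :
    pairing (diffY α h g) φ ψ = pairing g φ ψ' := by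
  rw [← pairing_flip, ← pairing_flip g]
  exact pairing_diffX hg.flip hα h hψ hφ hs

theorem Lp2Norm_eq {p : ℝ} (hp : 0 < p) (f : ℝ → ℝ → ℝ) :
    Lp2Norm p f =
      (∫⁻ x, ∫⁻ y, ENNReal.ofReal |f x y| ^ p ∂periodMeasure ∂periodMeasure) ^ (1 / p) := by
  unfold Lp2Norm
  simp_rw [ENNReal.ofReal_rpow_of_nonneg (abs_nonneg _) hp.le]

theorem integrable_of_lintegral_rpow {X : Type*} [MeasurableSpace X] {μ : Measure X}
    [IsFiniteMeasure μ] {p : ℝ} (hp : 1 < p) {g : X → ℝ} (hg : Measurable g)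
    (h : ∫⁻ z, ENNReal.ofReal |g z| ^ p ∂μ ≠ ⊤) : Integrable g μ := by
  refine ⟨hg.aestronglyMeasurable, ?_⟩
  refine lt_of_le_of_lt (b := ∫⁻ z, 1 + ENNReal.ofReal |g z| ^ p ∂μ)
    (lintegral_mono fun z => ?_) ?_
  · rw [Real.enorm_eq_ofReal_abs]
    rcases le_total (ENNReal.ofReal |g z|) 1 with h1 | h1
    · exact h1.trans le_self_add
    · refine le_trans ?_ le_add_self
      conv_lhs => rw [← ENNReal.rpow_one (ENNReal.ofReal |g z|)]
      exact ENNReal.rpow_le_rpow_of_exponent_le h1 hp.le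
  · rw [lintegral_add_left measurable_const]
    simp only [lintegral_const, one_mul]
    exact ENNReal.add_lt_top.2 ⟨measure_lt_top _ _, h.lt_top⟩

theorem MemLp0.isPerInt {p : ℝ} (hp : 1 < p) {f : ℝ → ℝ → ℝ} (hf : MemLp0 p f) : IsPerInt f := by
  refine ⟨hf.meas, hf.periodic_x, hf.periodic_y, ?_⟩
  refine integrable_of_lintegral_rpow hp hf.meas ?_
  have hm := hf.meas
  rw [lintegral_prod _ (Measurable.aemeasurable (by fun_prop))]
  have := hf.norm_ne_top
  rw [Lp2Norm_eq (by linarith)] at this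
  intro h
  refine this ?_
  simp only [Function.uncurry] at h
  rw [h, ENNReal.top_rpow_of_pos (by positivity)]

theorem isTest_sin (k : ℕ) : IsTest fun x => sin (k * x) :=
  ⟨by fun_prop, fun x => by
    rw [show (k : ℝ) * (x + 2 * π) = k * x + k * (2 * π) by ring,
      Real.sin_add_nat_mul_two_pi]⟩

theorem isTest_cos' (k : ℕ) : IsTest fun x => cos (k * x) := by
  simpa using isTest_cos k 0

theorem IsPerInt.pairing_eq {f : ℝ → ℝ → ℝ} (hf : IsPerInt f) {φ ψ : ℝ → ℝ}
    (hφ : IsTest φ) (hψ : IsTest ψ) :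
    pairing f φ ψ =
      ∫ x in (0:ℝ)..(2*π), ∫ y in (0:ℝ)..(2*π), f x y * φ x * ψ y := by
  have hpi : (0:ℝ) ≤ 2 * π := by positivity
  unfold pairing
  rw [integral_prod _ (hf.integrable_mul_mul hφ hψ), intervalIntegral.integral_of_le hpi]
  simp_rw [intervalIntegral.integral_of_le hpi]

theorem InMclass.pairing_cos_cos {p : ℝ} (hp : 1 < p) {f : ℝ → ℝ → ℝ} {a : ℕ → ℕ → ℝ}
    (h : InMclass p f a) {k l : ℕ} (hk : 1 ≤ k) (hl : 1 ≤ l) (θ η : ℝ) :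
    pairing f (fun x => cos (k * x + θ)) (fun y => cos (l * y + η)) =
      π ^ 2 * (cos θ * cos η * a k l) := by
  have hf := h.1.isPerInt hp
  have hpi : π ^ 2 ≠ 0 := by positivity
  have hcc : pairing f (fun x => cos (k * x)) (fun y => cos (l * y)) = π ^ 2 * a k l := by
    rw [hf.pairing_eq (isTest_cos' k) (isTest_cos' l), ← h.2.1 k l hk hl, fourierCC]
    field_simp
  have hsc : pairing f (fun x => sin (k * x)) (fun y => cos (l * y)) = 0 := by
    rw [hf.pairing_eq (isTest_sin k) (isTest_cos' l)]
    have := (h.2.2.1 k l).1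
    rw [fourierSC] at this
    simpa [hpi] using this
  have hcs : pairing f (fun x => cos (k * x)) (fun y => sin (l * y)) = 0 := by
    rw [hf.pairing_eq (isTest_cos' k) (isTest_sin l)]
    have := (h.2.2.1 k l).2.1
    rw [fourierCS] at this
    simpa [hpi] using this
  have hss : pairing f (fun x => sin (k * x)) (fun y => sin (l * y)) = 0 := by
    rw [hf.pairing_eq (isTest_sin k) (isTest_sin l)]
    have := (h.2.2.1 k l).2.2
    rw [fourierSS] at this
    simpa [hpi] using this
  have i1 := hf.integrable_mul_mul (isTest_cos' k) (isTest_cos' l)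
  have i2 := hf.integrable_mul_mul (isTest_sin k) (isTest_cos' l)
  have i3 := hf.integrable_mul_mul (isTest_cos' k) (isTest_sin l)
  have i4 := hf.integrable_mul_mul (isTest_sin k) (isTest_sin l)
  have e : pairing f (fun x => cos (k * x + θ)) (fun y => cos (l * y + η)) =
      (cos θ * cos η) * pairing f (fun x => cos (k * x)) (fun y => cos (l * y))
      - (sin θ * cos η) * pairing f (fun x => sin (k * x)) (fun y => cos (l * y))
      - (cos θ * sin η) * pairing f (fun x => cos (k * x)) (fun y => sin (l * y))
      + (sin θ * sin η) * pairing f (fun x => sin (k * x)) (fun y => sin (l * y)) := by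
    unfold pairing
    have e0 : ∀ z : ℝ × ℝ, f z.1 z.2 * cos (k * z.1 + θ) * cos (l * z.2 + η) =
        (cos θ * cos η) * (f z.1 z.2 * cos (k * z.1) * cos (l * z.2))
        - (sin θ * cos η) * (f z.1 z.2 * sin (k * z.1) * cos (l * z.2))
        - (cos θ * sin η) * (f z.1 z.2 * cos (k * z.1) * sin (l * z.2))
        + (sin θ * sin η) * (f z.1 z.2 * sin (k * z.1) * sin (l * z.2)) := by
      intro z
      simp only [Real.cos_add]
      ring
    simp_rw [e0]
    have j1 := i1.const_mul (cos θ * cos η)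
    have j2 := i2.const_mul (sin θ * cos η)
    have j3 := i3.const_mul (cos θ * sin η)
    have j4 := i4.const_mul (sin θ * sin η)
    rw [integral_add (by exact (j1.sub j2).sub j3) j4, integral_sub (by exact j1.sub j2) j3,
      integral_sub j1 j2, integral_const_mul, integral_const_mul, integral_const_mul,
      integral_const_mul]
  rw [e, hcc, hsc, hcs, hss]
  ring

/-- The Riemann–Lebesgue lemma for cosine coefficients. -/
theorem tendsto_integral_mul_cos {G : ℝ → ℝ} (hG : Integrable G periodMeasure) :
    Filter.Tendsto (fun k : ℕ => ∫ x, G x * cos (k * x) ∂periodMeasure) Filter.atTop (nhds 0) := by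
  have hw : Filter.Tendsto (fun k : ℕ => (k : ℝ) * (1 / (2 * π))) Filter.atTop
      (Filter.cocompact ℝ) :=
    (tendsto_natCast_atTop_atTop.atTop_mul_const (by positivity)).mono_right
      atTop_le_cocompact
  have h := (Real.tendsto_integral_exp_smul_cocompact
    (fun x => (((Set.Ioc 0 (2 * π)).indicator G x : ℝ) : ℂ))).comp hw
  have h2 := (Complex.continuous_re.tendsto 0).comp h
  simp only [Complex.zero_re] at h2
  refine h2.congr fun k => ?_
  simp only [Function.comp]
  have hi : Integrable (Set.indicator (Set.Ioc 0 (2 * π)) G) :=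
    (integrable_indicator_iff measurableSet_Ioc).2 hG
  have e : ∀ v : ℝ, (Real.fourierChar (-(v * (k * (1 / (2 * π)))))) •
      (((Set.Ioc 0 (2 * π)).indicator G v : ℝ) : ℂ) =
      Complex.exp (((-(k * v) : ℝ) : ℂ) * Complex.I) *
        (((Set.Ioc 0 (2 * π)).indicator G v : ℝ) : ℂ) := by
    intro v
    rw [Circle.smul_def, Real.fourierChar_apply, smul_eq_mul]
    congr 4
    field_simp
  have hint : Integrable fun v : ℝ => Complex.exp (((-(k * v) : ℝ) : ℂ) * Complex.I) *
        (((Set.Ioc 0 (2 * π)).indicator G v : ℝ) : ℂ) := by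
    refine Integrable.bdd_mul (c := 1) hi.ofReal ?_ (.of_forall fun v => ?_)
    · exact Continuous.aestronglyMeasurable (by fun_prop)
    · rw [Complex.norm_exp_ofReal_mul_I]
  simp_rw [e]
  have := integral_re (𝕜 := ℂ) hint
  simp only [RCLike.re_eq_complex_re] at this
  rw [← this, ← integral_indicator measurableSet_Ioc]
  congr 1; ext v
  rw [Complex.re_mul_ofReal, Complex.exp_ofReal_mul_I_re, Real.cos_neg]
  by_cases hv : v ∈ Set.Ioc 0 (2 * π)
  · rw [Set.indicator_of_mem hv, Set.indicator_of_mem hv, mul_comm]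
  · simp [hv]

theorem tsum_ofReal_sub {u : ℕ → ℝ} (hd : ∀ i, 0 ≤ u i - u (i + 1))
    (hu : Filter.Tendsto u Filter.atTop (nhds 0)) (k : ℕ) :
    0 ≤ u k ∧ ∑' i, ENNReal.ofReal (u (k + i) - u (k + i + 1)) = ENNReal.ofReal (u k) := by
  have hs : HasSum (fun i => u (k + i) - u (k + i + 1)) (u k) := by
    rw [hasSum_iff_tendsto_nat_of_nonneg fun i => hd _]
    have e : ∀ n, ∑ i ∈ Finset.range n, (u (k + i) - u (k + i + 1)) = u k - u (k + n) := by
      intro n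
      simpa [add_assoc] using Finset.sum_range_sub' (fun i => u (k + i)) n
    simp_rw [e]
    have h1 : Filter.Tendsto (fun n => u (k + n)) Filter.atTop (nhds 0) := by
      simp_rw [add_comm k]
      exact (Filter.tendsto_add_atTop_iff_nat k).2 hu
    simpa using h1.const_sub (u k)
  refine ⟨hs.nonneg fun i => hd _, ?_⟩
  rw [← ENNReal.ofReal_tsum_of_nonneg (fun i => hd _) hs.summable, hs.tsum_eq]

/-- The double sequence `A i j = a (i+1) (j+1)` of coefficients in `M_p`. -/
theorem InMclass.coeff_facts {p : ℝ} (hp : 1 < p) {f : ℝ → ℝ → ℝ} {a : ℕ → ℕ → ℝ}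
    (h : InMclass p f a) :
    (∀ i j, 0 ≤ a (i + 1) (j + 1)) ∧
    (∀ i j, a (i + 2) (j + 1) ≤ a (i + 1) (j + 1)) ∧
    (∀ i j, a (i + 1) (j + 2) ≤ a (i + 1) (j + 1)) ∧
    ∀ k l, ∑' i, ∑' j, ENNReal.ofReal (a (k + i + 1) (l + j + 1) - a (k + i + 2) (l + j + 1)
      - a (k + i + 1) (l + j + 2) + a (k + i + 2) (l + j + 2)) =
        ENNReal.ofReal (a (k + 1) (l + 1)) := by
  have hf := h.1.isPerInt hp
  have hpi : π ^ 2 ≠ 0 := by positivity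
  have hcc : ∀ k l : ℕ, 1 ≤ k → 1 ≤ l →
      π ^ 2 * a k l = ∫ z, f z.1 z.2 * cos (k * z.1) * cos (l * z.2) ∂squareMeasure := by
    intro k l hk hl
    simpa [pairing] using (h.pairing_cos_cos hp hk hl 0 0).symm
  have lim : ∀ u : ℕ → ℝ, Filter.Tendsto (fun k => π ^ 2 * u k) Filter.atTop (nhds 0) →
      Filter.Tendsto u Filter.atTop (nhds 0) := by
    intro u hu
    have := hu.const_mul (π ^ 2)⁻¹
    simpa [← mul_assoc, inv_mul_cancel₀ hpi] using this
  have t1 : ∀ l, 1 ≤ l → Filter.Tendsto (fun k => a k l) Filter.atTop (nhds 0) := by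
    intro l hl
    have hi := hf.integrable_mul_mul ⟨continuous_const, fun _ => rfl⟩ (isTest_cos' l)
      (φ := fun _ => 1)
    refine lim _ ((tendsto_integral_mul_cos hi.integral_prod_left).congr' ?_)
    filter_upwards [Filter.eventually_ge_atTop 1] with k hk
    rw [hcc k l hk hl, integral_prod _ (hf.integrable_mul_mul (isTest_cos' k) (isTest_cos' l))]
    congr 1; ext x
    rw [← integral_mul_const]
    congr 1; ext y; ring
  have t2 : ∀ k, 1 ≤ k → Filter.Tendsto (fun l => a k l) Filter.atTop (nhds 0) := by
    intro k hk
    have hi := hf.integrable_mul_mul (isTest_cos' k) ⟨continuous_const, fun _ => rfl⟩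
      (ψ := fun _ => 1)
    refine lim _ ((tendsto_integral_mul_cos hi.integral_prod_right).congr' ?_)
    filter_upwards [Filter.eventually_ge_atTop 1] with l hl
    rw [hcc k l hk hl,
      integral_prod_symm _ (hf.integrable_mul_mul (isTest_cos' k) (isTest_cos' l))]
    congr 1; ext y
    rw [← integral_mul_const]
    congr 1; ext x; ring
  have hc : ∀ i j, 0 ≤ a (i + 1) (j + 1) - a (i + 2) (j + 1) - a (i + 1) (j + 2)
      + a (i + 2) (j + 2) := fun i j => h.2.2.2 (i + 1) (j + 1) (by omega) (by omega)
  have s1 : ∀ l, 1 ≤ l → Filter.Tendsto (fun i => a (i + 1) l) Filter.atTop (nhds 0) :=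
    fun l hl => (Filter.tendsto_add_atTop_iff_nat 1).2 (t1 l hl)
  have s2 : ∀ k, 1 ≤ k → Filter.Tendsto (fun j => a k (j + 1)) Filter.atTop (nhds 0) :=
    fun k hk => (Filter.tendsto_add_atTop_iff_nat 1).2 (t2 k hk)
  have D : ∀ i l, 0 ≤ a (i + 1) (l + 1) - a (i + 2) (l + 1) ∧
      ∑' j, ENNReal.ofReal ((a (i + 1) (l + j + 1) - a (i + 2) (l + j + 1)) -
        (a (i + 1) (l + j + 2) - a (i + 2) (l + j + 2))) =
      ENNReal.ofReal (a (i + 1) (l + 1) - a (i + 2) (l + 1)) := by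
    intro i l
    refine tsum_ofReal_sub (u := fun j => a (i + 1) (j + 1) - a (i + 2) (j + 1))
      (fun j => ?_) ?_ l
    · linarith [hc i j]
    · simpa using (s2 (i + 1) (by omega)).sub (s2 (i + 2) (by omega))
  have E : ∀ i j, 0 ≤ a (i + 1) (j + 1) - a (i + 1) (j + 2) := by
    intro k j
    refine (tsum_ofReal_sub (u := fun i => a (i + 1) (j + 1) - a (i + 1) (j + 2))
      (fun i => ?_) ?_ k).1
    · linarith [hc i j]
    · simpa using (s1 (j + 1) (by omega)).sub (s1 (j + 2) (by omega))
  have T : ∀ k l, 0 ≤ a (k + 1) (l + 1) ∧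
      ∑' i, ENNReal.ofReal (a (k + i + 1) (l + 1) - a (k + i + 2) (l + 1)) =
        ENNReal.ofReal (a (k + 1) (l + 1)) := fun k l =>
    tsum_ofReal_sub (u := fun i => a (i + 1) (l + 1)) (fun i => (D i l).1)
      (s1 (l + 1) (by omega)) k
  refine ⟨fun i j => (T i j).1, fun i j => by linarith [(D i j).1],
    fun i j => by linarith [E i j], fun k l => ?_⟩
  rw [← (T k l).2]
  congr 1; ext i
  rw [← (D (k + i) l).2]
  congr 1; ext j
  congr 1; ring

theorem integral_mul_eq_zero_of_fourier {v : ℝ → ℝ} (hv : Integrable v periodMeasure)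
    (hc : ∀ k : ℕ, ∫ x, v x * cos (k * x) ∂periodMeasure = 0)
    (hs : ∀ k : ℕ, ∫ x, v x * sin (k * x) ∂periodMeasure = 0)
    (φ : C(AddCircle (2 * π), ℂ)) :
    ∫ x : ℝ, φ (x : AddCircle (2 * π)) * (v x : ℂ) ∂periodMeasure = 0 := by
  have : Fact (0 < 2 * π) := ⟨by positivity⟩
  have hint : ∀ φ : C(AddCircle (2 * π), ℂ),
      Integrable (fun x : ℝ => φ (x : AddCircle (2 * π)) * (v x : ℂ)) periodMeasure := by
    intro φ
    refine Integrable.bdd_mul (c := ‖φ‖) hv.ofReal ?_ (.of_forall fun x => φ.norm_coe_le_norm _)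
    exact (φ.continuous.comp (AddCircle.continuous_mk' (2 * π))).aestronglyMeasurable
  let L : C(AddCircle (2 * π), ℂ) →L[ℂ] ℂ := LinearMap.mkContinuous
    { toFun := fun φ => ∫ x : ℝ, φ (x : AddCircle (2 * π)) * (v x : ℂ) ∂periodMeasure
      map_add' := fun φ ψ => by
        rw [← integral_add (hint φ) (hint ψ)]
        congr 1; ext x; simp [add_mul]
      map_smul' := fun c φ => by
        rw [RingHom.id_apply, smul_eq_mul, ← integral_const_mul]
        congr 1; ext x; simp [mul_assoc] } (∫ x, ‖v x‖ ∂periodMeasure) (by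
      intro φ
      refine (norm_integral_le_integral_norm _).trans ?_
      rw [mul_comm (∫ x, ‖v x‖ ∂periodMeasure), ← integral_const_mul]
      refine integral_mono (hint φ).norm (hv.norm.const_mul _) fun x => ?_
      simp only [norm_mul, Complex.norm_real]
      gcongr
      exact φ.norm_coe_le_norm _)
  have hker : (Submodule.span ℂ (Set.range (@fourier (2 * π)))).topologicalClosure ≤
      LinearMap.ker L.toLinearMap := by
    refine Submodule.topologicalClosure_minimal _ ?_ L.isClosed_ker
    rw [Submodule.span_le]
    rintro _ ⟨n, rfl⟩
    change ∫ x : ℝ, fourier n (x : AddCircle (2 * π)) * (v x : ℂ) ∂periodMeasure = 0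
    have e : ∀ x : ℝ, fourier n (x : AddCircle (2 * π)) * (v x : ℂ) =
        ((v x * cos (n * x) : ℝ) : ℂ) + ((v x * sin (n * x) : ℝ) : ℂ) * Complex.I := by
      intro x
      rw [fourier_coe_apply, show 2 * (π:ℂ) * Complex.I * n * x / ((2 * π : ℝ) : ℂ) =
        ((n * x : ℝ) : ℂ) * Complex.I by push_cast; field_simp, Complex.exp_mul_I]
      push_cast; ring
    have ic : ∀ k : ℤ, Integrable (fun x => v x * cos (k * x)) periodMeasure := fun k =>
      hv.mul_bdd (c := 1) (Continuous.aestronglyMeasurable (by fun_prop))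
        (.of_forall fun x => Real.abs_cos_le_one _)
    have is : ∀ k : ℤ, Integrable (fun x => v x * sin (k * x)) periodMeasure := fun k =>
      hv.mul_bdd (c := 1) (Continuous.aestronglyMeasurable (by fun_prop))
        (.of_forall fun x => Real.abs_sin_le_one _)
    simp_rw [e]
    rw [integral_add (ic n).ofReal ((is n).ofReal.mul_const _), integral_mul_const,
      integral_complex_ofReal, integral_complex_ofReal]
    obtain ⟨m, rfl | rfl⟩ := n.eq_nat_or_neg
    · have h1 := hc m
      have h2 := hs m
      simp only [Int.cast_natCast]
      rw [h1, h2]; simp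
    · have h1 := hc m
      have h2 := hs m
      simp only [Int.cast_neg, Int.cast_natCast, neg_mul, Real.cos_neg, Real.sin_neg, mul_neg,
        integral_neg]
      rw [h1, h2]; simp
  rw [span_fourier_closure_eq_top] at hker
  exact hker (Submodule.mem_top : φ ∈ ⊤)

/-- Uniqueness of Fourier series in `L¹`. -/
theorem ae_eq_zero_of_fourier {v : ℝ → ℝ} (hv : Integrable v periodMeasure)
    (hc : ∀ k : ℕ, ∫ x, v x * cos (k * x) ∂periodMeasure = 0)
    (hs : ∀ k : ℕ, ∫ x, v x * sin (k * x) ∂periodMeasure = 0) :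
    v =ᵐ[periodMeasure] 0 := by
  have hpi : (0:ℝ) < 2 * π := by positivity
  have : Fact (0 < 2 * π) := ⟨hpi⟩
  have hv' : Integrable v (volume.restrict (Set.Ioo 0 (2 * π))) :=
    hv.mono_measure (Measure.restrict_mono Set.Ioo_subset_Ioc_self le_rfl)
  have key : ∀ᵐ x ∂volume, x ∈ Set.Ioo (0:ℝ) (2 * π) → v x = 0 := by
    refine isOpen_Ioo.ae_eq_zero_of_integral_contDiff_smul_eq_zero
      (IntegrableOn.locallyIntegrableOn hv') fun g hg _ hgs => ?_
    have hg0 : ∀ x ∉ Set.Ioo (0:ℝ) (2 * π), g x = 0 := fun x hx =>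
      image_eq_zero_of_notMem_tsupport fun h => hx (hgs h)
    have hcont : Continuous (AddCircle.liftIco (2 * π) 0 fun x => (g x : ℂ)) := by
      refine AddCircle.liftIco_zero_continuous ?_ ?_
      · simp [hg0]
      · have := hg.continuous
        exact Continuous.continuousOn (by fun_prop)
    have h := integral_mul_eq_zero_of_fourier hv hc hs ⟨_, hcont⟩
    have e1 : ∫ x, g x • v x = ∫ x, g x * v x ∂periodMeasure := by
      rw [setIntegral_eq_integral_of_forall_compl_eq_zero]
      · rfl
      · intro x hx
        rw [hg0 x fun h => hx (Set.Ioo_subset_Ioc_self h), zero_mul]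
    have e2 : ∫ x : ℝ, AddCircle.liftIco (2 * π) 0 (fun x => (g x : ℂ)) (x : AddCircle (2 * π)) *
        (v x : ℂ) ∂periodMeasure = ((∫ x, g x * v x ∂periodMeasure : ℝ) : ℂ) := by
      rw [← integral_complex_ofReal]
      refine setIntegral_congr_fun measurableSet_Ioc fun x hx => ?_
      rcases hx.2.lt_or_eq with h1 | h1
      · rw [AddCircle.liftIco_zero_coe_apply ⟨hx.1.le, h1⟩]; push_cast; rfl
      · have : (x : AddCircle (2 * π)) = ((0:ℝ) : AddCircle (2 * π)) := by
          rw [h1, AddCircle.coe_period]; rfl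
        rw [this, AddCircle.liftIco_zero_coe_apply ⟨le_rfl, hpi⟩, hg0 0 (by simp),
          hg0 x (by simp [h1])]
        simp
    rw [e1]
    have h3 : ((∫ x, g x * v x ∂periodMeasure : ℝ) : ℂ) = 0 := e2.symm.trans h
    exact_mod_cast h3
  rw [Filter.EventuallyEq, periodMeasure, ← restrict_Ioo_eq_restrict_Ioc,
    ae_restrict_iff' measurableSet_Ioo]
  exact key

/-- Uniqueness of double Fourier series. -/
theorem ae_eq_zero_of_pairing {u : ℝ → ℝ → ℝ} (hm : Measurable (Function.uncurry u))
    (hi : Integrable (Function.uncurry u) squareMeasure)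
    (h : ∀ (k l : ℕ) (θ η : ℝ),
      pairing u (fun x => cos (k * x + θ)) (fun y => cos (l * y + η)) = 0) :
    ∀ᵐ z ∂squareMeasure, u z.1 z.2 = 0 := by
  have hcos : ∀ (k : ℕ) (θ : ℝ), Integrable (fun z : ℝ × ℝ => u z.1 z.2 * cos (k * z.1 + θ))
      squareMeasure := fun k θ =>
    hi.mul_bdd (c := 1) (Continuous.aestronglyMeasurable (by fun_prop))
      (.of_forall fun x => Real.abs_cos_le_one _)
  have hcos2 : ∀ (k l : ℕ) (θ η : ℝ), Integrable
      (fun z : ℝ × ℝ => u z.1 z.2 * cos (k * z.1 + θ) * cos (l * z.2 + η)) squareMeasure :=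
    fun k l θ η =>
    (hcos k θ).mul_bdd (c := 1) (Continuous.aestronglyMeasurable (by fun_prop))
      (.of_forall fun x => Real.abs_cos_le_one _)
  have h1 : ∀ (k l : ℕ) (θ η : ℝ), ∫ y, (∫ x, u x y * cos (k * x + θ) ∂periodMeasure) *
      cos (l * y + η) ∂periodMeasure = 0 := by
    intro k l θ η
    rw [← h k l θ η, pairing, integral_prod_symm _ (hcos2 k l θ η)]
    simp_rw [integral_mul_const]
  have h2 : ∀ (k : ℕ) (θ : ℝ),
      ∀ᵐ y ∂periodMeasure, ∫ x, u x y * cos (k * x + θ) ∂periodMeasure = 0 := by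
    intro k θ
    refine ae_eq_zero_of_fourier (hcos k θ).integral_prod_right (fun l => ?_) (fun l => ?_)
    · simpa using h1 k l θ 0
    · simpa [Real.cos_sub_pi_div_two, ← sub_eq_add_neg] using h1 k l θ (-(π / 2))
  have h3 : ∀ᵐ y ∂periodMeasure, (fun x => u x y) =ᵐ[periodMeasure] 0 := by
    have hc := ae_all_iff.2 fun k => h2 k 0
    have hs := ae_all_iff.2 fun k => h2 k (-(π / 2))
    filter_upwards [hc, hs, hi.prod_left_ae] with y hc hs hy
    refine ae_eq_zero_of_fourier hy (fun k => ?_) (fun k => ?_)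
    · simpa using hc k
    · simpa [Real.cos_sub_pi_div_two, ← sub_eq_add_neg] using hs k
  have h4 : ∫⁻ z, ‖u z.1 z.2‖ₑ ∂squareMeasure = 0 := by
    have hm' : Measurable fun z : ℝ × ℝ => ‖u z.1 z.2‖ₑ := hm.enorm
    rw [lintegral_prod_symm' _ hm', lintegral_eq_zero_iff' hm'.lintegral_prod_left'.aemeasurable]
    filter_upwards [h3] with y hy
    refine (lintegral_congr_ae (g := fun _ => 0) ?_).trans (by simp)
    filter_upwards [hy] with x hx
    simpa using hx
  filter_upwards [(lintegral_eq_zero_iff hm.enorm).1 h4] with z hz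
  simpa [Function.uncurry] using hz

/-- The factor by which the modulus of smoothness of order `α` with step `1/n` weights
the frequency `i + 1` in `L_p`. -/
def coeffWeight (p : ℝ) (n : ℕ) (α : ℝ) (i : ℕ) : ℝ≥0∞ :=
  ENNReal.ofReal (modWeight n α i) ^ p * freq i ^ (p - 2)

/-- The coefficient side of the equivalence, written as a single weighted sum. -/
def weightedSum (p α₁ α₂ : ℝ) (n₁ n₂ : ℕ) (a : ℕ → ℕ → ℝ) : ℝ≥0∞ :=
  ∑' i, ∑' j, ENNReal.ofReal (a (i + 1) (j + 1)) ^ p * coeffWeight p n₁ α₁ i *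
    coeffWeight p n₂ α₂ j

theorem isTest_sum_cos (l : ℕ → ℝ) (i : ℕ) :
    IsTest fun x => ∑ k ∈ Finset.range (i + 1), l k * cos ((k + 1) * x) := by
  refine ⟨by fun_prop, fun x => Finset.sum_congr rfl fun k _ => ?_⟩
  have := (isTest_cos' (k + 1)).per x
  push_cast at this
  rw [this]

theorem InMclass.pairing_sum_cos {p : ℝ} (hp : 1 < p) {f : ℝ → ℝ → ℝ} {a : ℕ → ℕ → ℝ}
    (h : InMclass p f a) (u v : ℕ → ℝ) (i j : ℕ) :
    pairing f (fun x => ∑ k ∈ Finset.range (i + 1), u k * cos ((k + 1) * x))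
      (fun y => ∑ l ∈ Finset.range (j + 1), v l * cos ((l + 1) * y)) =
      ∑ k ∈ Finset.range (i + 1), ∑ l ∈ Finset.range (j + 1),
        u k * v l * (π ^ 2 * a (k + 1) (l + 1)) := by
  have hf := h.1.isPerInt hp
  have hi : ∀ k l : ℕ, Integrable (fun z : ℝ × ℝ =>
      u k * v l * (f z.1 z.2 * cos (((k + 1 : ℕ) : ℝ) * z.1) * cos (((l + 1 : ℕ) : ℝ) * z.2)))
      squareMeasure := fun k l =>
    (hf.integrable_mul_mul (isTest_cos' (k + 1)) (isTest_cos' (l + 1))).const_mul _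
  have e : ∀ z : ℝ × ℝ, f z.1 z.2 * (∑ k ∈ Finset.range (i + 1), u k * cos ((k + 1) * z.1)) *
      (∑ l ∈ Finset.range (j + 1), v l * cos ((l + 1) * z.2)) =
      ∑ k ∈ Finset.range (i + 1), ∑ l ∈ Finset.range (j + 1), u k * v l *
        (f z.1 z.2 * cos (((k + 1 : ℕ) : ℝ) * z.1) * cos (((l + 1 : ℕ) : ℝ) * z.2)) := by
    intro z
    rw [mul_assoc, Finset.sum_mul_sum, Finset.mul_sum]
    refine Finset.sum_congr rfl fun k _ => ?_
    rw [Finset.mul_sum]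
    refine Finset.sum_congr rfl fun l _ => ?_
    push_cast; ring
  unfold pairing
  simp_rw [e]
  rw [integral_finsetSum _ fun k _ => integrable_finsetSum _ fun l _ => hi k l]
  refine Finset.sum_congr rfl fun k _ => ?_
  rw [integral_finsetSum _ fun l _ => hi k l]
  refine Finset.sum_congr rfl fun l _ => ?_
  rw [integral_const_mul]
  congr 1
  have := h.pairing_cos_cos hp (k := k + 1) (l := l + 1) (by omega) (by omega) 0 0
  simpa [pairing] using this

theorem ofReal_abs_pairing_le {g : ℝ → ℝ → ℝ} (hg : IsPerInt g) {φ ψ : ℝ → ℝ}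
    (hφ : IsTest φ) (hψ : IsTest ψ) :
    ENNReal.ofReal |pairing g φ ψ| ≤ ∫⁻ x, ∫⁻ y, ENNReal.ofReal |g x y| *
      ENNReal.ofReal |φ x| * ENNReal.ofReal |ψ y| ∂periodMeasure ∂periodMeasure := by
  have hm := hg.integrable_mul_mul hφ hψ
  rw [← Real.enorm_eq_ofReal_abs]
  refine (enorm_integral_le_lintegral_enorm _).trans ?_
  rw [lintegral_prod _ hm.1.enorm]
  refine le_of_eq ?_
  simp only [enorm_mul, Real.enorm_eq_ofReal_abs]

/-- Lower bound for the norm of the mixed difference with steps `1 / n₁` and `1 / n₂`. -/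
theorem exists_weightedSum_le {p α₁ α₂ : ℝ} (hp : 1 < p) (hα₁ : 0 < α₁) (hα₂ : 0 < α₂) :
    ∃ C : ℝ≥0∞, C ≠ ⊤ ∧ ∀ (f : ℝ → ℝ → ℝ) (a : ℕ → ℕ → ℝ) (n₁ n₂ : ℕ), 1 ≤ n₁ → 1 ≤ n₂ →
      InMclass p f a → weightedSum p α₁ α₂ n₁ n₂ a ≤
        C * Lp2Norm p (diffX α₁ (1 / n₁) (diffY α₂ (1 / n₂) f)) ^ p := by
  have hp0 : 0 < p := by linarith
  obtain ⟨C, hC, hmain⟩ := exists_tsum_tsum_lintegral_le hp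
  obtain ⟨c₁, hc₁, ht₁⟩ := exists_tester hα₁
  obtain ⟨c₂, hc₂, ht₂⟩ := exists_tester hα₂
  set K : ℝ≥0∞ := ENNReal.ofReal (π ^ 2 * c₁ * c₂) with hK
  have hK0 : K ≠ 0 := by
    rw [hK]; simp only [ne_eq, ENNReal.ofReal_eq_zero, not_le]; positivity
  have hKt : K ≠ ⊤ := ENNReal.ofReal_ne_top
  set B := (∑' ν, diffMajorantWeight α₁ ν) ^ p * (∑' ν, diffMajorantWeight α₂ ν) ^ p with hB
  have hBt : B ≠ ⊤ := ENNReal.mul_ne_top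
    (ENNReal.rpow_ne_top_of_nonneg hp0.le (tsum_diffMajorantWeight_ne_top hα₁))
    (ENNReal.rpow_ne_top_of_nonneg hp0.le (tsum_diffMajorantWeight_ne_top hα₂))
  have hKp0 : K ^ p ≠ 0 := by simp [hK0, hKt]
  have hKpt : K ^ p ≠ ⊤ := ENNReal.rpow_ne_top_of_nonneg hp0.le hKt
  refine ⟨(K ^ p)⁻¹ * (4 ^ p * (C * B)), ENNReal.mul_ne_top (ENNReal.inv_ne_top.2 hKp0)
    (ENNReal.mul_ne_top (ENNReal.rpow_ne_top_of_nonneg hp0.le (by simp))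
      (ENNReal.mul_ne_top hC hBt)), fun f a n₁ n₂ hn₁ hn₂ hf => ?_⟩
  have hfp := hf.1.isPerInt hp
  have hg := hfp.diffY hα₂ (1 / n₂)
  have hF := hg.diffX hα₁ (1 / n₁)
  set F := diffX α₁ (1 / n₁) (diffY α₂ (1 / n₂) f) with hFdef
  obtain ⟨a0, a1, a2, -⟩ := hf.coeff_facts hp
  have anti1 : ∀ j, Antitone fun i => a (i + 1) (j + 1) := fun j =>
    antitone_nat_of_succ_le fun i => a1 i j
  have anti2 : ∀ i, Antitone fun j => a (i + 1) (j + 1) := fun i =>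
    antitone_nat_of_succ_le fun j => a2 i j
  set I : ℕ → ℕ → ℝ≥0∞ := fun i j => ∫⁻ x, ∫⁻ y, ENNReal.ofReal |F x y| *
    diffMajorant α₁ (1 / n₁) i x * diffMajorant α₂ (1 / n₂) j y ∂periodMeasure ∂periodMeasure
    with hI
  have key : ∀ i j, K * (freq i * ENNReal.ofReal (modWeight n₁ α₁ i)) *
      (freq j * ENNReal.ofReal (modWeight n₂ α₂ j)) * ENNReal.ofReal (a (i + 1) (j + 1)) ≤
      4 * I i j := by
    intro i j
    obtain ⟨q, u, hq1, hq2, hq3, hq4, hq5, hq6⟩ := ht₁ n₁ i hn₁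
    obtain ⟨r, v, hr1, hr2, hr3, hr4, hr5, hr6⟩ := ht₂ n₂ j hn₂
    have e : pairing F q r = ∑ k ∈ Finset.range (i + 1), ∑ l ∈ Finset.range (j + 1),
        u k * v l * (π ^ 2 * a (k + 1) (l + 1)) := by
      rw [hFdef, pairing_diffX hg hα₁ _ ⟨hq1, hq2⟩ ⟨hr1, hr2⟩ hq5,
        pairing_diffY hfp hα₂ _ (isTest_sum_cos u i) ⟨hr1, hr2⟩ hr5, hf.pairing_sum_cos hp]
    have hle : π ^ 2 * c₁ * c₂ * (((i : ℝ) + 1) * modWeight n₁ α₁ i) *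
        (((j : ℝ) + 1) * modWeight n₂ α₂ j) * a (i + 1) (j + 1) ≤ pairing F q r := by
      have hw1 := modWeight_nonneg n₁ α₁ i
      have hw2 := modWeight_nonneg n₂ α₂ j
      calc _ = (c₁ * (((i : ℝ) + 1) * modWeight n₁ α₁ i)) *
            (c₂ * (((j : ℝ) + 1) * modWeight n₂ α₂ j)) * (π ^ 2 * a (i + 1) (j + 1)) := by ring
        _ ≤ (∑ k ∈ Finset.range (i + 1), u k) * (∑ l ∈ Finset.range (j + 1), v l) *
            (π ^ 2 * a (i + 1) (j + 1)) := by
          have := a0 i j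
          have h0 : 0 ≤ ∑ k ∈ Finset.range (i + 1), u k := Finset.sum_nonneg fun k _ => hq4 k
          gcongr
        _ = ∑ k ∈ Finset.range (i + 1), ∑ l ∈ Finset.range (j + 1),
            u k * v l * (π ^ 2 * a (i + 1) (j + 1)) := by
          rw [Finset.sum_mul_sum, Finset.sum_mul]
          refine Finset.sum_congr rfl fun k _ => ?_
          rw [Finset.sum_mul]
        _ ≤ _ := by
          rw [e]
          refine Finset.sum_le_sum fun k hk => Finset.sum_le_sum fun l hl => ?_
          have h1 : a (i + 1) (j + 1) ≤ a (k + 1) (l + 1) :=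
            (anti1 j (by have := Finset.mem_range.1 hk; omega : k ≤ i)).trans
              (anti2 k (by have := Finset.mem_range.1 hl; omega : l ≤ j))
          have := hq4 k
          have := hr4 l
          gcongr
    calc _ = ENNReal.ofReal (π ^ 2 * c₁ * c₂ * (((i : ℝ) + 1) * modWeight n₁ α₁ i) *
        (((j : ℝ) + 1) * modWeight n₂ α₂ j) * a (i + 1) (j + 1)) := by
          have hw1 := modWeight_nonneg n₁ α₁ i
          have hw2 := modWeight_nonneg n₂ α₂ j
          rw [ENNReal.ofReal_mul (by positivity), ENNReal.ofReal_mul (by positivity),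
            ENNReal.ofReal_mul (by positivity), freq_eq_ofReal, freq_eq_ofReal,
            ENNReal.ofReal_mul (p := (i : ℝ) + 1) (by positivity),
            ENNReal.ofReal_mul (p := (j : ℝ) + 1) (by positivity)]
      _ ≤ ENNReal.ofReal |pairing F q r| := ENNReal.ofReal_le_ofReal (hle.trans (le_abs_self _))
      _ ≤ _ := ofReal_abs_pairing_le hF ⟨hq1, hq2⟩ ⟨hr1, hr2⟩
      _ ≤ ∫⁻ x, ∫⁻ y, ENNReal.ofReal |F x y| * (2 * diffMajorant α₁ (1 / n₁) i x) *
            (2 * diffMajorant α₂ (1 / n₂) j y) ∂periodMeasure ∂periodMeasure :=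
          lintegral_mono fun x => lintegral_mono fun y =>
            mul_le_mul' (mul_le_mul' le_rfl (hq3 x)) (hr3 y)
      _ = 4 * I i j := by
          rw [hI]
          simp only
          rw [← lintegral_const_mul' _ _ (by simp)]
          congr 1; ext x
          rw [← lintegral_const_mul' _ _ (by simp)]
          congr 1; ext y
          ring
  have hG := hmain (diffMajorantWeight α₁) (diffMajorantWeight α₂)
    (diffMajorantShift α₁ (1 / n₁)) (diffMajorantShift α₂ (1 / n₂))
    (fun x y => ENNReal.ofReal |F x y|)
    (by have := hF.meas; exact (this.abs).ennreal_ofReal)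
    (fun y x => by simp only; rw [show F (x + 2 * π) y = F x y from hF.per_x y x])
    (fun x y => by simp only; rw [hF.per_y x y])
  have hnorm : Lp2Norm p F ^ p =
      ∫⁻ x, ∫⁻ y, ENNReal.ofReal |F x y| ^ p ∂periodMeasure ∂periodMeasure := by
    rw [Lp2Norm_eq hp0, ← ENNReal.rpow_mul, one_div, inv_mul_cancel₀ hp0.ne', ENNReal.rpow_one]
  have hsum : K ^ p * weightedSum p α₁ α₂ n₁ n₂ a ≤ 4 ^ p * (C * B * Lp2Norm p F ^ p) := by
    calc _ = ∑' i, ∑' j, freq i ^ (-2 : ℝ) * freq j ^ (-2 : ℝ) *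
          (K * (freq i * ENNReal.ofReal (modWeight n₁ α₁ i)) *
      (freq j * ENNReal.ofReal (modWeight n₂ α₂ j)) * ENNReal.ofReal (a (i + 1) (j + 1))) ^ p := by
          rw [weightedSum, ← ENNReal.tsum_mul_left]
          congr 1; ext i
          rw [← ENNReal.tsum_mul_left]
          congr 1; ext j
          have ef : ∀ i, freq i ^ (p - 2) = freq i ^ p * freq i ^ (-2 : ℝ) := fun i => by
            rw [← ENNReal.rpow_add _ _ (freq_ne_zero i) (freq_ne_top i)]; rfl
          simp only [ENNReal.mul_rpow_of_nonneg _ _ hp0.le, coeffWeight, ef]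
          ring
      _ ≤ ∑' i, ∑' j, freq i ^ (-2 : ℝ) * freq j ^ (-2 : ℝ) * (4 * I i j) ^ p :=
          ENNReal.tsum_le_tsum fun i => ENNReal.tsum_le_tsum fun j =>
            mul_le_mul' le_rfl (ENNReal.rpow_le_rpow (key i j) hp0.le)
      _ = 4 ^ p * ∑' i, ∑' j, freq i ^ (-2 : ℝ) * freq j ^ (-2 : ℝ) * I i j ^ p := by
          rw [← ENNReal.tsum_mul_left]
          congr 1; ext i
          rw [← ENNReal.tsum_mul_left]
          congr 1; ext j
          rw [ENNReal.mul_rpow_of_nonneg _ _ hp0.le]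
          ring
      _ ≤ _ := by
          refine mul_le_mul' le_rfl (hG.trans (le_of_eq ?_))
          rw [hnorm, hB]; ring
  calc weightedSum p α₁ α₂ n₁ n₂ a = (K ^ p)⁻¹ * (K ^ p * weightedSum p α₁ α₂ n₁ n₂ a) := by
        rw [← mul_assoc, ENNReal.inv_mul_cancel hKp0 hKpt, one_mul]
    _ ≤ (K ^ p)⁻¹ * (4 ^ p * (C * B * Lp2Norm p F ^ p)) := mul_le_mul' le_rfl hsum
    _ = _ := by ring

theorem exists_multiplier {α : ℝ} (hα : 0 < α) (h : ℝ) :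
    ∃ ρ ψ : ℕ → ℝ, ρ 0 = 0 ∧
      (∀ (k : ℕ) (θ x : ℝ), HasSum (fun ν : ℕ => diffCoeff α ν * cos (k * (x - (α - ν) * h) + θ))
        (ρ k * cos (k * x + (θ - ψ k)))) ∧
      ∀ i x, ∑' ν : ℕ, diffCoeff α ν * cosSum i (x + (α - ν) * h) =
        ∑ m ∈ Finset.range (i + 1), ρ (m + 1) * cos ((m + 1) * x + ψ (m + 1)) := by
  choose ρ ψ h1 h2 using fun k : ℕ => exists_hasSum_diffCoeff_twice hα (k * h)
  refine ⟨ρ, ψ, ?_, fun k θ x => ?_, fun i x => ?_⟩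
  · have e1 := (h1 0 (-ψ 0)).mul_left (ρ 0)
    have e2 := h2 0 (-ψ 0 - ψ 0)
    simp only [Nat.cast_zero, zero_mul, mul_zero, add_zero, sub_zero, neg_add_cancel, cos_zero,
      mul_one, zero_div, sin_zero, abs_zero, sub_add_cancel] at e1 e2
    rw [Real.zero_rpow (by positivity), zero_mul] at e2
    simp only [mul_left_comm (ρ 0)] at e1
    exact mul_self_eq_zero.1 (e1.unique e2)
  · have := h1 k (-(k * x + θ))
    rw [← Real.cos_neg (k * x + (θ - ψ k))]
    convert this using 2 with ν
    · rw [← Real.cos_neg]; congr 2; ring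
    · congr 1; ring
  · simp_rw [cosSum, Finset.mul_sum]
    refine (hasSum_sum fun m _ => ?_).tsum_eq
    have := h1 (m + 1) ((m + 1) * x)
    convert this using 4 with ν
    push_cast; ring

theorem integral_cos_int_mul_add (n : ℤ) (c : ℝ) :
    ∫ x, cos (n * x + c) ∂periodMeasure = if n = 0 then 2 * π * cos c else 0 := by
  rw [← intervalIntegral.integral_of_le (by positivity)]
  split_ifs with hn
  · simp [hn]
  · have hn' : (n : ℝ) ≠ 0 := by exact_mod_cast hn
    rw [intervalIntegral.integral_comp_mul_add (fun x => cos x) hn', integral_cos,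
      show (n : ℝ) * (2 * π) + c = c + n * (2 * π) by ring, Real.sin_add_int_mul_two_pi]
    simp

theorem integral_cos_mul_cos (m k : ℕ) (ψ θ : ℝ) :
    ∫ x, cos (((m + 1 : ℕ) : ℝ) * x + ψ) * cos (k * x + θ) ∂periodMeasure =
      if m + 1 = k then π * cos (ψ - θ) else 0 := by
  have e : ∀ x, cos (((m + 1 : ℕ) : ℝ) * x + ψ) * cos (k * x + θ) =
      2⁻¹ * (cos ((((m : ℤ) + 1 - k : ℤ) : ℝ) * x + (ψ - θ)) +
        cos ((((m : ℤ) + 1 + k : ℤ) : ℝ) * x + (ψ + θ))) := by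
    intro x
    have := Real.two_mul_cos_mul_cos (((m + 1 : ℕ) : ℝ) * x + ψ) (k * x + θ)
    have e1 : (((m : ℤ) + 1 - k : ℤ) : ℝ) * x + (ψ - θ) =
        ((m + 1 : ℕ) : ℝ) * x + ψ - (k * x + θ) := by push_cast; ring
    have e2 : (((m : ℤ) + 1 + k : ℤ) : ℝ) * x + (ψ + θ) =
        ((m + 1 : ℕ) : ℝ) * x + ψ + (k * x + θ) := by push_cast; ring
    rw [e1, e2]; linarith
  have hi : ∀ (n : ℤ) (c : ℝ), Integrable (fun x => cos (n * x + c)) periodMeasure := fun n c =>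
    (integrable_const (1:ℝ)).mono' (Continuous.aestronglyMeasurable (by fun_prop))
      (.of_forall fun x => Real.abs_cos_le_one _)
  simp_rw [e]
  rw [integral_const_mul, integral_add (hi _ _) (hi _ _), integral_cos_int_mul_add,
    integral_cos_int_mul_add, if_neg (by omega : ¬ ((m : ℤ) + 1 + k = 0))]
  by_cases h : m + 1 = k
  · rw [if_pos h, if_pos (by omega)]; ring
  · rw [if_neg h, if_neg (by omega)]; ring

theorem isTest_sum_cos_add (ρ ψ : ℕ → ℝ) (i : ℕ) :
    IsTest fun x => ∑ m ∈ Finset.range (i + 1), ρ (m + 1) * cos ((m + 1) * x + ψ (m + 1)) := by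
  refine ⟨by fun_prop, fun x => Finset.sum_congr rfl fun k _ => ?_⟩
  have := (isTest_cos (k + 1) (ψ (k + 1))).per x
  push_cast at this
  rw [this]

theorem integral_sum_cos_mul_cos {ρ ψ : ℕ → ℝ} (h0 : ρ 0 = 0) (i k : ℕ) (θ : ℝ) :
    ∫ x, (∑ m ∈ Finset.range (i + 1), ρ (m + 1) * cos ((m + 1) * x + ψ (m + 1))) *
      cos (k * x + θ) ∂periodMeasure =
      if k ≤ i + 1 then π * (ρ k * cos (θ - ψ k)) else 0 := by
  have hi : ∀ m : ℕ, Integrable (fun x => ρ (m + 1) *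
      (cos (((m + 1 : ℕ) : ℝ) * x + ψ (m + 1)) * cos (k * x + θ))) periodMeasure := fun m =>
    ((integrable_const (1:ℝ)).mono' (Continuous.aestronglyMeasurable (by fun_prop))
      (.of_forall fun x => by
        rw [norm_mul]
        exact mul_le_one₀ (Real.abs_cos_le_one _) (norm_nonneg _)
          (Real.abs_cos_le_one _))).const_mul _
  have e : ∀ x, (∑ m ∈ Finset.range (i + 1), ρ (m + 1) * cos ((m + 1) * x + ψ (m + 1))) *
      cos (k * x + θ) = ∑ m ∈ Finset.range (i + 1), ρ (m + 1) *
      (cos (((m + 1 : ℕ) : ℝ) * x + ψ (m + 1)) * cos (k * x + θ)) := by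
    intro x
    rw [Finset.sum_mul]
    refine Finset.sum_congr rfl fun m _ => ?_
    push_cast; ring
  simp_rw [e]
  rw [integral_finsetSum _ fun m _ => hi m]
  simp_rw [integral_const_mul, integral_cos_mul_cos]
  rcases Nat.eq_zero_or_pos k with rfl | hk
  · simp [h0]
  · obtain ⟨k, rfl⟩ := Nat.exists_eq_add_of_le' hk
    simp only [Nat.add_right_cancel_iff, mul_ite, mul_zero, Finset.sum_ite_eq', Finset.mem_range,
      Nat.lt_succ_iff, add_le_add_iff_right]
    split_ifs
    · rw [← Real.cos_neg]; ring_nf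
    · rfl

theorem integrable_tsum_and_pairing {ι : Type*} [Countable ι] {e : ι → ℝ → ℝ → ℝ}
    (hm : ∀ i, Measurable (Function.uncurry (e i)))
    (hs : ∑' i, ∫⁻ z, ‖e i z.1 z.2‖ₑ ∂squareMeasure ≠ ⊤) :
    Integrable (Function.uncurry fun x y => ∑' i, e i x y) squareMeasure ∧
    ∀ (k l : ℕ) (θ η : ℝ),
      pairing (fun x y => ∑' i, e i x y) (fun x => cos (k * x + θ)) (fun y => cos (l * y + η)) =
      ∑' i, pairing (e i) (fun x => cos (k * x + θ)) (fun y => cos (l * y + η)) := by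
  have hm' : ∀ i, Measurable fun z : ℝ × ℝ => e i z.1 z.2 := hm
  constructor
  · refine ⟨(Measurable.tsum hm').aestronglyMeasurable, ?_⟩
    refine lt_of_le_of_lt (b := ∫⁻ z : ℝ × ℝ, ∑' i, ‖e i z.1 z.2‖ₑ ∂squareMeasure)
      (lintegral_mono fun z => enorm_tsum_le_tsum_enorm) ?_
    rw [lintegral_tsum fun i => (hm' i).enorm.aemeasurable]
    exact hs.lt_top
  · intro k l θ η
    unfold pairing
    simp_rw [← tsum_mul_right]
    rw [integral_tsum]
    · intro i
      exact Measurable.aestronglyMeasurable (by fun_prop)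
    · refine ne_top_of_le_ne_top hs (ENNReal.tsum_le_tsum fun i => lintegral_mono fun z => ?_)
      rw [enorm_mul, enorm_mul]
      have hb : ∀ t, ‖cos t‖ₑ ≤ 1 := fun t => by
        rw [Real.enorm_eq_ofReal_abs]
        exact ENNReal.ofReal_le_one.2 (Real.abs_cos_le_one t)
      exact (mul_le_of_le_one_right' (hb _)).trans (mul_le_of_le_one_right' (hb _))

theorem tsum_shift_eq {c : ℕ → ℕ → ℝ} (hc : ∀ i j, 0 ≤ c i j) {k l : ℕ} {A : ℝ} (hA : 0 ≤ A)
    (h : ∑' i, ∑' j, ENNReal.ofReal (c (k + i) (l + j)) = ENNReal.ofReal A) :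
    ∑' q : ℕ × ℕ, (if k ≤ q.1 ∧ l ≤ q.2 then c q.1 q.2 else 0) = A := by
  have hinj : Function.Injective fun q : ℕ × ℕ => (k + q.1, l + q.2) := by
    rintro ⟨a, b⟩ ⟨a', b'⟩ h
    simpa using h
  rw [← hinj.tsum_eq]
  · simp only [le_add_iff_nonneg_right, zero_le, and_self, if_true]
    rw [← ENNReal.tsum_prod' (f := fun q : ℕ × ℕ => ENNReal.ofReal (c (k + q.1) (l + q.2)))] at h
    have := ENNReal.tsum_toReal_eq (f := fun q : ℕ × ℕ => ENNReal.ofReal (c (k + q.1) (l + q.2)))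
      fun _ => ENNReal.ofReal_ne_top
    rw [h, ENNReal.toReal_ofReal hA] at this
    rw [this]
    congr 1; ext q
    rw [ENNReal.toReal_ofReal (hc _ _)]
  · rintro ⟨i, j⟩ hq
    simp only [Function.mem_support, ne_eq, ite_eq_right_iff, Classical.not_imp] at hq
    exact ⟨(i - k, j - l), by simp [hq.1.1, hq.1.2]⟩

/-- The mixed second difference of a double sequence, indexed from `(1, 1)`. -/
abbrev mixedDiff (a : ℕ → ℕ → ℝ) (i j : ℕ) : ℝ :=
  a (i + 1) (j + 1) - a (i + 2) (j + 1) - a (i + 1) (j + 2) + a (i + 2) (j + 2)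

/-- The fractional difference of the kernel `cosSum i`. -/
abbrev diffCosSum (α h : ℝ) (i : ℕ) (x : ℝ) : ℝ :=
  ∑' ν : ℕ, diffCoeff α ν * cosSum i (x + (α - ν) * h)

theorem pairing_mul_mul (c : ℝ) (u v φ ψ : ℝ → ℝ) :
    pairing (fun x y => c * u x * v y) φ ψ =
      c * ((∫ x, u x * φ x ∂periodMeasure) * ∫ y, v y * ψ y ∂periodMeasure) := by
  rw [pairing, squareMeasure, ← integral_prod_mul, ← integral_const_mul]
  congr 1; ext z; ring

theorem pairing_const_mul_const_mul (g : ℝ → ℝ → ℝ) (φ ψ : ℝ → ℝ) (s t : ℝ) :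
    pairing g (fun x => s * φ x) (fun y => t * ψ y) = s * t * pairing g φ ψ := by
  rw [pairing, pairing, ← integral_const_mul]
  congr 1; ext z; ring

theorem IsTest.const_mul {φ : ℝ → ℝ} (h : IsTest φ) (c : ℝ) : IsTest fun x => c * φ x :=
  ⟨h.cont.const_smul c, fun x => by simp only [h.per x]⟩

/-- The mixed difference of `f` as a double series obtained by double Abel summation. -/
theorem InMclass.diff_ae_eq {p α₁ α₂ : ℝ} (hp : 1 < p) (hα₁ : 0 < α₁) (hα₂ : 0 < α₂)
    {f : ℝ → ℝ → ℝ} {a : ℕ → ℕ → ℝ} (hf : InMclass p f a) (h₁ h₂ : ℝ)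
    (hs : ∑' q : ℕ × ℕ, ∫⁻ z, ‖mixedDiff a q.1 q.2 * diffCosSum α₁ h₁ q.1 z.1 *
      diffCosSum α₂ h₂ q.2 z.2‖ₑ ∂squareMeasure ≠ ⊤) :
    ∀ᵐ z ∂squareMeasure, diffX α₁ h₁ (diffY α₂ h₂ f) z.1 z.2 =
      ∑' q : ℕ × ℕ, mixedDiff a q.1 q.2 * diffCosSum α₁ h₁ q.1 z.1 * diffCosSum α₂ h₂ q.2 z.2 := by
  have hfp := hf.1.isPerInt hp
  have hg := hfp.diffY hα₂ h₂
  have hF := hg.diffX hα₁ h₁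
  obtain ⟨ρ, ψ, hρ0, hρ1, hρ2⟩ := exists_multiplier hα₁ h₁
  obtain ⟨σ, χ, hσ0, hσ1, hσ2⟩ := exists_multiplier hα₂ h₂
  have hE : ∀ i, diffCosSum α₁ h₁ i = fun x => _ := fun i => funext fun x => hρ2 i x
  have hE' : ∀ i, diffCosSum α₂ h₂ i = fun x => _ := fun i => funext fun x => hσ2 i x
  have ht : ∀ i, IsTest (diffCosSum α₁ h₁ i) := fun i => by
    rw [hE]; exact isTest_sum_cos_add ρ ψ i
  have ht' : ∀ i, IsTest (diffCosSum α₂ h₂ i) := fun i => by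
    rw [hE']; exact isTest_sum_cos_add σ χ i
  obtain ⟨a0, -, -, a3⟩ := hf.coeff_facts hp
  set e : ℕ × ℕ → ℝ → ℝ → ℝ := fun q x y => mixedDiff a q.1 q.2 * diffCosSum α₁ h₁ q.1 x *
    diffCosSum α₂ h₂ q.2 y with he
  have hm : ∀ q, Measurable (Function.uncurry (e q)) := fun q => by
    have h1 := (ht q.1).cont.measurable
    have h2 := (ht' q.2).cont.measurable
    exact ((h1.comp measurable_fst).const_mul _).mul (h2.comp measurable_snd)
  obtain ⟨hHi, hHp⟩ := integrable_tsum_and_pairing hm hs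
  have hHm : Measurable (Function.uncurry fun x y => ∑' q, e q x y) := Measurable.tsum hm
  have hu : ∀ᵐ z ∂squareMeasure, diffX α₁ h₁ (diffY α₂ h₂ f) z.1 z.2 - ∑' q, e q z.1 z.2 = 0 := by
    refine ae_eq_zero_of_pairing
      (u := fun x y => diffX α₁ h₁ (diffY α₂ h₂ f) x y - ∑' q, e q x y)
      (hF.meas.sub hHm) (hF.int.sub hHi) fun k l θ η => ?_
    have e1 : pairing (fun x y => diffX α₁ h₁ (diffY α₂ h₂ f) x y - ∑' q, e q x y)
        (fun x => cos (k * x + θ)) (fun y => cos (l * y + η)) =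
        pairing (diffX α₁ h₁ (diffY α₂ h₂ f)) (fun x => cos (k * x + θ))
          (fun y => cos (l * y + η)) -
        pairing (fun x y => ∑' q, e q x y) (fun x => cos (k * x + θ))
          (fun y => cos (l * y + η)) := by
      simp only [pairing]
      rw [← integral_sub (hF.integrable_mul_mul (isTest_cos k θ) (isTest_cos l η))]
      · congr 1; ext z; ring
      · refine (hHi.mul_bdd (c := 1) (f := fun z : ℝ × ℝ => ∑' q, e q z.1 z.2)
          (g := fun z => cos (k * z.1 + θ)) (Continuous.aestronglyMeasurable (by fun_prop))
          (.of_forall fun x => Real.abs_cos_le_one _)).mul_bdd (c := 1)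
          (Continuous.aestronglyMeasurable (by fun_prop))
          (.of_forall fun x => Real.abs_cos_le_one _)
    rw [e1, sub_eq_zero, hHp,
      pairing_diffX hg hα₁ h₁ (isTest_cos k θ) (isTest_cos l η) (hρ1 k θ),
      pairing_diffY hfp hα₂ h₂ ((isTest_cos k _).const_mul _) (isTest_cos l η) (hσ1 l η),
      pairing_const_mul_const_mul]
    have e2 : ∀ q : ℕ × ℕ, pairing (e q) (fun x => cos (k * x + θ)) (fun y => cos (l * y + η)) =
        mixedDiff a q.1 q.2 * ((if k ≤ q.1 + 1 then π * (ρ k * cos (θ - ψ k)) else 0) *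
          (if l ≤ q.2 + 1 then π * (σ l * cos (η - χ l)) else 0)) := fun q => by
      rw [he]
      simp only
      rw [pairing_mul_mul, hE, hE', integral_sum_cos_mul_cos hρ0, integral_sum_cos_mul_cos hσ0]
    simp_rw [e2]
    rcases Nat.eq_zero_or_pos k with rfl | hk
    · simp [hρ0]
    rcases Nat.eq_zero_or_pos l with rfl | hl
    · simp [hσ0]
    rw [hf.pairing_cos_cos hp hk hl]
    obtain ⟨k, rfl⟩ := Nat.exists_eq_add_of_le' hk
    obtain ⟨l, rfl⟩ := Nat.exists_eq_add_of_le' hl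
    rw [← tsum_shift_eq (c := mixedDiff a)
      (fun i j => hf.2.2.2 (i + 1) (j + 1) (by omega) (by omega)) (a0 k l) (a3 k l)]
    simp only [add_le_add_iff_right]
    simp_rw [← tsum_mul_left]
    congr 1; ext q
    by_cases h1 : k ≤ q.1 <;> by_cases h2 : l ≤ q.2 <;> simp [h1, h2]
    ring
  filter_upwards [hu] with z hz
  exact sub_eq_zero.1 hz

theorem freq_mul_modWeight_le_sum (n : ℕ) {α : ℝ} (hα : 0 < α) (i : ℕ) :
    freq i * ENNReal.ofReal (modWeight n α i) ≤ ENNReal.ofReal (2 ^ (α + 1)) *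
      ∑ k ∈ Finset.range (i + 1), ENNReal.ofReal (modWeight n α k) := by
  rw [freq_eq_ofReal, ← ENNReal.ofReal_mul (by positivity),
    ← ENNReal.ofReal_sum_of_nonneg fun k _ => modWeight_nonneg n α k,
    ← ENNReal.ofReal_mul (by positivity)]
  exact ENNReal.ofReal_le_ofReal (mul_modWeight_le_sum n hα i)

theorem measurable_diffCosSum {α : ℝ} (hα : 0 < α) (h : ℝ) (i : ℕ) :
    Measurable (diffCosSum α h i) := by
  obtain ⟨ρ, ψ, -, -, hρ⟩ := exists_multiplier hα h
  rw [show diffCosSum α h i = _ from funext fun x => hρ i x]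
  exact (isTest_sum_cos_add ρ ψ i).cont.measurable

/-- Upper bound for the norm of a mixed difference by the weighted sum of coefficients. -/
theorem exists_Lp2Norm_rpow_le {p α₁ α₂ : ℝ} (hp : 1 < p) (hα₁ : 0 < α₁) (hα₂ : 0 < α₂) :
    ∃ C : ℝ≥0∞, C ≠ ⊤ ∧ ∀ (f : ℝ → ℝ → ℝ) (a : ℕ → ℕ → ℝ) (n₁ n₂ : ℕ), 1 ≤ n₁ → 1 ≤ n₂ →
      InMclass p f a → ∀ h₁ h₂ : ℝ, |h₁| ≤ 1 / n₁ → |h₂| ≤ 1 / n₂ →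
      Lp2Norm p (diffX α₁ h₁ (diffY α₂ h₂ f)) ^ p ≤ C * weightedSum p α₁ α₂ n₁ n₂ a := by
  have hp0 : 0 < p := by linarith
  obtain ⟨C, hC, hmain⟩ := exists_lintegral_tsum_tsum_le hp
  set B := C * ((∑' ν, diffMajorantWeight α₁ ν) ^ p * ENNReal.ofReal (2 ^ (α₁ + 1)) ^ p) *
    ((∑' ν, diffMajorantWeight α₂ ν) ^ p * ENNReal.ofReal (2 ^ (α₂ + 1)) ^ p) with hB
  have hBt : B ≠ ⊤ := by
    have h1 : ∀ {α : ℝ}, 0 < α →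
        (∑' ν, diffMajorantWeight α ν) ^ p * ENNReal.ofReal (2 ^ (α + 1)) ^ p ≠ ⊤ := fun hα =>
      ENNReal.mul_ne_top
        (ENNReal.rpow_ne_top_of_nonneg hp0.le (tsum_diffMajorantWeight_ne_top hα))
        (ENNReal.rpow_ne_top_of_nonneg hp0.le ENNReal.ofReal_ne_top)
    exact ENNReal.mul_ne_top (ENNReal.mul_ne_top hC (h1 hα₁)) (h1 hα₂)
  have h4 : (4 : ℝ≥0∞) ^ p ≠ ⊤ := ENNReal.rpow_ne_top_of_nonneg hp0.le (by simp)
  refine ⟨4 ^ p * B + 1, ENNReal.add_ne_top.2 ⟨ENNReal.mul_ne_top h4 hBt, by simp⟩,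
    fun f a n₁ n₂ hn₁ hn₂ hf h₁ h₂ hh₁ hh₂ => ?_⟩
  by_cases htop : weightedSum p α₁ α₂ n₁ n₂ a = ⊤
  · rw [htop, ENNReal.mul_top (by simp)]; exact le_top
  refine le_trans ?_ (mul_le_mul' le_self_add le_rfl)
  obtain ⟨-, -, -, a3⟩ := hf.coeff_facts hp
  have hc : ∀ i j, 0 ≤ mixedDiff a i j :=
    fun i j => hf.2.2.2 (i + 1) (j + 1) (by omega) (by omega)
  set e : ℕ × ℕ → ℝ → ℝ → ℝ := fun q x y => mixedDiff a q.1 q.2 * diffCosSum α₁ h₁ q.1 x *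
    diffCosSum α₂ h₂ q.2 y with he
  have hm : ∀ q, Measurable fun z : ℝ × ℝ => e q z.1 z.2 := fun q => by
    have h1 := measurable_diffCosSum hα₁ h₁ q.1
    have h2 := measurable_diffCosSum hα₂ h₂ q.2
    exact ((h1.comp measurable_fst).const_mul _).mul (h2.comp measurable_snd)
  set H : ℝ × ℝ → ℝ≥0∞ := fun z => ∑' q, ‖e q z.1 z.2‖ₑ with hH
  have hHm : Measurable H := Measurable.tsum fun q => (hm q).enorm
  have hHle : ∀ x y, H (x, y) ≤ 4 * ∑' i, ∑' j, ENNReal.ofReal (mixedDiff a i j) *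
      (ENNReal.ofReal (modWeight n₁ α₁ i) * diffMajorant α₁ h₁ i x) *
      (ENNReal.ofReal (modWeight n₂ α₂ j) * diffMajorant α₂ h₂ j y) := by
    intro x y
    rw [hH]
    simp only
    rw [ENNReal.tsum_prod' (f := fun q : ℕ × ℕ => ‖e q x y‖ₑ), ← ENNReal.tsum_mul_left]
    refine ENNReal.tsum_le_tsum fun i => ?_
    rw [← ENNReal.tsum_mul_left]
    refine ENNReal.tsum_le_tsum fun j => ?_
    rw [he]
    simp only
    rw [enorm_mul, enorm_mul, Real.enorm_eq_ofReal (hc i j), Real.enorm_eq_ofReal_abs,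
      Real.enorm_eq_ofReal_abs]
    refine (mul_le_mul' (mul_le_mul' le_rfl (ofReal_abs_diff_cosSum_le hα₁ hn₁ hh₁ i x))
      (ofReal_abs_diff_cosSum_le hα₂ hn₂ hh₂ j y)).trans (le_of_eq ?_)
    ring
  have hHp : ∫⁻ x, ∫⁻ y, H (x, y) ^ p ∂periodMeasure ∂periodMeasure ≤
      4 ^ p * B * weightedSum p α₁ α₂ n₁ n₂ a := by
    have hmain' := hmain (diffMajorantWeight α₁) (diffMajorantWeight α₂)
      (diffMajorantShift α₁ h₁) (diffMajorantShift α₂ h₂) _ _ _ _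
      (freq_mul_modWeight_le_sum n₁ hα₁) (freq_mul_modWeight_le_sum n₂ hα₂)
      (fun i j => ENNReal.ofReal (mixedDiff a i j))
    calc _ ≤ ∫⁻ x, ∫⁻ y, 4 ^ p * (∑' i, ∑' j, ENNReal.ofReal (mixedDiff a i j) *
      (ENNReal.ofReal (modWeight n₁ α₁ i) * diffMajorant α₁ h₁ i x) *
      (ENNReal.ofReal (modWeight n₂ α₂ j) * diffMajorant α₂ h₂ j y)) ^ p
          ∂periodMeasure ∂periodMeasure := by
          refine lintegral_mono fun x => lintegral_mono fun y => ?_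
          simp only
          rw [← ENNReal.mul_rpow_of_nonneg _ _ hp0.le]
          exact ENNReal.rpow_le_rpow (hHle x y) hp0.le
      _ ≤ 4 ^ p * (B * weightedSum p α₁ α₂ n₁ n₂ a) := by
          simp_rw [lintegral_const_mul' _ _ h4]
          refine mul_le_mul' le_rfl (hmain'.trans (le_of_eq ?_))
          rw [← hB, weightedSum]
          congr 1
          congr 1; ext k
          congr 1; ext l
          rw [← a3 k l]
          simp only [coeffWeight]
      _ = _ := by ring
  have hfp := hf.1.isPerInt hp
  have hF := (hfp.diffY hα₂ h₂).diffX hα₁ h₁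
  have hprod : ∫⁻ z, H z ^ p ∂squareMeasure =
      ∫⁻ x, ∫⁻ y, H (x, y) ^ p ∂periodMeasure ∂periodMeasure :=
    lintegral_prod _ (hHm.pow_const _).aemeasurable
  have hfin : ∫⁻ z, H z ^ p ∂squareMeasure ≠ ⊤ := by
    rw [hprod]
    exact ne_top_of_le_ne_top (ENNReal.mul_ne_top (ENNReal.mul_ne_top h4 hBt) htop) hHp
  have hs : ∑' q : ℕ × ℕ, ∫⁻ z, ‖e q z.1 z.2‖ₑ ∂squareMeasure ≠ ⊤ := by
    rw [← lintegral_tsum fun q => (hm q).enorm.aemeasurable]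
    refine ne_top_of_le_ne_top (b := ∫⁻ z, (1 + H z ^ p) ∂squareMeasure) ?_
      (lintegral_mono fun z => ?_)
    · rw [lintegral_add_left measurable_const]
      refine ENNReal.add_ne_top.2 ⟨?_, hfin⟩
      rw [lintegral_const, one_mul]
      exact measure_ne_top _ _
    · change H z ≤ 1 + H z ^ p
      rcases le_total (H z) 1 with h1 | h1
      · exact h1.trans le_self_add
      · refine le_trans ?_ le_add_self
        calc H z = H z ^ (1 : ℝ) := (ENNReal.rpow_one _).symm
          _ ≤ H z ^ p := ENNReal.rpow_le_rpow_of_exponent_le h1 hp.le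
  have hae := hf.diff_ae_eq hp hα₁ hα₂ h₁ h₂ hs
  rw [Lp2Norm_eq hp0, ← ENNReal.rpow_mul, one_div, inv_mul_cancel₀ hp0.ne', ENNReal.rpow_one]
  have hFm : Measurable fun z : ℝ × ℝ =>
      ENNReal.ofReal |diffX α₁ h₁ (diffY α₂ h₂ f) z.1 z.2| ^ p := by
    have : Measurable fun z : ℝ × ℝ => diffX α₁ h₁ (diffY α₂ h₂ f) z.1 z.2 := hF.meas
    exact (this.abs.ennreal_ofReal).pow_const _
  calc _ = ∫⁻ z, ENNReal.ofReal |diffX α₁ h₁ (diffY α₂ h₂ f) z.1 z.2| ^ p ∂squareMeasure :=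
        (lintegral_prod _ hFm.aemeasurable).symm
    _ ≤ ∫⁻ z, H z ^ p ∂squareMeasure := by
        refine lintegral_mono_ae ?_
        filter_upwards [hae] with z hz
        rw [hz, ← Real.enorm_eq_ofReal_abs]
        exact ENNReal.rpow_le_rpow enorm_tsum_le_tsum_enorm hp0.le
    _ ≤ _ := hprod.trans_le hHp

theorem coeffWeight_of_lt (p α : ℝ) {n i : ℕ} (h : i < n) :
    coeffWeight p n α i = ENNReal.ofReal ((n : ℝ) ^ (-α)) ^ p *
      ENNReal.ofReal (((i + 1 : ℕ) : ℝ) ^ ((α + 1) * p - 2)) := by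
  have hn : (0:ℝ) < n := by exact_mod_cast (Nat.zero_le i).trans_lt h
  have hi : (0:ℝ) < (i : ℝ) + 1 := by positivity
  have hle : ((i : ℝ) + 1) / n ≤ 1 := by
    rw [div_le_one hn]; exact_mod_cast h
  rw [coeffWeight, freq_rpow, modWeight, min_eq_left hle,
    ENNReal.ofReal_rpow_of_pos (by positivity), ENNReal.ofReal_rpow_of_pos (by positivity),
    ← ENNReal.ofReal_mul (by positivity), ← ENNReal.ofReal_mul (by positivity),
    Real.div_rpow hi.le hn.le, Real.div_rpow (by positivity) (by positivity), Real.rpow_neg hn.le,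
    Real.inv_rpow (by positivity), ← Real.rpow_mul hi.le,
    show (α + 1) * p - 2 = α * p + (p - 2) by ring, Nat.cast_succ, Real.rpow_add hi]
  congr 1; ring

theorem coeffWeight_add (p α : ℝ) {n : ℕ} (hn : 1 ≤ n) (k : ℕ) :
    coeffWeight p n α (k + n) = ENNReal.ofReal (((n + 1 + k : ℕ) : ℝ) ^ (p - 2)) := by
  have hn0 : (0:ℝ) < n := by exact_mod_cast hn
  have hle : 1 ≤ (((k + n : ℕ) : ℝ) + 1) / n := by
    rw [one_le_div hn0]; push_cast; linarith [Nat.cast_nonneg (α := ℝ) k]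
  rw [coeffWeight, freq_rpow, modWeight, min_eq_right hle, Real.one_rpow, ENNReal.ofReal_one,
    ENNReal.one_rpow, one_mul]
  congr 2; push_cast; ring

theorem mul_rpow_one_div {p : ℝ} (hp : 0 < p) (K S : ℝ≥0∞) :
    K * S ^ (1 / p) = (K ^ p * S) ^ (1 / p) := by
  rw [ENNReal.mul_rpow_of_nonneg _ _ (by positivity), ← ENNReal.rpow_mul, mul_one_div_cancel hp.ne',
    ENNReal.rpow_one]

theorem sum_Icc_one_eq_sum_range {M : Type*} [AddCommMonoid M] (g : ℕ → M) (n : ℕ) :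
    ∑ k ∈ Finset.Icc 1 n, g k = ∑ k ∈ Finset.range n, g (k + 1) := by
  rw [Finset.range_eq_Ico, Finset.sum_Ico_add' g 0 n 1]
  rfl

theorem weightedSum_and_Mfun_eq {p α₁ α₂ : ℝ} (hp : 0 < p) {a : ℕ → ℕ → ℝ} {n₁ n₂ : ℕ}
    (hn₁ : 1 ≤ n₁) (hn₂ : 1 ≤ n₂) (ha : ∀ i j, 0 ≤ a (i + 1) (j + 1)) :
    ∃ s : Fin 4 → ℝ≥0∞, weightedSum p α₁ α₂ n₁ n₂ a = s 0 + s 1 + (s 2 + s 3) ∧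
      Mfun a p α₁ α₂ n₁ n₂ =
        s 0 ^ (1 / p) + s 1 ^ (1 / p) + s 2 ^ (1 / p) + s 3 ^ (1 / p) := by
  set T : ℕ → ℕ → ℝ≥0∞ := fun i j => ENNReal.ofReal (a (i + 1) (j + 1)) ^ p *
    coeffWeight p n₁ α₁ i * coeffWeight p n₂ α₂ j with hT
  refine ⟨![∑ i ∈ Finset.range n₁, ∑ j ∈ Finset.range n₂, T i j,
    ∑ i ∈ Finset.range n₁, ∑' j, T i (j + n₂), ∑ j ∈ Finset.range n₂, ∑' i, T (i + n₁) j,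
    ∑' i, ∑' j, T (i + n₁) (j + n₂)], ?_, ?_⟩
  · have hj : ∀ i, ∑' j, T i j = ∑ j ∈ Finset.range n₂, T i j + ∑' j, T i (j + n₂) := fun i =>
      (ENNReal.summable.sum_add_tsum_nat_add' (f := T i)).symm
    change ∑' i, ∑' j, T i j = _
    rw [← ENNReal.summable.sum_add_tsum_nat_add' (k := n₁)]
    simp_rw [hj]
    rw [Finset.sum_add_distrib, ENNReal.tsum_add,
      Summable.tsum_finsetSum fun j _ => ENNReal.summable]
    rfl
  · have hpow : ∀ x y z : ℝ, 0 ≤ x → 0 ≤ y → ENNReal.ofReal (x ^ p * y * z) =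
        ENNReal.ofReal x ^ p * ENNReal.ofReal y * ENNReal.ofReal z := fun x y z hx hy => by
      rw [ENNReal.ofReal_mul (by positivity), ENNReal.ofReal_mul (by positivity),
        ENNReal.ofReal_rpow_of_nonneg hx hp.le]
    have ha' : ∀ i j, 0 ≤ a (n₁ + 1 + i) (j + 1) := fun i j => by
      have := ha (n₁ + i) j; rwa [show n₁ + i + 1 = n₁ + 1 + i by ring] at this
    have ha'' : ∀ i j, 0 ≤ a (i + 1) (n₂ + 1 + j) := fun i j => by
      have := ha i (n₂ + j); rwa [show n₂ + j + 1 = n₂ + 1 + j by ring] at this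
    have ha₄ : ∀ i j, 0 ≤ a (n₁ + 1 + i) (n₂ + 1 + j) := fun i j => by
      have := ha' i (n₂ + j); rwa [show n₂ + j + 1 = n₂ + 1 + j by ring] at this
    have e₁ : ∀ k, k + n₁ + 1 = n₁ + 1 + k := fun k => by ring
    have e₂ : ∀ k, k + n₂ + 1 = n₂ + 1 + k := fun k => by ring
    unfold Mfun
    simp only [sum_Icc_one_eq_sum_range, mul_rpow_one_div hp]
    simp only [Matrix.cons_val]
    congr 1; congr 1; congr 1
    · congr 1
      simp only [Finset.mul_sum]
      refine Finset.sum_congr rfl fun i hi => Finset.sum_congr rfl fun j hj => ?_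
      rw [hpow _ _ _ (ha i j) (by positivity), hT]
      simp only
      rw [coeffWeight_of_lt p α₁ (Finset.mem_range.1 hi),
        coeffWeight_of_lt p α₂ (Finset.mem_range.1 hj), ENNReal.ofReal_mul (by positivity),
        ENNReal.mul_rpow_of_nonneg _ _ hp.le]
      ring
    · congr 1
      simp only [Finset.mul_sum, ← ENNReal.tsum_mul_left]
      refine Finset.sum_congr rfl fun i hi => ?_
      congr 1; ext j
      rw [hpow _ _ _ (ha'' i j) (by positivity), hT]
      simp only
      rw [coeffWeight_of_lt p α₁ (Finset.mem_range.1 hi), coeffWeight_add p α₂ hn₂, e₂]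
      ring
    · congr 1
      simp only [Finset.mul_sum, ← ENNReal.tsum_mul_left]
      refine Finset.sum_congr rfl fun j hj => ?_
      congr 1; ext i
      rw [hpow _ _ _ (ha' i j) (by positivity), hT]
      simp only
      rw [coeffWeight_of_lt p α₂ (Finset.mem_range.1 hj), coeffWeight_add p α₁ hn₁, e₁]
      ring
    · congr 1
      congr 1; ext i
      congr 1; ext j
      rw [Nat.cast_mul, Real.mul_rpow (by positivity) (by positivity), ← mul_assoc,
        hpow _ _ _ (ha₄ i j) (by positivity), hT]
      simp only
      rw [coeffWeight_add p α₁ hn₁, coeffWeight_add p α₂ hn₂, e₁, e₂]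

/-- The single weighted sum is equivalent to the four-term quantity. -/
theorem weightedSum_rpow_equiv_Mfun {p α₁ α₂ : ℝ} (hp : 1 < p) {a : ℕ → ℕ → ℝ} {n₁ n₂ : ℕ}
    (hn₁ : 1 ≤ n₁) (hn₂ : 1 ≤ n₂) (ha : ∀ i j, 0 ≤ a (i + 1) (j + 1)) :
    weightedSum p α₁ α₂ n₁ n₂ a ^ (1 / p) ≤ Mfun a p α₁ α₂ n₁ n₂ ∧
      Mfun a p α₁ α₂ n₁ n₂ ≤ 4 * weightedSum p α₁ α₂ n₁ n₂ a ^ (1 / p) := by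
  have hp0 : 0 < p := by linarith
  have h0 : 0 ≤ 1 / p := by positivity
  have h1 : 1 / p ≤ 1 := by rw [div_le_one hp0]; exact hp.le
  obtain ⟨s, h, h'⟩ := weightedSum_and_Mfun_eq (α₁ := α₁) (α₂ := α₂) hp0 hn₁ hn₂ ha
  rw [h, h']
  constructor
  · rw [add_assoc (_ + _)]
    exact (ENNReal.rpow_add_le_add_rpow _ _ h0 h1).trans
      (add_le_add (ENNReal.rpow_add_le_add_rpow _ _ h0 h1)
        (ENNReal.rpow_add_le_add_rpow _ _ h0 h1))
  · calc _ ≤ (s 0 + s 1 + (s 2 + s 3)) ^ (1 / p) + (s 0 + s 1 + (s 2 + s 3)) ^ (1 / p) +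
        (s 0 + s 1 + (s 2 + s 3)) ^ (1 / p) + (s 0 + s 1 + (s 2 + s 3)) ^ (1 / p) := by
          refine add_le_add (add_le_add (add_le_add ?_ ?_) ?_) ?_ <;>
            refine ENNReal.rpow_le_rpow ?_ h0
          · exact le_self_add.trans le_self_add
          · exact le_add_self.trans le_self_add
          · exact le_self_add.trans le_add_self
          · exact le_add_self.trans le_add_self
      _ = _ := by ring

/-- For `f ∈ M_p`, the mixed modulus of smoothness is equivalent to the
weighted sums of its Fourier coefficients. -/
theorem modulus_vs_fourier_coefficients_Mclass (p α₁ α₂ : ℝ) (hp : 1 < p)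
    (hα₁ : 0 < α₁) (hα₂ : 0 < α₂) :
    ∃ C : ℝ, 0 < C ∧ ∀ (f : ℝ → ℝ → ℝ) (a : ℕ → ℕ → ℝ) (n₁ n₂ : ℕ),
      1 ≤ n₁ → 1 ≤ n₂ → InMclass p f a →
      mixedMod p α₁ α₂ (1/(n₁:ℝ)) (1/(n₂:ℝ)) f ≤
          ENNReal.ofReal C * Mfun a p α₁ α₂ n₁ n₂ ∧
      Mfun a p α₁ α₂ n₁ n₂ ≤
          ENNReal.ofReal C * mixedMod p α₁ α₂ (1/(n₁:ℝ)) (1/(n₂:ℝ)) f := by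
  have hp0 : 0 < p := by linarith
  obtain ⟨A, hA, hupper⟩ := exists_Lp2Norm_rpow_le hp hα₁ hα₂
  obtain ⟨B, hB, hlower⟩ := exists_weightedSum_le hp hα₁ hα₂
  have hroot : ∀ {X D Y : ℝ≥0∞}, X ^ p ≤ D * Y → X ≤ D ^ (1 / p) * Y ^ (1 / p) :=
    fun {X D Y} h => by
      rw [← ENNReal.mul_rpow_of_nonneg _ _ (by positivity)]
      simpa [← ENNReal.rpow_mul, mul_inv_cancel₀ hp0.ne'] using
        ENNReal.rpow_le_rpow h (by positivity : 0 ≤ 1 / p)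
  set D : ℝ≥0∞ := A ^ (1 / p) + 4 * B ^ (1 / p) with hD
  have hDt : D ≠ ⊤ := ENNReal.add_ne_top.2
    ⟨ENNReal.rpow_ne_top_of_nonneg (by positivity) hA,
      ENNReal.mul_ne_top (by simp) (ENNReal.rpow_ne_top_of_nonneg (by positivity) hB)⟩
  have hle : D ≤ ENNReal.ofReal (D.toReal + 1) := by
    rw [ENNReal.ofReal_add ENNReal.toReal_nonneg zero_le_one, ENNReal.ofReal_toReal hDt]
    exact le_self_add
  refine ⟨D.toReal + 1, by positivity, fun f a n₁ n₂ hn₁ hn₂ hf => ?_⟩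
  obtain ⟨hM₁, hM₂⟩ :=
    weightedSum_rpow_equiv_Mfun (α₁ := α₁) (α₂ := α₂) hp hn₁ hn₂ (hf.coeff_facts hp).1
  constructor
  · refine iSup_le fun h₁ => iSup_le fun hh₁ => iSup_le fun h₂ => iSup_le fun hh₂ => ?_
    refine (hroot (hupper f a n₁ n₂ hn₁ hn₂ hf h₁ h₂ hh₁ hh₂)).trans (mul_le_mul' ?_ hM₁)
    exact le_trans (hD ▸ le_self_add) hle
  · have habs : ∀ n : ℕ, |1 / (n : ℝ)| ≤ 1 / n := fun n => (abs_of_nonneg (by positivity)).le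
    calc _ ≤ 4 * weightedSum p α₁ α₂ n₁ n₂ a ^ (1 / p) := hM₂
      _ ≤ 4 * (B ^ (1 / p) * Lp2Norm p (diffX α₁ (1 / n₁) (diffY α₂ (1 / n₂) f))) := by
        refine mul_le_mul' le_rfl ?_
        have := ENNReal.rpow_le_rpow (hlower f a n₁ n₂ hn₁ hn₂ hf) (by positivity : 0 ≤ 1 / p)
        rwa [ENNReal.mul_rpow_of_nonneg _ _ (by positivity), ← ENNReal.rpow_mul _ p,
          mul_one_div_cancel hp0.ne', ENNReal.rpow_one] at this
      _ ≤ D * mixedMod p α₁ α₂ (1 / n₁) (1 / n₂) f := by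
        rw [← mul_assoc]
        refine mul_le_mul' (hD ▸ le_add_self) ?_
        exact le_iSup_of_le (1 / (n₁ : ℝ)) <| le_iSup_of_le (habs n₁) <|
          le_iSup_of_le (1 / (n₂ : ℝ)) <| le_iSup_of_le (habs n₂) le_rfl
      _ ≤ _ := mul_le_mul' hle le_rfl

end
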